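/- Let G be a finite minimal simple group. If G is biminimal non-nilpotent, then G is isomorphic to the alternating group A₅. -/

import Mathlib

/-- A group is *minimal non-nilpotent* if it is not nilpotent but every proper
subgroup of it is nilpotent. -/
def MinimalNonNilpotent (G : Type*) [Group G] : Prop :=
  ¬ Group.IsNilpotent G ∧ ∀ H : Subgroup G, H ≠ ⊤ → Group.IsNilpotent H

/-- A group is *biminimal non-nilpotent* if it is neither nilpotent nor minimal
non-nilpotent, but every proper subgroup of it is nilpotent or minimal non-nilpotent. -/
def BiminimalNonNilpotent (G : Type*) [Group G] : Prop :=
  ¬ Group.IsNilpotent G ∧ ¬ MinimalNonNilpotent G ∧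
    ∀ H : Subgroup G, H ≠ ⊤ → (Group.IsNilpotent H ∨ MinimalNonNilpotent H)

/-- A group is *para-Nil-Hamiltonian* if it is not nilpotent and every non-normal
subgroup of it is either nilpotent or minimal non-nilpotent. -/
def ParaNilHamiltonian (G : Type*) [Group G] : Prop :=
  ¬ Group.IsNilpotent G ∧
    ∀ H : Subgroup G, ¬ H.Normal → (Group.IsNilpotent H ∨ MinimalNonNilpotent H)

/-- A group is *meta-Nil-Hamiltonian* if every non-nilpotent subgroup of it is normal. -/
def MetaNilHamiltonian (G : Type*) [Group G] : Prop :=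
  ∀ H : Subgroup G, ¬ Group.IsNilpotent H → H.Normal

/-- A group is *locally graded* if every non-trivial finitely generated subgroup of it
contains a proper subgroup of finite index. -/
def LocallyGraded (G : Type*) [Group G] : Prop :=
  ∀ H : Subgroup G, H ≠ ⊥ → Group.FG H → ∃ K : Subgroup H, K ≠ ⊤ ∧ K.FiniteIndex

/-- A group is abelian if its multiplication commutes. -/
def Abelian (G : Type*) [Group G] : Prop := ∀ a b : G, a * b = b * a

/-- A group is *minimal non-abelian* if it is not abelian but every proper
subgroup of it is abelian. -/
def MinimalNonAbelian (G : Type*) [Group G] : Prop :=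
  ¬ Abelian G ∧ ∀ H : Subgroup G, H ≠ ⊤ → Abelian H

/-- A group is *biminimal non-abelian* if it is neither abelian nor minimal non-abelian,
but every proper subgroup of it is abelian or minimal non-abelian. -/
def BiminimalNonAbelian (G : Type*) [Group G] : Prop :=
  ¬ Abelian G ∧ ¬ MinimalNonAbelian G ∧
    ∀ H : Subgroup G, H ≠ ⊤ → (Abelian H ∨ MinimalNonAbelian H)

/-- A group is *parahamiltonian* if it is not abelian and every non-normal subgroup
of it is either abelian or minimal non-abelian. -/
def Parahamiltonian (G : Type*) [Group G] : Prop :=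
  ¬ Abelian G ∧ ∀ H : Subgroup G, ¬ H.Normal → (Abelian H ∨ MinimalNonAbelian H)

/-- A group is *locally nilpotent* if every finitely generated subgroup of it is nilpotent. -/
def LocallyNilpotent (G : Type*) [Group G] : Prop :=
  ∀ H : Subgroup G, Group.FG H → Group.IsNilpotent H

open Subgroup
open scoped commutatorElement

section Schmidt

/-- In a finite nilpotent group, elements of coprime prime-power orders commute. -/
theorem commute_of_isNilpotent_of_pow_eq_one {N : Type*} [Group N] [Finite N]
    (hN : Group.IsNilpotent N) {p q : ℕ} (hp : p.Prime) (hq : q.Prime) (hpq : p ≠ q)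
    {a b : N} {i j : ℕ} (ha : a ^ p ^ i = 1) (hb : b ^ q ^ j = 1) : Commute a b := by
  have := Fact.mk hp
  have := Fact.mk hq
  have key : ∀ (r : ℕ) (_ : Fact r.Prime) (c : N) (k : ℕ), c ^ r ^ k = 1 →
      ∃ R : Sylow r N, c ∈ R := by
    intro r hr c k hc
    have h : IsPGroup r (zpowers c) := by
      rw [IsPGroup.iff_orderOf]
      rintro ⟨g, hg⟩
      obtain ⟨n, rfl⟩ := mem_zpowers_iff.1 hg
      have : orderOf (c ^ n) ∣ r ^ k := by
        apply orderOf_dvd_of_pow_eq_one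
        rw [← zpow_natCast, ← zpow_mul, mul_comm, zpow_mul, zpow_natCast, hc, one_zpow]
      obtain ⟨l, -, hl⟩ := (Nat.dvd_prime_pow hr.out).1 this
      exact ⟨l, by rw [Subgroup.orderOf_mk, hl]⟩
    obtain ⟨R, hR⟩ := h.exists_le_sylow
    exact ⟨R, hR (mem_zpowers c)⟩
  obtain ⟨P, hP⟩ := key p inferInstance a i ha
  obtain ⟨Q, hQ⟩ := key q inferInstance b j hb
  exact commute_of_normal_of_disjoint (P : Subgroup N) Q inferInstance inferInstance
    (IsPGroup.disjoint_of_ne p q hpq _ _ P.2 Q.2) a b hP hQ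

/-- Elements of coprime prime-power orders inside a nilpotent subgroup commute. -/
theorem commute_of_mem_of_isNilpotent {M : Type*} [Group M] [Finite M] {H : Subgroup M}
    (hH : Group.IsNilpotent H) {p q : ℕ} (hp : p.Prime) (hq : q.Prime) (hpq : p ≠ q)
    {a b : M} (haH : a ∈ H) (hbH : b ∈ H) {i j : ℕ} (ha : a ^ p ^ i = 1) (hb : b ^ q ^ j = 1) :
    Commute a b := by
  have := commute_of_isNilpotent_of_pow_eq_one hH hp hq hpq (a := ⟨a, haH⟩) (b := ⟨b, hbH⟩)
    (Subtype.ext ha) (Subtype.ext hb)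
  exact congrArg Subtype.val this.eq

theorem exists_pow_eq_one_of_mem_sylow {M : Type*} [Group M] {p : ℕ} (P : Sylow p M) {a : M}
    (ha : a ∈ P) : ∃ i, a ^ p ^ i = 1 := by
  obtain ⟨i, hi⟩ := P.2 ⟨a, ha⟩
  exact ⟨i, congrArg Subtype.val hi⟩

theorem isPGroup_zpowers {M : Type*} [Group M] {p : ℕ} {a : M} {i : ℕ}
    (ha : a ^ p ^ i = 1) : IsPGroup p (zpowers a) := by
  rintro ⟨g, hg⟩
  obtain ⟨n, rfl⟩ := mem_zpowers_iff.1 hg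
  refine ⟨i, Subtype.ext ?_⟩
  change (a ^ n) ^ p ^ i = 1
  rw [← zpow_natCast, ← zpow_mul, mul_comm, zpow_mul, zpow_natCast, ha, one_zpow]

theorem exists_mem_sylow {M : Type*} [Group M] {p : ℕ} {a : M} {i : ℕ}
    (ha : a ^ p ^ i = 1) : ∃ P : Sylow p M, a ∈ P := by
  obtain ⟨R, hR⟩ := (isPGroup_zpowers ha).exists_le_sylow
  exact ⟨R, hR (mem_zpowers a)⟩

theorem eq_one_of_coprime_prime_pow {M : Type*} [Group M] {p q : ℕ} (hp : p.Prime) (hq : q.Prime)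
    (hpq : p ≠ q) {a : M} {i j : ℕ} (hi : a ^ p ^ i = 1) (hj : a ^ q ^ j = 1) : a = 1 := by
  have hc : (p ^ i).Coprime (q ^ j) := Nat.Coprime.pow _ _ ((Nat.coprime_primes hp hq).2 hpq)
  have := Nat.eq_one_of_dvd_coprimes hc (orderOf_dvd_of_pow_eq_one hi)
    (orderOf_dvd_of_pow_eq_one hj)
  exact orderOf_eq_one_iff.1 this

/-- A normal `p`-Sylow subgroup contains all `p`-elements. -/
theorem mem_sylow_of_normal {M : Type*} [Group M] [Finite M] {p : ℕ} [Fact p.Prime]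
    (P : Sylow p M) (hP : (P : Subgroup M).Normal) {a : M} {i : ℕ} (ha : a ^ p ^ i = 1) :
    a ∈ P := by
  obtain ⟨R, hR⟩ := exists_mem_sylow ha
  have := (P.unique_of_normal hP).instSubsingleton
  rwa [Subsingleton.elim P R]

/-- A normal subgroup `K` all of whose prime-to-`q` part is everything: in a finite soluble group
there are a prime `q` and a proper normal subgroup containing all elements of order prime
to `q`. -/
theorem exists_normal_containing_coprime (M : Type*) [Group M] [Finite M] [Nontrivial M]
    (hM : Group.IsSolvable M) :
    ∃ q : ℕ, q.Prime ∧ ∃ K : Subgroup M, K.Normal ∧ K ≠ ⊤ ∧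
      ∀ (a : M) (n : ℕ), n.Coprime q → a ^ n = 1 → a ∈ K := by
  have hlt := Group.IsSolvable.commutator_lt_top_of_nontrivial M
  have hnt : Nontrivial (Abelianization M) := by
    rw [Abelianization, QuotientGroup.nontrivial_iff]
    exact hlt.ne
  obtain ⟨q, hq, hdvd⟩ := Nat.exists_prime_and_dvd (Finite.one_lt_card (α := Abelianization M)).ne'
  have := Fact.mk hq
  refine ⟨q, hq, (powMonoidHom q : Abelianization M →* _).range.comap Abelianization.of,
    inferInstance, ?_, ?_⟩
  · intro htop
    obtain ⟨x, hx⟩ := exists_prime_orderOf_dvd_card' q hdvd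
    have hsurj : Function.Surjective (powMonoidHom q : Abelianization M →* _) := by
      intro z
      obtain ⟨m, rfl⟩ := QuotientGroup.mk_surjective z
      have : m ∈ (powMonoidHom q : Abelianization M →* _).range.comap Abelianization.of := by
        rw [htop]; trivial
      exact this
    have hinj := Finite.injective_iff_surjective.2 hsurj
    have : x = 1 := hinj (by simp [← hx, pow_orderOf_eq_one])
    rw [this, orderOf_one] at hx
    exact hq.one_lt.ne hx
  · intro a n hn ha
    rw [mem_comap]
    have hcop : (orderOf a).Coprime q := Nat.Coprime.coprime_dvd_left
      (orderOf_dvd_of_pow_eq_one ha) hn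
    obtain ⟨m, hm⟩ := exists_pow_eq_self_of_coprime hcop.symm
    refine ⟨Abelianization.of (a ^ m), ?_⟩
    rw [powMonoidHom_apply, ← map_pow, ← pow_mul, mul_comm, pow_mul, hm]

/-- Sylow subgroups commuting with all Sylow subgroups for other primes are normal. -/
theorem sylow_normal_of_commute {M : Type*} [Group M] [Finite M] {q : ℕ} [Fact q.Prime]
    (Q : Sylow q M)
    (h : ∀ p : ℕ, p.Prime → p ≠ q → ∀ (a b : M) (i j : ℕ), a ^ p ^ i = 1 → b ^ q ^ j = 1 →
      Commute a b) : (Q : Subgroup M).Normal := by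
  rw [← normalizer_eq_top_iff]
  rw [← index_eq_one]
  by_contra hne
  obtain ⟨p, hp, hdvd⟩ := Nat.exists_prime_and_dvd hne
  have := Fact.mk hp
  by_cases hpq : p = q
  · subst hpq
    exact Q.not_dvd_index (hdvd.trans (index_dvd_of_le le_normalizer))
  · obtain ⟨P⟩ : Nonempty (Sylow p M) := inferInstance
    have : (P : Subgroup M) ≤ normalizer (Q : Set M) := by
      intro a ha
      obtain ⟨i, hi⟩ := exists_pow_eq_one_of_mem_sylow P ha
      apply centralizer_le_normalizer
      rw [mem_centralizer_iff]
      intro b hb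
      obtain ⟨j, hj⟩ := exists_pow_eq_one_of_mem_sylow Q hb
      exact (h p hp hpq a b i j hi hj).symm.eq
    exact P.not_dvd_index (hdvd.trans (index_dvd_of_le this))

/-- The structure of soluble minimal non-nilpotent groups. -/
theorem MinimalNonNilpotent.exists_structure {M : Type*} [Group M] [Finite M]
    (hsol : Group.IsSolvable M) (hM : MinimalNonNilpotent M) :
    ∃ p q : ℕ, p.Prime ∧ q.Prime ∧ p ≠ q ∧ ∃ (P : Sylow p M) (y : M),
      (P : Subgroup M).Normal ∧ (∃ j, y ^ q ^ j = 1) ∧ (∀ u ∈ P, Commute u (y ^ q)) ∧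
      (∀ m : M, ∃ u ∈ P, ∃ k : ℕ, m = u * y ^ k) ∧ (∃ u ∈ P, ¬ Commute u y) ∧
      (∀ K : Subgroup M, K ≤ P → K ≠ P → (∀ u ∈ K, y * u * y⁻¹ ∈ K) →
        ∀ u ∈ K, Commute u y) ∧
      ∀ r : ℕ, r.Prime → r ≠ q → ∀ R : Sylow r M, (R : Subgroup M).Normal := by
  have hgen : ∀ p q : ℕ, p.Prime → q.Prime → p ≠ q → ∀ (a b : M) (i j : ℕ), a ^ p ^ i = 1 →
      b ^ q ^ j = 1 → ¬ Commute a b → ∀ H : Subgroup M, a ∈ H → b ∈ H → H = ⊤ := by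
    intro p q hp hq hpq a b i j ha hb hab H haH hbH
    by_contra hH
    exact hab (commute_of_mem_of_isNilpotent (hM.2 H hH) hp hq hpq haH hbH ha hb)
  have hnt : Nontrivial M := by
    by_contra h
    rw [not_nontrivial_iff_subsingleton] at h
    exact hM.1 inferInstance
  obtain ⟨q, hq, K, hKn, hK, hKq⟩ := exists_normal_containing_coprime M hsol
  have := Fact.mk hq
  have hKnil := hM.2 K hK
  have hnormal : ∀ p : ℕ, p.Prime → p ≠ q → ∀ P : Sylow p M, (P : Subgroup M).Normal := by
    intro p hp hpq P
    have := Fact.mk hp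
    have hPK : (P : Subgroup M) ≤ K := by
      intro a ha
      obtain ⟨i, hi⟩ := exists_pow_eq_one_of_mem_sylow P ha
      exact hKq a _ (Nat.Coprime.pow_left i ((Nat.coprime_primes hp hq).2 hpq)) hi
    have hn : ((P.subtype hPK : Sylow p K) : Subgroup K).Normal := inferInstance
    have hc := (P.subtype hPK).characteristic_of_normal hn
    have := ConjAct.normal_of_characteristic_of_normal (H := K)
      (K := ((P.subtype hPK : Sylow p K) : Subgroup K))
    rwa [Sylow.coe_subtype, subgroupOf_map_subtype, inf_eq_left.2 hPK] at this
  obtain ⟨p, hp, hpq, a, y, i, j, ha, hy, hay⟩ : ∃ p : ℕ, p.Prime ∧ p ≠ q ∧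
      ∃ (a y : M) (i j : ℕ), a ^ p ^ i = 1 ∧ y ^ q ^ j = 1 ∧ ¬ Commute a y := by
    by_contra! hcon
    apply hM.1
    refine (Group.isNilpotent_of_finite_tfae.out 0 3 rfl rfl).2 ?_
    intro p hp P
    by_cases hpq : p = q
    · subst hpq
      exact sylow_normal_of_commute P hcon
    · exact hnormal p hp.out hpq P
  have := Fact.mk hp
  obtain ⟨P⟩ : Nonempty (Sylow p M) := inferInstance
  have hPn := hnormal p hp hpq P
  have haP : a ∈ P := mem_sylow_of_normal P hPn ha
  have hzq : ∀ k : ℕ, (y ^ k) ^ q ^ j = 1 := fun k ↦ by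
    rw [← pow_mul, mul_comm, pow_mul, hy, one_pow]
  have hcover : ∀ z : M, (∃ u ∈ P, ¬ Commute u z) → z ^ q ^ j = 1 →
      ∀ m : M, ∃ u ∈ P, ∃ k : ℕ, m = u * z ^ k := by
    rintro z ⟨u, hu, huz⟩ hz m
    obtain ⟨i, hi⟩ := exists_pow_eq_one_of_mem_sylow P hu
    have htop := hgen p q hp hq hpq u z i j hi hz huz ((P : Subgroup M) ⊔ zpowers z)
      (mem_sup_left hu) (mem_sup_right (mem_zpowers z))
    have hm : m ∈ (P : Subgroup M) ⊔ zpowers z := by rw [htop]; trivial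
    rw [mem_sup_of_normal_left] at hm
    obtain ⟨u, hu, w, hw, rfl⟩ := hm
    obtain ⟨k, rfl⟩ := mem_powers_iff_mem_zpowers.2 hw
    exact ⟨u, hu, k, rfl⟩
  refine ⟨p, q, hp, hq, hpq, P, y, hPn, ⟨j, hy⟩, ?_, hcover y ⟨a, haP, hay⟩ hy,
    ⟨a, haP, hay⟩, ?_, hnormal⟩
  · by_contra! hcon
    obtain ⟨u, hu, hk⟩ := hcover (y ^ q) hcon (hzq q) y
    obtain ⟨k, hk⟩ := hk
    have hu1 : u = 1 := by
      obtain ⟨i, hi⟩ := exists_pow_eq_one_of_mem_sylow P hu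
      refine eq_one_of_coprime_prime_pow hp hq hpq hi (j := j) ?_
      have : u = y * (y ^ (q * k))⁻¹ := by rw [pow_mul, eq_mul_inv_iff_mul_eq, ← hk]
      rw [this, (Commute.inv_right (Commute.self_pow y _)).mul_pow, inv_pow, hzq, hy]
      simp
    rw [hu1, one_mul, ← pow_mul] at hk
    have hy1 : y ≠ 1 := by rintro rfl; exact hay (Commute.one_right a)
    have hmod : 1 ≡ q * k [MOD orderOf y] := by
      rw [← pow_eq_pow_iff_modEq, pow_one]; exact hk
    have hqy : q ∣ orderOf y := by
      obtain ⟨l, -, hl⟩ := (Nat.dvd_prime_pow hq).1 (orderOf_dvd_of_pow_eq_one hy)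
      rw [hl]
      refine dvd_pow_self q ?_
      rintro rfl
      rw [pow_zero, orderOf_eq_one_iff] at hl
      exact hy1 hl
    have := (hmod.of_dvd hqy).trans ((Nat.modEq_zero_iff_dvd).2 (dvd_mul_right q k))
    exact hq.one_lt.ne' (Nat.dvd_one.1 ((Nat.modEq_zero_iff_dvd).1 this))
  · intro L hLP hL hLy u hu
    by_contra huy
    obtain ⟨i, hi⟩ := exists_pow_eq_one_of_mem_sylow P (hLP hu)
    have hyL : y ∈ normalizer (L : Set M) := by
      exact mem_normalizer_fintype hLy
    apply hL
    refine le_antisymm hLP fun v hv ↦ ?_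
    have htop := hgen p q hp hq hpq u y i j hi hy huy (zpowers y ⊔ L)
      (mem_sup_right hu) (mem_sup_left (mem_zpowers y))
    have hv' : v ∈ zpowers y ⊔ L := by rw [htop]; trivial
    rw [← SetLike.mem_coe, coe_mul_of_left_le_normalizer_right _ _
      ((zpowers_le).2 hyL)] at hv'
    obtain ⟨w, hw, l, hl, rfl⟩ := hv'
    have hwP : w ∈ P := by
      have h : w * l * l⁻¹ ∈ (P : Subgroup M) := mul_mem hv (inv_mem (hLP hl))
      rwa [mul_inv_cancel_right] at h
    obtain ⟨k, rfl⟩ := mem_powers_iff_mem_zpowers.2 hw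
    obtain ⟨i', hi'⟩ := exists_pow_eq_one_of_mem_sylow P hwP
    have : y ^ k = 1 := eq_one_of_coprime_prime_pow hp hq hpq hi' (hzq k)
    simpa [this] using hl

end Schmidt

section Local

variable {G : Type*} [Group G]

/-- The `p`-elements of `H` form a subgroup. -/
def HasNormalSylow (p : ℕ) (H : Subgroup G) : Prop :=
  ∃ R ≤ H, IsPGroup p R ∧ ∀ a ∈ H, ∀ i, a ^ p ^ i = 1 → a ∈ R

/-- `H` is the product of its normal Sylow `p`-subgroup `P` and the cyclic `q`-group generated
by `y`, as in the structure theorem of Schmidt for minimal non-nilpotent groups. -/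
structure SchmidtData (p q : ℕ) (P H : Subgroup G) (y : G) : Prop where
  prime_left : p.Prime
  prime_right : q.Prime
  ne : p ≠ q
  le : P ≤ H
  isPGroup : IsPGroup p P
  mem_of_pow : ∀ a ∈ H, ∀ i, a ^ p ^ i = 1 → a ∈ P
  mem : y ∈ H
  pow_eq_one : ∃ j, y ^ q ^ j = 1
  commute_pow : ∀ u ∈ P, Commute u (y ^ q)
  exists_eq_mul : ∀ h ∈ H, ∃ u ∈ P, ∃ k : ℕ, h = u * y ^ k
  not_commute : ∃ u ∈ P, ¬ Commute u y
  commute_of_lt : ∀ K : Subgroup G, K ≤ P → K ≠ P → (∀ u ∈ K, y * u * y⁻¹ ∈ K) →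
    ∀ u ∈ K, Commute u y
  hasNormalSylow : ∀ r : ℕ, r.Prime → r ≠ q → HasNormalSylow r H

theorem HasNormalSylow.of_normal [Finite G] {p : ℕ} [Fact p.Prime] {H : Subgroup G}
    (h : ∀ R : Sylow p H, (R : Subgroup H).Normal) : HasNormalSylow p H := by
  obtain ⟨R⟩ : Nonempty (Sylow p H) := inferInstance
  refine ⟨(R : Subgroup H).map H.subtype, map_subtype_le _, R.2.map _, fun a ha i hi ↦ ?_⟩
  exact ⟨⟨a, ha⟩, mem_sylow_of_normal R (h R) (i := i) (Subtype.ext hi), rfl⟩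

theorem hasNormalSylow_of_isNilpotent [Finite G] {p : ℕ} [Fact p.Prime] {H : Subgroup G}
    (h : Group.IsNilpotent H) : HasNormalSylow p H :=
  .of_normal fun _ ↦ inferInstance

theorem IsPGroup.pow_eq_one {p : ℕ} {P : Subgroup G} (hP : IsPGroup p P) {a : G} (ha : a ∈ P) :
    ∃ i, a ^ p ^ i = 1 := by
  obtain ⟨i, hi⟩ := hP ⟨a, ha⟩
  exact ⟨i, congrArg Subtype.val hi⟩

theorem MinimalNonNilpotent.exists_schmidtData [Finite G] {H : Subgroup G}
    (hsol : Group.IsSolvable H) (hH : MinimalNonNilpotent H) :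
    ∃ p q P y, SchmidtData p q P H y := by
  obtain ⟨p, q, hp, hq, hpq, P, y, hPn, ⟨j, hj⟩, hcomm, hmul, ⟨w, hw, hwy⟩, hK, hr⟩ :=
    hH.exists_structure hsol
  have := Fact.mk hp
  refine ⟨p, q, (P : Subgroup H).map H.subtype, y, hp, hq, hpq, map_subtype_le _, P.2.map _,
    fun a ha i hi ↦ ⟨⟨a, ha⟩, mem_sylow_of_normal P hPn (i := i) (Subtype.ext hi), rfl⟩,
    y.2, ⟨j, congrArg Subtype.val hj⟩, ?_, ?_, ?_, ?_, ?_⟩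
  · rintro _ ⟨u, hu, rfl⟩
    exact (hcomm u hu).map H.subtype
  · intro h hh
    obtain ⟨u, hu, k, hk⟩ := hmul ⟨h, hh⟩
    exact ⟨u, ⟨u, hu, rfl⟩, k, congrArg Subtype.val hk⟩
  · exact ⟨w, ⟨w, hw, rfl⟩, fun h ↦ hwy (Subtype.ext h)⟩
  · intro K hKP hne hKy u hu
    have := hK (K.subgroupOf H) (fun v hv ↦ ?_) (fun h ↦ hne ?_) (fun v hv ↦ hKy v hv)
      ⟨u, map_subtype_le _ (hKP hu)⟩ hu
    · exact this.map H.subtype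
    · obtain ⟨v', hv', h⟩ := hKP hv
      rwa [← Subtype.ext h]
    · rw [← h, subgroupOf_map_subtype, left_eq_inf]
      exact hKP.trans (map_subtype_le _)
  · intro r hr' hrq
    have := Fact.mk hr'
    exact .of_normal (hr r hr' hrq)

theorem Sylow.exists_eq_zpowers [Finite G] {p : ℕ} [Fact p.Prime] {R : Sylow p G} {c : G}
    (h : (R : Subgroup G) = zpowers c) (P : Sylow p G) : ∃ c', (P : Subgroup G) = zpowers c' := by
  obtain ⟨g, rfl⟩ := MulAction.exists_smul_eq G R P
  refine ⟨g * c * g⁻¹, ?_⟩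
  rw [Sylow.coe_subgroup_smul, h]
  ext z
  simp only [mem_pointwise_smul_iff_inv_smul_mem, mem_zpowers_iff, MulAut.smul_def]
  refine exists_congr fun k ↦ ?_
  rw [conj_zpow, ← map_inv, MulAut.conj_apply, inv_inv]
  constructor
  · intro h; rw [h]; group
  · intro h; rw [← h]; group

namespace SchmidtData

variable {p q : ℕ} {P H : Subgroup G} {y : G}

theorem conj_mem (h : SchmidtData p q P H y) {a u : G} (ha : a ∈ H) (hu : u ∈ P) :
    a * u * a⁻¹ ∈ P := by
  obtain ⟨i, hi⟩ := h.isPGroup.pow_eq_one hu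
  exact h.mem_of_pow _ (mul_mem (mul_mem ha (h.le hu)) (inv_mem ha)) i (by rw [conj_pow, hi]; simp)

theorem mem_zpowers_of_pow (h : SchmidtData p q P H y) {R : Subgroup G} (hRH : R ≤ H)
    (hR : IsPGroup q R) (hy : y ∈ R) : R = zpowers y := by
  refine le_antisymm (fun a ha ↦ ?_) (zpowers_le.2 hy)
  obtain ⟨u, hu, k, rfl⟩ := h.exists_eq_mul a (hRH ha)
  have huR : u ∈ R := by simpa using mul_mem ha (inv_mem (pow_mem hy k))
  obtain ⟨i, hi⟩ := h.isPGroup.pow_eq_one hu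
  obtain ⟨j, hj⟩ := hR.pow_eq_one huR
  rw [eq_one_of_coprime_prime_pow h.prime_left h.prime_right h.ne hi hj, one_mul]
  exact pow_mem (mem_zpowers y) k

/-- A power of an element of `H` lies in `P`. -/
theorem exists_pow_mem (h : SchmidtData p q P H y) {a : G} (ha : a ∈ H) : ∃ j, a ^ q ^ j ∈ P := by
  obtain ⟨j, hj⟩ := h.pow_eq_one
  refine ⟨j, ?_⟩
  have hn : (P.subgroupOf H).Normal := ⟨fun u hu a ↦ h.conj_mem a.2 hu⟩
  obtain ⟨u, hu, k, rfl⟩ := h.exists_eq_mul a ha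
  have : (((⟨u, h.le hu⟩ * ⟨y, h.mem⟩ ^ k : H) : H ⧸ P.subgroupOf H)) ^ q ^ j = 1 := by
    have h1 : ((⟨u, h.le hu⟩ : H) : H ⧸ P.subgroupOf H) = 1 :=
      (QuotientGroup.eq_one_iff _).2 hu
    have h2 : (⟨y, h.mem⟩ : H) ^ q ^ j = 1 := Subtype.ext hj
    rw [QuotientGroup.mk_mul, h1, one_mul, ← QuotientGroup.mk_pow, ← pow_mul, mul_comm, pow_mul,
      h2, one_pow, QuotientGroup.mk_one]
  rw [← QuotientGroup.mk_pow, QuotientGroup.eq_one_iff] at this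
  exact this

/-- The order of an element of `H` is of the form `p ^ i * q ^ j`. -/
theorem eq_one_of_pow (h : SchmidtData p q P H y) {r : ℕ} (hr : r.Prime) (hrp : r ≠ p)
    (hrq : r ≠ q) {a : G} (ha : a ∈ H) {i : ℕ} (hi : a ^ r ^ i = 1) : a = 1 := by
  obtain ⟨j, hj⟩ := h.exists_pow_mem ha
  obtain ⟨k, hk⟩ := h.isPGroup.pow_eq_one hj
  have h1 : a ^ q ^ j = 1 := eq_one_of_coprime_prime_pow h.prime_left hr hrp.symm hk (j := i)
    (by rw [← pow_mul, mul_comm, pow_mul, hi, one_pow])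
  exact eq_one_of_coprime_prime_pow hr h.prime_right hrq hi h1

/-- The Sylow `q`-subgroup of `H` is not normal. -/
theorem not_hasNormalSylow (h : SchmidtData p q P H y) : ¬ HasNormalSylow q H := by
  rintro ⟨R, hRH, hR, hmem⟩
  obtain ⟨u, hu, huy⟩ := h.not_commute
  obtain ⟨j, hj⟩ := h.pow_eq_one
  have hyR := hmem y h.mem j hj
  have huH := h.le hu
  have h1 : u * y * u⁻¹ * y⁻¹ ∈ R := mul_mem (hmem _
    (mul_mem (mul_mem huH h.mem) (inv_mem huH)) j (by rw [conj_pow, hj]; simp)) (inv_mem hyR)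
  have h2 : u * y * u⁻¹ * y⁻¹ ∈ P := by
    have := mul_mem hu (h.conj_mem h.mem (inv_mem hu))
    simpa [mul_assoc] using this
  obtain ⟨i, hi⟩ := h.isPGroup.pow_eq_one h2
  obtain ⟨k, hk⟩ := hR.pow_eq_one h1
  have := eq_one_of_coprime_prime_pow h.prime_left h.prime_right h.ne hi hk
  apply huy
  rwa [mul_inv_eq_one, mul_inv_eq_iff_eq_mul] at this

/-- All `q`-subgroups of `H` are cyclic. -/
theorem exists_eq_zpowers [Finite G] (h : SchmidtData p q P H y) [Fact q.Prime] (R : Sylow q H) :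
    ∃ c : H, (R : Subgroup H) = zpowers c := by
  obtain ⟨j, hj⟩ := h.pow_eq_one
  obtain ⟨R', hR'⟩ := exists_mem_sylow (a := (⟨y, h.mem⟩ : H)) (p := q) (i := j) (Subtype.ext hj)
  refine Sylow.exists_eq_zpowers (R := R') (c := ⟨y, h.mem⟩) ?_ R
  have := h.mem_zpowers_of_pow (R := (R' : Subgroup H).map H.subtype) (map_subtype_le _)
    (R'.2.map _) ⟨_, hR', rfl⟩
  refine map_injective (subtype_injective H) ?_
  rw [this, MonoidHom.map_zpowers]
  rfl

end SchmidtData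

end Local

section SchmidtGroups

variable {G : Type*} [Group G]

/-- Finite perfect simple groups all of whose proper subgroups are nilpotent or have the
structure of a minimal non-nilpotent group. -/
structure IsSchmidtSimple (G : Type*) [Group G] : Prop where
  simple : IsSimpleGroup G
  commutator_eq_top : commutator G = ⊤
  nilpotent_or : ∀ H : Subgroup G, H ≠ ⊤ →
    Group.IsNilpotent H ∨ ∃ p q P y, SchmidtData p q P H y

theorem exists_mem_normalizer_of_lt [Finite G] {p : ℕ} [Fact p.Prime] {D P : Subgroup G}
    (hP : IsPGroup p P) (h : D < P) : ∃ x ∈ P, x ∉ D ∧ x ∈ normalizer (D : Set G) := by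
  have := hP.isNilpotent
  have hlt := Group.normalizerCondition_of_isNilpotent (G := P) (D.subgroupOf P) (by
    rw [lt_top_iff_ne_top, Ne, subgroupOf_eq_top]
    exact h.not_ge)
  obtain ⟨x, hx, hxD⟩ := SetLike.exists_of_lt hlt
  refine ⟨x, x.2, hxD, ?_⟩
  rw [mem_normalizer_iff] at hx ⊢
  intro d
  constructor
  · intro hd
    exact (hx ⟨d, h.le hd⟩).1 hd
  · intro hd
    have hdP : d ∈ P := by
      have := mul_mem (mul_mem (inv_mem x.2) (h.le hd)) x.2
      simpa [mul_assoc] using this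
    exact (hx ⟨d, hdP⟩).2 hd

theorem conj_mem_of_mem_normalizer {P : Subgroup G} {g x : G} (hg : g ∈ normalizer (P : Set G))
    (hx : x ∈ P) : g * x * g⁻¹ ∈ P :=
  (mem_normalizer_iff.1 hg x).1 hx

theorem mem_normalizer_zpowers_of_commute {g x : G} (h : Commute g x) :
    g ∈ normalizer (zpowers x : Set G) := by
  apply centralizer_le_normalizer
  rw [mem_centralizer_iff]
  rintro _ ⟨k, rfl⟩
  exact (h.zpow_right k).symm.eq

theorem HasNormalSylow.exists_sylow {p : ℕ} {H : Subgroup G} (h : HasNormalSylow p H) :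
    ∃ P : Sylow p G, ∀ a ∈ H, ∀ i, a ^ p ^ i = 1 → a ∈ P := by
  obtain ⟨R, -, hR, hmem⟩ := h
  obtain ⟨P, hP⟩ := hR.exists_le_sylow
  exact ⟨P, fun a ha i hi ↦ hP (hmem a ha i hi)⟩

/-- If normalizers of nontrivial `p`-subgroups have normal Sylow `p`-subgroups, then distinct
Sylow `p`-subgroups intersect trivially. -/
theorem sylow_inf_eq_bot [Finite G] {p : ℕ} [Fact p.Prime]
    (h : ∀ D : Subgroup G, IsPGroup p D → D ≠ ⊥ → HasNormalSylow p (normalizer (D : Set G)))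
    {P P' : Sylow p G} (hne : (P : Subgroup G) ⊓ P' ≠ ⊥) : P = P' := by
  suffices ∀ n : ℕ, ∀ P P' : Sylow p G, (P : Subgroup G) ⊓ P' ≠ ⊥ →
      Nat.card G - Nat.card ((P : Subgroup G) ⊓ P' : Subgroup G) = n → P = P' from
    this _ P P' hne rfl
  intro n
  induction n using Nat.strong_induction_on with
  | _ n ih =>
  intro P P' hD hn
  by_contra hPP
  set D := (P : Subgroup G) ⊓ P' with hDdef
  have hDp : IsPGroup p D := P.2.to_le inf_le_left
  obtain ⟨R, hR⟩ := (h D hDp hD).exists_sylow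
  have hDR : D ≤ R := fun d hd ↦ by
    obtain ⟨i, hi⟩ := hDp.pow_eq_one hd
    exact hR d (le_normalizer hd) i hi
  have key : ∀ S : Sylow p G, D < S → S = R := by
    intro S hS
    obtain ⟨x, hxS, hxD, hxN⟩ := exists_mem_normalizer_of_lt S.2 hS
    obtain ⟨i, hi⟩ := S.2.pow_eq_one hxS
    have hlt : D < (S : Subgroup G) ⊓ R :=
      lt_of_le_of_ne (le_inf hS.le hDR) fun h ↦ hxD (h ▸ ⟨hxS, hR x hxN i hi⟩)
    refine ih _ ?_ S R (ne_bot_of_gt hlt) rfl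
    rw [← hn]
    have h1 : Nat.card D < Nat.card ((S : Subgroup G) ⊓ R : Subgroup G) :=
      Set.ncard_lt_ncard (SetLike.coe_ssubset_coe.2 hlt)
    have h2 := card_le_card_group ((S : Subgroup G) ⊓ R : Subgroup G)
    omega
  have hlt1 : D < P := lt_of_le_of_ne inf_le_left fun h ↦ hPP (by
    rw [hDdef, inf_eq_left] at h
    exact Sylow.ext (P.3 P'.2 h).symm)
  have hlt2 : D < P' := lt_of_le_of_ne inf_le_right fun h ↦ hPP (by
    rw [hDdef, inf_eq_right] at h
    exact Sylow.ext (P'.3 P.2 h))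
  exact hPP ((key P hlt1).trans (key P' hlt2).symm)

/-- In a perfect group, a nontrivial Sylow subgroup whose normalizer controls fusion in it has
non-nilpotent normalizer. -/
theorem sylow_eq_bot_of_isNilpotent_normalizer [Finite G] {p : ℕ} [Fact p.Prime]
    (hperf : commutator G = ⊤) (P : Sylow p G)
    (hfus : ∀ x ∈ P, ∀ g : G, g * x * g⁻¹ ∈ P →
      ∃ n ∈ normalizer (P : Set G), g * x * g⁻¹ = n * x * n⁻¹)
    (hnil : Group.IsNilpotent (normalizer (P : Set G))) : (P : Subgroup G) = ⊥ := by
  set N := normalizer (P : Set G)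
  have hPN : (P : Subgroup G) ≤ N := le_normalizer
  have hfoc : (P : Subgroup G) ≤ ⁅(P : Subgroup G), N⁆ := by
    have h := commutator_inf_eq_focalSubgroup P
    rw [hperf, top_inf_eq] at h
    conv_lhs => rw [h]
    rw [focalSubgroup_def, closure_le]
    rintro _ ⟨hg, x, hx, u, rfl⟩
    have hx' : u * x⁻¹ * u⁻¹ ∈ (P : Subgroup G) := by
      have h : x⁻¹ * ⁅x, u⁆ ∈ (P : Subgroup G) := mul_mem (inv_mem hx) hg
      rw [commutatorElement_def] at h
      convert h using 1
      group
    obtain ⟨n, hn, hun⟩ := hfus x⁻¹ (inv_mem hx) u hx'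
    have : (⁅x, u⁆ : G) = ⁅x, n⁆ := by
      rw [commutatorElement_def, commutatorElement_def, mul_assoc, mul_assoc, ← mul_assoc u, hun,
        mul_assoc, mul_assoc, mul_assoc]
    rw [this]
    exact commutator_mem_commutator hx hn
  have hle : ∀ n, (P : Subgroup G) ≤ N.lowerCentralSeries n := by
    intro n
    induction n with
    | zero => exact hPN
    | succ n ih =>
      rw [Subgroup.lowerCentralSeries_succ]
      exact hfoc.trans (commutator_mono ih le_rfl)
  obtain ⟨n, hn⟩ := (isNilpotent_iff_lowerCentralSeries N).1 hnil
  exact le_bot_iff.1 (hn ▸ hle n)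

end SchmidtGroups

section SchmidtSimple

variable {G : Type*} [Group G]

namespace SchmidtData

variable {p q : ℕ} {P H : Subgroup G} {y : G}

theorem eq_one_of_commute [Finite G] (h : SchmidtData p q P H y)
    (hP : ∀ a ∈ P, ∀ b ∈ P, Commute a b)
    {u : G} (hu : u ∈ P) (huy : Commute u y) : u = 1 := by
  let φ : P →* G :=
    { toFun := fun v ↦ (v : G)⁻¹ * (y * v * y⁻¹)
      map_one' := by simp
      map_mul' := fun v w ↦ by
        have hw : Commute (w : G) ((v : G)⁻¹ * (y * v * y⁻¹)) :=
          hP _ w.2 _ (mul_mem (inv_mem v.2) (h.conj_mem h.mem v.2))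
        have := hw.inv_left.eq
        simp only [coe_mul, mul_inv_rev]
        calc (w : G)⁻¹ * (v : G)⁻¹ * (y * (v * w) * y⁻¹)
            = (w : G)⁻¹ * ((v : G)⁻¹ * (y * v * y⁻¹)) * (y * w * y⁻¹) := by group
          _ = _ := by rw [this]; group }
  have hφ : ∀ v, φ v = (v : G)⁻¹ * (y * v * y⁻¹) := fun v ↦ rfl
  have hle : φ.range ≤ P := by
    rintro _ ⟨v, rfl⟩
    exact mul_mem (inv_mem v.2) (h.conj_mem h.mem v.2)
  have hrange : φ.range = P := by
    by_contra hne
    obtain ⟨v, hv, hvy⟩ := h.not_commute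
    have hc := h.commute_of_lt φ.range hle hne (by
      rintro _ ⟨w, rfl⟩
      exact ⟨⟨y * w * y⁻¹, h.conj_mem h.mem w.2⟩, by simp only [hφ]; group⟩) _ ⟨⟨v, hv⟩, rfl⟩
    rw [hφ] at hc
    set c := v⁻¹ * (y * v * y⁻¹)
    have hcP : c ∈ P := hle ⟨⟨v, hv⟩, rfl⟩
    have hvc : y * v * y⁻¹ = v * c := by simp only [c]; group
    have hpow : ∀ n : ℕ, y ^ n * v * (y ^ n)⁻¹ = v * c ^ n := by
      intro n
      induction n with
      | zero => simp
      | succ n ih =>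
        have hcn : y * c ^ n * y⁻¹ = c ^ n := by
          rw [(hc.pow_left n).symm.eq, mul_inv_cancel_right]
        calc y ^ (n + 1) * v * (y ^ (n + 1))⁻¹ = y * (y ^ n * v * (y ^ n)⁻¹) * y⁻¹ := by
              rw [pow_succ']; group
          _ = (y * v * y⁻¹) * (y * c ^ n * y⁻¹) := by rw [ih]; group
          _ = v * c ^ (n + 1) := by 
              rw [hcn, hvc, pow_succ', mul_assoc]
    have hq := hpow q
    rw [(h.commute_pow v hv).symm.eq, mul_inv_cancel_right, left_eq_mul] at hq
    obtain ⟨i, hi⟩ := h.isPGroup.pow_eq_one hcP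
    have hc1 : c = 1 := eq_one_of_coprime_prime_pow h.prime_left h.prime_right h.ne hi (j := 1)
      (by rwa [pow_one])
    apply hvy
    rw [inv_mul_eq_one, eq_mul_inv_iff_mul_eq] at hc1
    exact hc1
  have hsurj : Function.Surjective (φ.codRestrict P fun v ↦ hle ⟨v, rfl⟩) := by
    rintro ⟨w, hw⟩
    rw [← hrange] at hw
    obtain ⟨v, hv⟩ := hw
    exact ⟨v, Subtype.ext hv⟩
  have hinj := Finite.injective_iff_surjective.2 hsurj
  have : (⟨u, hu⟩ : P) = 1 := hinj (Subtype.ext (by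
    simp only [MonoidHom.codRestrict_apply, hφ, map_one, OneMemClass.coe_one]
    rw [huy.symm.eq, mul_inv_cancel_right, inv_mul_cancel]))
  exact congrArg Subtype.val this

end SchmidtData

variable [Finite G] {p : ℕ} [Fact p.Prime]

theorem IsSchmidtSimple.ne_top_of_isPGroup (hG : IsSchmidtSimple G) {D : Subgroup G}
    (hD : IsPGroup p D) : D ≠ ⊤ := by
  rintro rfl
  have := hG.simple
  have h : Group.IsNilpotent (⊤ : Subgroup G) := hD.isNilpotent
  have h' : Group.IsNilpotent G := Group.isNilpotent_top.1 h
  exact (Group.IsSolvable.commutator_lt_top_of_nontrivial G).ne hG.commutator_eq_top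

theorem IsSchmidtSimple.normalizer_ne_top (hG : IsSchmidtSimple G) {D : Subgroup G}
    (hD : IsPGroup p D) (hD' : D ≠ ⊥) : normalizer (D : Set G) ≠ ⊤ := by
  have := hG.simple
  intro h
  rw [normalizer_eq_top_iff] at h
  exact (h.eq_bot_or_eq_top).elim hD' (hG.ne_top_of_isPGroup hD)

theorem IsSchmidtSimple.exists_eq_zpowers (hG : IsSchmidtSimple G) {D : Subgroup G}
    (hD : IsPGroup p D) (hD' : D ≠ ⊥) (h : ¬ HasNormalSylow p (normalizer (D : Set G)))
    (P : Sylow p G) : ∃ c, (P : Subgroup G) = zpowers c := by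
  obtain hnil | ⟨p', q, P', y, hS⟩ := hG.nilpotent_or _ (hG.normalizer_ne_top hD hD')
  · exact (h (hasNormalSylow_of_isNilpotent hnil)).elim
  obtain rfl : p = q := by
    by_contra hpq
    exact h (hS.hasNormalSylow p Fact.out hpq)
  set H := normalizer (D : Set G)
  have hDH : D ≤ H := le_normalizer
  obtain ⟨R, hR⟩ := (hD.comap_of_injective H.subtype (subtype_injective H)).exists_le_sylow
  obtain ⟨c, hc⟩ := hS.exists_eq_zpowers R
  obtain ⟨S, hRS⟩ := (R.2.map H.subtype).exists_le_sylow
  have hc' : (R : Subgroup H).map H.subtype = zpowers (c : G) := by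
    rw [hc, MonoidHom.map_zpowers]; rfl
  refine Sylow.exists_eq_zpowers (R := S) (c := c) ?_ P
  rw [← hc']
  by_contra hne
  obtain ⟨x, hxS, hxR, hxN⟩ := exists_mem_normalizer_of_lt S.2 (lt_of_le_of_ne hRS (Ne.symm hne))
  have hxH : x ∈ H := by
    refine mem_normalizer_fintype fun d hd ↦ ?_
    have hcR : (c : G) ∈ (R : Subgroup H).map H.subtype := hc' ▸ mem_zpowers _
    have h1 := conj_mem_of_mem_normalizer hxN hcR
    rw [hc'] at h1
    obtain ⟨k, hk⟩ := mem_zpowers_iff.1 h1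
    have h2 : d ∈ (R : Subgroup H).map H.subtype := ⟨⟨d, hDH hd⟩, hR hd, rfl⟩
    rw [hc'] at h2
    obtain ⟨l, rfl⟩ := mem_zpowers_iff.1 h2
    rw [← conj_zpow, ← hk, ← zpow_mul, mul_comm, zpow_mul]
    exact zpow_mem hd k
  have hSR : (S : Subgroup G).subgroupOf H = R :=
    R.3 (S.2.comap_of_injective H.subtype (subtype_injective H)) fun a ha ↦ hRS ⟨a, ha, rfl⟩
  exact hxR ⟨⟨x, hxH⟩, hSR ▸ hxS, rfl⟩

theorem IsSchmidtSimple.exists_schmidtData (hG : IsSchmidtSimple G) (P : Sylow p G)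
    (hP : (P : Subgroup G) ≠ ⊥) (hfus : ∀ x ∈ P, ∀ g : G, g * x * g⁻¹ ∈ P →
      ∃ n ∈ normalizer (P : Set G), g * x * g⁻¹ = n * x * n⁻¹) :
    ∃ q y, SchmidtData p q P (normalizer (P : Set G)) y := by
  have hnorm : ∀ a ∈ normalizer (P : Set G), ∀ i, a ^ p ^ i = 1 → a ∈ (P : Subgroup G) := by
    intro a ha i hi
    have hn : ((P.subtype le_normalizer : Sylow p (normalizer (P : Set G))) :
        Subgroup (normalizer (P : Set G))).Normal := normal_in_normalizer
    exact mem_sylow_of_normal _ hn (a := ⟨a, ha⟩) (i := i) (Subtype.ext hi)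
  obtain hnil | ⟨p', q, P', y, hS⟩ := hG.nilpotent_or _ (hG.normalizer_ne_top P.2 hP)
  · exact (hP (sylow_eq_bot_of_isNilpotent_normalizer hG.commutator_eq_top P hfus hnil)).elim
  have hpq : p ≠ q := by
    rintro rfl
    exact hS.not_hasNormalSylow ⟨P, le_normalizer, P.2, hnorm⟩
  obtain rfl : p = p' := by
    by_contra hpp
    refine hP ((eq_bot_iff_forall _).2 fun a ha ↦ ?_)
    obtain ⟨i, hi⟩ := P.2.pow_eq_one ha
    exact hS.eq_one_of_pow Fact.out hpp hpq (le_normalizer ha) hi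
  obtain rfl : P' = P := by
    refine le_antisymm (fun a ha ↦ ?_) fun a ha ↦ ?_
    · obtain ⟨i, hi⟩ := hS.isPGroup.pow_eq_one ha
      exact hnorm a (hS.le ha) i hi
    · obtain ⟨i, hi⟩ := P.2.pow_eq_one ha
      exact hS.mem_of_pow a (le_normalizer ha) i hi
  exact ⟨q, y, hS⟩

theorem IsSchmidtSimple.hasNormalSylow (hG : IsSchmidtSimple G) {D : Subgroup G}
    (hD : IsPGroup p D) (hD' : D ≠ ⊥) : HasNormalSylow p (normalizer (D : Set G)) := by
  by_contra hcon
  obtain ⟨P, hDP⟩ := hD.exists_le_sylow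
  have hP : (P : Subgroup G) ≠ ⊥ := fun h ↦ hD' (le_bot_iff.1 (h ▸ hDP))
  obtain ⟨c, hc⟩ := hG.exists_eq_zpowers hD hD' hcon P
  have hab : ∀ a ∈ (P : Subgroup G), ∀ b ∈ (P : Subgroup G), Commute a b := by
    rw [hc]
    rintro _ ⟨k, rfl⟩ _ ⟨l, rfl⟩
    exact (Commute.refl c).zpow_zpow k l
  have : IsMulCommutative P := ⟨⟨fun a b ↦ Subtype.ext (hab a a.2 b b.2)⟩⟩
  obtain ⟨q, y, hS⟩ := hG.exists_schmidtData P hP (fun x hx g hg ↦ by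
    obtain ⟨n, hn, h⟩ := P.conj_eq_normalizer_conj_of_mem x g⁻¹ hx (by simpa using hg)
    exact ⟨n⁻¹, inv_mem hn, by simpa using h⟩)
  have hcP : c ∈ (P : Subgroup G) := hc ▸ mem_zpowers c
  have hcp : c ^ p = 1 := by
    refine hS.eq_one_of_commute hab (pow_mem hcP p) ?_
    refine hS.commute_of_lt (zpowers (c ^ p)) (zpowers_le.2 (pow_mem hcP p)) (fun h ↦ ?_) ?_ _
      (mem_zpowers _)
    · have h1 : c ∈ zpowers (c ^ p) := h ▸ hcP
      obtain ⟨k, hk⟩ := mem_zpowers_iff.1 h1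
      obtain ⟨i, hi⟩ := P.2.pow_eq_one hcP
      have h2 : ∀ n, c = (c ^ p ^ n) ^ (k ^ n) := by
        intro n
        induction n with
        | zero => simp
        | succ n ih =>
          calc c = (((c ^ p ^ n) ^ k ^ n) ^ p) ^ k := by rw [← ih, hk]
            _ = _ := by
              simp only [← zpow_natCast, ← zpow_mul]
              push_cast
              ring_nf
      have h3 := h2 i
      rw [hi, one_zpow] at h3
      exact hP (by rw [hc, h3, zpowers_one_eq_bot])
    · intro u hu
      obtain ⟨k, rfl⟩ := mem_zpowers_iff.1 hu
      have h1 := hS.conj_mem hS.mem hcP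
      rw [hc] at h1
      obtain ⟨l, hl⟩ := mem_zpowers_iff.1 h1
      rw [← conj_zpow, ← conj_pow, ← hl]
      refine ⟨l * k, ?_⟩
      simp only [← zpow_natCast, ← zpow_mul]
      ring_nf
  have hcard : Nat.card P = p := by
    have : Nat.card P = orderOf c := by
      rw [← Nat.card_zpowers]
      exact Nat.card_congr (Equiv.subtypeEquivRight fun x ↦ by rw [← hc])
    rw [this]
    refine orderOf_eq_prime hcp ?_
    rintro rfl
    exact hP (by rw [hc, zpowers_one_eq_bot])
  have hDP' : D = P := by
    refine eq_of_le_of_card_ge hDP ?_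
    have h1 := card_dvd_of_le hDP
    change Nat.card D ∣ Nat.card P at h1
    change Nat.card P ≤ _
    rw [hcard] at h1 ⊢
    obtain h | h := (Nat.dvd_prime Fact.out).1 h1
    · exact (hD' (card_eq_one.1 h)).elim
    · exact h.ge
  rw [hDP'] at hcon
  exact hcon ⟨P, le_normalizer, P.2, hS.mem_of_pow⟩

/-- Distinct Sylow `p`-subgroups intersect trivially. -/
theorem IsSchmidtSimple.mem_normalizer_of_conj_mem (hG : IsSchmidtSimple G) (P : Sylow p G)
    {x g : G} (hx : x ∈ P) (hx1 : x ≠ 1) (hg : g * x * g⁻¹ ∈ P) :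
    g ∈ normalizer (P : Set G) := by
  rw [← Sylow.smul_eq_iff_mem_normalizer]
  refine sylow_inf_eq_bot (fun D ↦ hG.hasNormalSylow) fun h ↦ hx1 ?_
  have h1 : g * x * g⁻¹ ∈ ((g • P : Sylow p G) : Subgroup G) ⊓ P := by
    refine ⟨?_, hg⟩
    rw [Sylow.coe_subgroup_smul]
    exact smul_mem_pointwise_smul x (MulAut.conj g) _ hx
  rw [h, mem_bot] at h1
  simpa using h1

theorem IsSchmidtSimple.exists_schmidtData_normalizer (hG : IsSchmidtSimple G) (P : Sylow p G)
    (hP : (P : Subgroup G) ≠ ⊥) :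
    ∃ q y, SchmidtData p q P (normalizer (P : Set G)) y := by
  refine hG.exists_schmidtData P hP fun x hx g hg ↦ ?_
  by_cases hx1 : x = 1
  · exact ⟨1, one_mem _, by simp [hx1]⟩
  · exact ⟨g, hG.mem_normalizer_of_conj_mem P hx hx1 hg, rfl⟩

end SchmidtSimple

theorem SchmidtData.pow_prime_eq_one {G : Type*} [Group G] [Finite G] (hG : IsSchmidtSimple G)
    {p q : ℕ} {y : G}
    {P H : Subgroup G} (h : SchmidtData p q P H y) : y ^ q = 1 := by
  by_contra hy
  have := Fact.mk h.prime_right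
  obtain ⟨j, hj⟩ := h.pow_eq_one
  have hD : IsPGroup q (zpowers (y ^ q)) := isPGroup_zpowers (i := j) (by
    rw [← pow_mul, mul_comm, pow_mul, hj, one_pow])
  obtain ⟨R, hRH, hR, hmem⟩ := hG.hasNormalSylow hD (by rwa [Ne, zpowers_eq_bot])
  set N := normalizer (zpowers (y ^ q) : Set G)
  have hyN : y ∈ N := mem_normalizer_zpowers_of_commute (Commute.self_pow y q)
  have hPN : P ≤ N := fun u hu ↦ mem_normalizer_zpowers_of_commute (h.commute_pow u hu)
  obtain ⟨u, hu, huy⟩ := h.not_commute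
  have hyR := hmem y hyN j hj
  have h1 : u * y * u⁻¹ * y⁻¹ ∈ R := mul_mem (hmem _
    (mul_mem (mul_mem (hPN hu) hyN) (inv_mem (hPN hu))) j (by rw [conj_pow, hj]; simp))
      (inv_mem hyR)
  have h2 : u * y * u⁻¹ * y⁻¹ ∈ P := by
    have := mul_mem hu (h.conj_mem h.mem (inv_mem hu))
    simpa [mul_assoc] using this
  obtain ⟨i, hi⟩ := h.isPGroup.pow_eq_one h2
  obtain ⟨k, hk⟩ := hR.pow_eq_one h1
  have := eq_one_of_coprime_prime_pow h.prime_left h.prime_right h.ne hi hk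
  apply huy
  rwa [mul_inv_eq_one, mul_inv_eq_iff_eq_mul] at this

section Counting

variable {G : Type*} [Group G]

/-- The set of conjugates of elements of `D`. -/
def conjUnion (D : Set G) : Set G := {x | ∃ g, ∃ d ∈ D, g * d * g⁻¹ = x}

/-- The number of conjugates of elements of a trivial intersection set `D` with normalizer `H`. -/
theorem ncard_conjUnion_mul [Finite G] (D : Set G) (H : Subgroup G)
    (hinv : ∀ h ∈ H, ∀ d ∈ D, h * d * h⁻¹ ∈ D)
    (hTI : ∀ d ∈ D, ∀ g, g * d * g⁻¹ ∈ D → g ∈ H) :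
    (conjUnion D).ncard * Nat.card H = Nat.card G * D.ncard := by
  rw [← Nat.card_coe_set_eq, ← Nat.card_coe_set_eq, ← Nat.card_prod, ← Nat.card_prod]
  choose r d hd hr using fun u : conjUnion D ↦ u.2
  refine Nat.card_congr
    { toFun := fun x ↦ (r x.1 * x.2, ⟨(x.2 : G)⁻¹ * d x.1 * x.2, by
        simpa using hinv _ (inv_mem x.2.2) _ (hd x.1)⟩)
      invFun := fun x ↦ (⟨x.1 * x.2 * x.1⁻¹, x.1, x.2, x.2.2, rfl⟩,
        ⟨(r ⟨x.1 * x.2 * x.1⁻¹, x.1, x.2, x.2.2, rfl⟩)⁻¹ * x.1, by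
          refine hTI _ x.2.2 _ ?_
          have h := hr ⟨x.1 * x.2 * x.1⁻¹, x.1, x.2, x.2.2, rfl⟩
          have h' := hd ⟨x.1 * x.2 * x.1⁻¹, x.1, x.2, x.2.2, rfl⟩
          convert h' using 1
          rw [mul_inv_eq_iff_eq_mul, mul_assoc, inv_mul_eq_iff_eq_mul]
          rw [mul_inv_eq_iff_eq_mul] at h
          simp only at h
          rw [← mul_assoc (r _), h]
          group⟩)
      left_inv := ?_
      right_inv := ?_ }
  · rintro ⟨u, h⟩
    have h1 : r u * h * ((h : G)⁻¹ * d u * h) * (r u * h)⁻¹ = u := by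
      conv_rhs => rw [← hr u]
      group
    have h2 : (⟨r u * h * ((h : G)⁻¹ * d u * h) * (r u * h)⁻¹, _, _, by
      simpa using hinv _ (inv_mem h.2) _ (hd u), rfl⟩ : conjUnion D) = u := Subtype.ext h1
    simp only [Prod.mk.injEq]
    refine ⟨h2, Subtype.ext ?_⟩
    simp only [h2, inv_mul_cancel_left]
  · rintro ⟨g, e⟩
    have h := hr ⟨g * e * g⁻¹, g, e, e.2, rfl⟩
    simp only [Prod.mk.injEq, mul_inv_cancel_left, true_and]
    refine Subtype.ext ?_
    simp only [mul_inv_rev, inv_inv]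
    simp only at h
    calc _ = g⁻¹ * (r ⟨g * e * g⁻¹, g, e, e.2, rfl⟩ * d ⟨g * e * g⁻¹, g, e, e.2, rfl⟩ *
        (r ⟨g * e * g⁻¹, g, e, e.2, rfl⟩)⁻¹) * g := by group
      _ = e := by rw [h]; group

theorem IsPGroup.sq_le_card [Finite G] {p : ℕ} [hp : Fact p.Prime] {P K : Subgroup G}
    (hP : IsPGroup p P) (hK : K ≠ ⊥) (hKP : K < P) : p ^ 2 ≤ Nat.card P := by
  obtain ⟨n, hn⟩ := IsPGroup.iff_card.1 hP
  rw [hn]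
  refine Nat.pow_le_pow_right hp.out.pos ?_
  by_contra! h
  have h1 : Nat.card P ∣ p := by
    rw [hn]; exact (pow_dvd_pow p (by omega : n ≤ 1)).trans (by simp)
  have h2 := card_dvd_of_le hKP.le
  rcases (Nat.dvd_prime hp.out).1 (h2.trans h1) with h3 | h3
  · exact hK (card_eq_one.1 h3)
  · exact hKP.ne (eq_of_le_of_card_ge hKP.le (h3 ▸ Nat.le_of_dvd hp.out.pos h1))

theorem IsPGroup.le_card [Finite G] {p : ℕ} [hp : Fact p.Prime] {P : Subgroup G}
    (hP : IsPGroup p P) (h : P ≠ ⊥) : p ≤ Nat.card P := by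
  obtain ⟨n, hn⟩ := IsPGroup.iff_card.1 hP
  rw [hn]
  refine Nat.le_self_pow ?_ p
  rintro rfl
  exact h (card_eq_one.1 (by simpa using hn))

namespace SchmidtData

variable {p q : ℕ} {P H : Subgroup G} {y : G}

theorem ne_one (h : SchmidtData p q P H y) : y ≠ 1 := by
  rintro rfl
  obtain ⟨u, -, hu⟩ := h.not_commute
  exact hu (Commute.one_right u)

theorem ne_bot (h : SchmidtData p q P H y) : P ≠ ⊥ := by
  rintro rfl
  obtain ⟨u, hu, hu'⟩ := h.not_commute
  rw [mem_bot] at hu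
  subst hu
  exact hu' (Commute.one_left y)

theorem disjoint [Finite G] (h : SchmidtData p q P H y) (hy : y ^ q = 1)
    {w : G} (hw : w ∈ zpowers y)
    (hwP : w ∈ P) : w = 1 := by
  obtain ⟨i, hi⟩ := h.isPGroup.pow_eq_one hwP
  obtain ⟨k, rfl⟩ := mem_powers_iff_mem_zpowers.2 hw
  refine eq_one_of_coprime_prime_pow h.prime_left h.prime_right h.ne hi (j := 1) ?_
  simp only [pow_one]
  rw [← pow_mul, mul_comm, pow_mul, hy, one_pow]

theorem orderOf_eq (h : SchmidtData p q P H y) (hy : y ^ q = 1) : orderOf y = q :=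
  have := Fact.mk h.prime_right
  orderOf_eq_prime hy h.ne_one

theorem card_eq [Finite G] (h : SchmidtData p q P H y) (hy : y ^ q = 1) :
    Nat.card H = Nat.card P * q := by
  have hc : IsComplement' (P.subgroupOf H) (zpowers (⟨y, h.mem⟩ : H)) := by
    refine isComplement'_of_disjoint_and_mul_eq_univ ?_ ?_
    · rw [disjoint_iff_inf_le]
      rintro ⟨w, hwH⟩ ⟨hwP, hw⟩
      rw [mem_bot]
      obtain ⟨k, hk⟩ := hw
      exact Subtype.ext (h.disjoint hy ⟨k, congrArg Subtype.val hk⟩ hwP)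
    · refine Set.eq_univ_of_forall fun a ↦ ?_
      obtain ⟨u, hu, k, hk⟩ := h.exists_eq_mul a a.2
      exact ⟨⟨u, h.le hu⟩, hu, ⟨y, h.mem⟩ ^ k, pow_mem (mem_zpowers _) k, Subtype.ext hk.symm⟩
  rw [← hc.card_mul_card, Nat.card_zpowers, Subgroup.orderOf_mk, h.orderOf_eq hy,
    Nat.card_congr (subgroupOfEquivOfLe h.le).toEquiv]

end SchmidtData

theorem zpowers_eq_of_prime_pow {q : ℕ} (hq : q.Prime) {y w : G} (hy : y ^ q = 1)
    (hw : w ∈ zpowers y) (hw1 : w ≠ 1) : y ∈ zpowers w := by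
  obtain ⟨k, rfl⟩ := mem_zpowers_iff.1 hw
  have hk : ¬ (q : ℤ) ∣ k := by
    rintro ⟨m, rfl⟩
    exact hw1 (by rw [zpow_mul, zpow_natCast, hy, one_zpow])
  have hc : IsCoprime (q : ℤ) k := (Nat.prime_iff_prime_int.1 hq).coprime_iff_not_dvd.2 hk
  obtain ⟨a, b, hab⟩ := hc
  refine ⟨b, ?_⟩
  simp only [← zpow_mul]
  have : y ^ (a * q + b * k) = y := by rw [hab, zpow_one]
  rwa [zpow_add, mul_comm a, zpow_mul, zpow_natCast, hy, one_zpow, one_mul, mul_comm b] at this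

end Counting

section Abelian

variable {G : Type*} [Group G]

theorem eq_one_of_commute_of_pow {p q : ℕ} (hp : p.Prime) (hq : q.Prime) (hpq : p ≠ q) {c w : G}
    (hcw : Commute c w) {i j k : ℕ} (hc : c ^ p ^ i = 1) (hw : w ^ q ^ j = 1)
    (h : (c * w) ^ p ^ k = 1) : w = 1 := by
  have h1 : w ^ p ^ (i + k) = 1 := by
    have h2 : (c * w) ^ p ^ (i + k) = 1 := by rw [pow_add, mul_comm, pow_mul, h, one_pow]
    have h3 : c ^ p ^ (i + k) = 1 := by rw [pow_add, pow_mul, hc, one_pow]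
    rwa [hcw.mul_pow, h3, one_mul] at h2
  exact eq_one_of_coprime_prime_pow hp hq hpq h1 hw

theorem sum_inv_gt {g c q p a r u₁ u₂ u₃ : ℕ} (hg : 0 < g) (hp : 2 ≤ p) (hq : 2 ≤ q)
    (hc : p ≤ c) (ha : p ^ 2 ≤ a) (hr : q ^ 2 ≤ r)
    (h₁ : u₁ * (c * q) = g * ((c - 1) * (q - 1))) (h₂ : u₂ * (a * q) = g * (a - 1))
    (h₃ : u₃ * (r * p) = g * (r - 1)) : g ≤ u₁ + u₂ + u₃ := by
  have hp' : (2 : ℝ) ≤ p := by exact_mod_cast hp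
  have hq' : (2 : ℝ) ≤ q := by exact_mod_cast hq
  have hc' : (p : ℝ) ≤ c := by exact_mod_cast hc
  have ha' : (p : ℝ) ^ 2 ≤ a := by exact_mod_cast ha
  have hr' : (q : ℝ) ^ 2 ≤ r := by exact_mod_cast hr
  have hg' : (0 : ℝ) < g := by exact_mod_cast hg
  have c1 : 1 ≤ c := by omega
  have a1 : 1 ≤ a := le_trans (Nat.one_le_pow _ _ (by omega)) ha
  have r1 : 1 ≤ r := le_trans (Nat.one_le_pow _ _ (by omega)) hr
  have q1 : 1 ≤ q := by omega
  have c0 : (0 : ℝ) < c := by exact_mod_cast c1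
  have a0 : (0 : ℝ) < a := by exact_mod_cast a1
  have r0 : (0 : ℝ) < r := by exact_mod_cast r1
  have p0 : (0 : ℝ) < p := by linarith
  have q0 : (0 : ℝ) < q := by linarith
  have e₁ : (u₁ : ℝ) = g * ((1 - 1 / c) * (1 - 1 / q)) := by
    have : (u₁ : ℝ) * (c * q) = g * ((c - 1) * (q - 1)) := by
      rw [← Nat.cast_one, ← Nat.cast_sub c1, ← Nat.cast_sub q1]; exact_mod_cast h₁
    field_simp
    linarith
  have e₂ : (u₂ : ℝ) = g * ((1 - 1 / a) * (1 / q)) := by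
    have : (u₂ : ℝ) * (a * q) = g * (a - 1) := by
      rw [← Nat.cast_one, ← Nat.cast_sub a1]; exact_mod_cast h₂
    field_simp
    linarith
  have e₃ : (u₃ : ℝ) = g * ((1 - 1 / r) * (1 / p)) := by
    have : (u₃ : ℝ) * (r * p) = g * (r - 1) := by
      rw [← Nat.cast_one, ← Nat.cast_sub r1]; exact_mod_cast h₃
    field_simp
    linarith
  have i₁ : (1 : ℝ) / c ≤ 1 / p := one_div_le_one_div_of_le p0 hc'
  have i₂ : (1 : ℝ) / a ≤ (1 / p) ^ 2 := by
    rw [one_div_pow]; exact one_div_le_one_div_of_le (by positivity) ha'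
  have i₃ : (1 : ℝ) / r ≤ (1 / q) ^ 2 := by
    rw [one_div_pow]; exact one_div_le_one_div_of_le (by positivity) hr'
  have s0 : (0 : ℝ) < 1 / p := by positivity
  have t0 : (0 : ℝ) < 1 / q := by positivity
  have s1 : (1 : ℝ) / p ≤ 1 / 2 := one_div_le_one_div_of_le two_pos hp'
  have t1 : (1 : ℝ) / q ≤ 1 / 2 := one_div_le_one_div_of_le two_pos hq'
  generalize (1 : ℝ) / p = s at *
  generalize (1 : ℝ) / q = t at *
  have key : 1 ≤ (1 - (1 : ℝ) / c) * (1 - t) + (1 - 1 / a) * t + (1 - 1 / r) * s := by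
    have j₁ := mul_le_mul_of_nonneg_right i₁ (by linarith : 0 ≤ 1 - t)
    have j₂ := mul_le_mul_of_nonneg_right i₂ t0.le
    have j₃ := mul_le_mul_of_nonneg_right i₃ s0.le
    have j₄ := mul_nonneg (mul_nonneg s0.le t0.le) (by linarith : 0 ≤ 1 - s - t)
    linarith
  have : (g : ℝ) ≤ u₁ + u₂ + u₃ := by
    rw [e₁, e₂, e₃, ← mul_add, ← mul_add]
    exact le_mul_of_one_le_right hg'.le key
  exact_mod_cast this

namespace SchmidtData

variable {p q : ℕ} {P : Subgroup G} {y : G}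

/-- The number of conjugates of nontrivial elements of `P`. -/
theorem ncard_conjUnion [Finite G] {P H : Subgroup G} (h : SchmidtData p q P H y)
    (hy : y ^ q = 1) (hTI : ∀ x ∈ P, x ≠ 1 → ∀ g, g * x * g⁻¹ ∈ P → g ∈ H) :
    (conjUnion ((P : Set G) \ {1})).ncard * (Nat.card P * q) = Nat.card G * (Nat.card P - 1) := by
  rw [← h.card_eq hy]
  convert ncard_conjUnion_mul ((P : Set G) \ {1}) H ?_ ?_ using 2
  · rw [Set.ncard_sdiff_singleton_of_mem (one_mem P), ← Nat.card_coe_set_eq]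
    rfl
  · rintro a ha d ⟨hd, hd1⟩
    refine ⟨h.conj_mem ha hd, fun h1 ↦ hd1 ?_⟩
    simpa using h1
  · rintro d ⟨hd, hd1⟩ g ⟨hg, -⟩
    exact hTI d hd hd1 g hg

theorem exists_center [Finite G] (hp : p.Prime) (h : SchmidtData p q P (normalizer (P : Set G)) y)
    (hP : ¬ ∀ a ∈ P, ∀ b ∈ P, Commute a b) :
    ∃ z ∈ P, z ≠ 1 ∧ Commute z y ∧ p ^ 2 ≤ Nat.card P := by
  have := Fact.mk hp
  set K : Subgroup G := P ⊓ centralizer (P : Set G) with hK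
  have hKP : K ≠ P := by
    intro h1
    refine hP fun a ha b hb ↦ ?_
    rw [← h1] at ha
    exact (mem_centralizer_iff.1 ha.2 b hb).symm
  have hy : ∀ u ∈ K, y * u * y⁻¹ ∈ K := by
    rintro u ⟨hu, hu'⟩
    refine ⟨h.conj_mem h.mem hu, mem_centralizer_iff.2 fun v hv ↦ ?_⟩
    have h1 := mem_centralizer_iff.1 hu' _ (h.conj_mem (inv_mem h.mem) hv)
    rw [inv_inv] at h1
    calc v * (y * u * y⁻¹) = y * (y⁻¹ * v * y * u) * y⁻¹ := by group
      _ = _ := by rw [h1]; group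
  have hcomm := h.commute_of_lt K inf_le_left hKP hy
  have hnt : Nontrivial P := (nontrivial_iff_ne_bot P).2 h.ne_bot
  have hc := h.isPGroup.center_nontrivial
  obtain ⟨⟨z, hz⟩, hz1⟩ := exists_ne (1 : center P)
  have hzK : (z : G) ∈ K := ⟨z.2, mem_centralizer_iff.2 fun v hv ↦
    congrArg Subtype.val (mem_center_iff.1 hz ⟨v, hv⟩)⟩
  have hz1' : (z : G) ≠ 1 := fun h1 ↦ hz1 (Subtype.ext (Subtype.ext h1))
  refine ⟨z, z.2, hz1', hcomm z hzK, h.isPGroup.sq_le_card ?_ (lt_of_le_of_ne inf_le_left hKP)⟩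
  rintro h1
  rw [hK, h1, mem_bot] at hzK
  exact hz1' hzK

theorem mixed_conj {i : ℕ} (hp : p.Prime) (hq : q.Prime) (hpq : p ≠ q) {c w c' w' g : G}
    (hcw : Commute c w) (hcw' : Commute c' w') (hc : c ^ p ^ i = 1) (hc' : c' ^ p ^ i = 1)
    (hw : w ^ q = 1) (hw' : w' ^ q = 1) (h : g * (c * w) * g⁻¹ = c' * w') :
    g * c * g⁻¹ = c' ∧ g * w * g⁻¹ = w' := by
  have hcop : (p ^ i).Coprime q := Nat.Coprime.pow_left _ ((Nat.coprime_primes hp hq).2 hpq)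
  obtain ⟨n, hn1, hn2⟩ := Nat.chineseRemainder hcop 1 0
  have key : ∀ c w : G, Commute c w → c ^ p ^ i = 1 → w ^ q = 1 → (c * w) ^ n = c := by
    intro c w hcw hc hw
    rw [hcw.mul_pow]
    have h1 : c ^ n = c ^ 1 :=
      pow_eq_pow_iff_modEq.2 (hn1.of_dvd (orderOf_dvd_of_pow_eq_one hc))
    have h2 : w ^ n = w ^ 0 :=
      pow_eq_pow_iff_modEq.2 (hn2.of_dvd (orderOf_dvd_of_pow_eq_one hw))
    rw [h1, h2, pow_one, pow_zero, mul_one]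
  have h1 : g * c * g⁻¹ = c' := by
    rw [← key c w hcw hc hw, ← key c' w' hcw' hc' hw', ← h, conj_pow]
  refine ⟨h1, mul_left_cancel (a := c') ?_⟩
  rw [← h, ← h1]
  group

end SchmidtData

theorem IsSchmidtSimple.commute_of_mem [Finite G] (hG : IsSchmidtSimple G) {p : ℕ}
    [hp : Fact p.Prime]
    (P : Sylow p G) : ∀ a ∈ (P : Subgroup G), ∀ b ∈ (P : Subgroup G), Commute a b := by
  by_contra hcon
  have hPne : (P : Subgroup G) ≠ ⊥ := fun h ↦ hcon (by
    simp only [h, mem_bot]; rintro _ rfl _ rfl; rfl)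
  obtain ⟨q, y, hS⟩ := hG.exists_schmidtData_normalizer P hPne
  have hy := hS.pow_prime_eq_one hG
  have hq := hS.prime_right
  have hpq := hS.ne
  have := Fact.mk hq
  obtain ⟨z, hzP, hz1, hzy, hPcard⟩ := hS.exists_center hp.out hcon
  obtain ⟨R, hyR⟩ := exists_mem_sylow (a := y) (p := q) (i := 1) (by rwa [pow_one])
  have hRne : (R : Subgroup G) ≠ ⊥ := fun h ↦ hS.ne_one (by
    have h1 : y ∈ (R : Subgroup G) := hyR
    rwa [h, mem_bot] at h1)
  obtain ⟨p', y', hT⟩ := hG.exists_schmidtData_normalizer R hRne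
  have hy' := hT.pow_prime_eq_one hG
  obtain ⟨i, hzi⟩ := P.2.pow_eq_one hzP
  have hzN : z ∈ normalizer (R : Set G) :=
    hG.mem_normalizer_of_conj_mem R hyR hS.ne_one (by rwa [hzy.eq, mul_inv_cancel_right])
  obtain rfl : p = p' := by
    by_contra hpp
    exact hz1 (hT.eq_one_of_pow hp.out hpq hpp hzN hzi)
  have hRcard : q ^ 2 ≤ Nat.card R := by
    refine hT.isPGroup.sq_le_card (K := zpowers y) (by rw [Ne, zpowers_eq_bot]; exact hS.ne_one)
      (lt_of_le_of_ne (zpowers_le.2 hyR) fun hR ↦ ?_)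
    obtain ⟨u, hu, k, hk⟩ := hT.exists_eq_mul z hzN
    have hRab : ∀ v ∈ (R : Subgroup G), Commute v (y' ^ k) := by
      rw [← hR]
      rintro _ ⟨l, rfl⟩
      rw [← hR] at hu
      obtain ⟨m, rfl⟩ := hu
      have : y' ^ k = (y ^ m)⁻¹ * z := by rw [hk, inv_mul_cancel_left]
      rw [this]
      exact (((Commute.refl y).zpow_zpow l m).inv_right).mul_right (hzy.symm.zpow_left l)
    by_cases hy1 : y' ^ k = 1
    · rw [hy1, mul_one] at hk
      obtain ⟨j, hj⟩ := hT.isPGroup.pow_eq_one hu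
      rw [← hk] at hj
      exact hz1 (eq_one_of_coprime_prime_pow hp.out hq hpq hzi hj)
    · obtain ⟨v, hv, hvy⟩ := hT.not_commute
      obtain ⟨l, hl⟩ := zpowers_eq_of_prime_pow hp.out hy' (pow_mem (mem_zpowers y') k) hy1
      apply hvy
      rw [← hl]
      exact (hRab v hv).zpow_right l
  -- the elements of order divisible by both primes
  set C : Subgroup G := (P : Subgroup G) ⊓ centralizer {y} with hC
  have hCy : ∀ c ∈ C, ∀ w ∈ zpowers y, Commute c w := by
    rintro c ⟨-, hc⟩ _ ⟨k, rfl⟩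
    exact Commute.zpow_right (mem_centralizer_singleton_iff.1 hc) k
  have hCcard : p ≤ Nat.card C := (P.2.to_le inf_le_left).le_card (fun h ↦ by
    have hz : z ∈ C := ⟨hzP, mem_centralizer_singleton_iff.2 hzy⟩
    rw [hC, h, mem_bot] at hz
    exact hz1 hz)
  set f : G × G → G := fun x ↦ x.1 * x.2 with hf
  have hinj : Set.InjOn f ((C : Set G) ×ˢ (zpowers y : Set G)) := by
    rintro ⟨c, w⟩ ⟨hc, hw⟩ ⟨c', w'⟩ ⟨hc', hw'⟩ h
    simp only [hf, SetLike.mem_coe] at h hc hw hc' hw'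
    have h1 : c'⁻¹ * c = w' * w⁻¹ := by
      rw [inv_mul_eq_iff_eq_mul, ← mul_assoc, ← h, mul_inv_cancel_right]
    have h2 : c'⁻¹ * c = 1 := hS.disjoint hy (by rw [h1]; exact mul_mem hw' (inv_mem hw))
      (mul_mem (inv_mem hc'.1) hc.1)
    have h3 : w' * w⁻¹ = 1 := h1 ▸ h2
    exact Prod.ext (inv_mul_eq_one.1 h2).symm (mul_inv_eq_one.1 h3).symm
  set D : Set G := f '' (((C : Set G) \ {1}) ×ˢ ((zpowers y : Set G) \ {1})) with hD
  have hDcard : D.ncard = (Nat.card C - 1) * (q - 1) := by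
    rw [hD, (hinj.mono (Set.prod_mono Set.sdiff_subset Set.sdiff_subset)).ncard_image,
      Set.ncard_prod, Set.ncard_sdiff_singleton_of_mem (one_mem C),
      Set.ncard_sdiff_singleton_of_mem (one_mem _), ← Nat.card_coe_set_eq, ← Nat.card_coe_set_eq]
    congr 2
    rw [← hS.orderOf_eq hy, ← Nat.card_zpowers]
    rfl
  set H : Subgroup G := normalizer (P : Set G) ⊓ normalizer (zpowers y : Set G) with hH
  have hHcard : Nat.card H = Nat.card C * q := by
    have h1 : (H : Set G) = f '' ((C : Set G) ×ˢ (zpowers y : Set G)) := by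
      ext x
      constructor
      · rintro ⟨hx1, hx2⟩
        obtain ⟨u, hu, k, rfl⟩ := hS.exists_eq_mul x hx1
        refine ⟨(u, y ^ k), ⟨⟨hu, ?_⟩, pow_mem (mem_zpowers y) k⟩, rfl⟩
        have hu2 : u ∈ normalizer (zpowers y : Set G) := by
          have hx2' : u * y ^ k ∈ normalizer (zpowers y : Set G) := hx2
          have := mul_mem hx2' (inv_mem (pow_mem (le_normalizer (mem_zpowers y)) k))
          rwa [mul_inv_cancel_right] at this
        have h2 : u * y * u⁻¹ * y⁻¹ = 1 := by
          refine hS.disjoint hy (mul_mem (conj_mem_of_mem_normalizer hu2 (mem_zpowers y))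
            (inv_mem (mem_zpowers y))) ?_
          have := mul_mem hu (hS.conj_mem hS.mem (inv_mem hu))
          simpa only [mul_assoc] using this
        rw [mul_inv_eq_one, mul_inv_eq_iff_eq_mul] at h2
        exact mem_centralizer_singleton_iff.2 h2
      · rintro ⟨⟨c, w⟩, ⟨hc, hw⟩, rfl⟩
        refine ⟨mul_mem (le_normalizer hc.1) (zpowers_le.2 hS.mem hw),
          mul_mem (mem_normalizer_zpowers_of_commute ?_) (le_normalizer hw)⟩
        exact hCy c hc y (mem_zpowers y)
    change Nat.card (H : Set G) = _
    rw [Nat.card_coe_set_eq, h1, hinj.ncard_image, Set.ncard_prod,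
      ← Nat.card_coe_set_eq, ← Nat.card_coe_set_eq]
    congr 1
    rw [← hS.orderOf_eq hy, ← Nat.card_zpowers]
    rfl
  obtain ⟨i, hi⟩ := IsPGroup.iff_card.1 P.2
  have hPpow : ∀ c ∈ (P : Subgroup G), c ^ p ^ i = 1 := fun c hc ↦ by
    rw [← hi]
    exact congrArg Subtype.val (pow_card_eq_one' (x := (⟨c, hc⟩ : (P : Subgroup G))))
  have hypow : ∀ w ∈ zpowers y, w ^ q = 1 := by
    rintro _ ⟨k, rfl⟩
    simp only
    rw [← zpow_natCast, ← zpow_mul, mul_comm, zpow_mul, zpow_natCast, hy, one_zpow]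
  have h₁ : (conjUnion D).ncard * (Nat.card C * q) =
      Nat.card G * ((Nat.card C - 1) * (q - 1)) := by
    rw [← hHcard, ← hDcard]
    refine ncard_conjUnion_mul D H ?_ ?_
    · rintro h ⟨hh1, hh2⟩ _ ⟨⟨c, w⟩, ⟨⟨hc, hc1⟩, ⟨hw, hw1⟩⟩, rfl⟩
      have hh2 : h ∈ normalizer (zpowers y : Set G) := hh2
      have hc : c ∈ C := hc
      refine ⟨(h * c * h⁻¹, h * w * h⁻¹), ⟨⟨⟨hS.conj_mem hh1 hc.1, ?_⟩, ?_⟩,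
        ⟨conj_mem_of_mem_normalizer hh2 hw, ?_⟩⟩, ?_⟩
      · have h1 := hCy c hc _ (conj_mem_of_mem_normalizer (inv_mem hh2) (mem_zpowers y))
        rw [inv_inv] at h1
        refine mem_centralizer_singleton_iff.2 ?_
        calc h * c * h⁻¹ * y = h * (c * (h⁻¹ * y * h)) * h⁻¹ := by group
          _ = _ := by rw [h1.eq]; group
      · simpa using hc1
      · simpa using hw1
      · simp [hf, mul_assoc]
    · rintro _ ⟨⟨c, w⟩, ⟨⟨hc, hc1⟩, ⟨hw, hw1⟩⟩, rfl⟩ g ⟨⟨c', w'⟩, ⟨⟨hc', -⟩, ⟨hw', -⟩⟩, h⟩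
      obtain ⟨h1, h2⟩ := SchmidtData.mixed_conj hp.out hq hpq (hCy c hc w hw) (hCy c' hc' w' hw')
        (hPpow c hc.1) (hPpow c' hc'.1) (hypow w hw) (hypow w' hw') h.symm
      refine ⟨hG.mem_normalizer_of_conj_mem P hc.1 hc1 (h1 ▸ hc'.1), mem_normalizer_fintype ?_⟩
      intro v hv
      obtain ⟨l, hl⟩ := zpowers_eq_of_prime_pow hq hy hw hw1
      obtain ⟨m, rfl⟩ := hv
      have h3 : g * y * g⁻¹ = w' ^ l := by
        rw [← h2, conj_zpow]
        exact congrArg (g * · * g⁻¹) hl.symm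
      change g * y ^ m * g⁻¹ ∈ zpowers y
      rw [← conj_zpow, h3]
      exact zpow_mem (zpow_mem hw' l) m
  have h₂ := hS.ncard_conjUnion hy fun x hx hx1 g ↦ hG.mem_normalizer_of_conj_mem P hx hx1
  have h₃ := hT.ncard_conjUnion hy' fun x hx hx1 g ↦ hG.mem_normalizer_of_conj_mem R hx hx1
  have hle := sum_inv_gt Nat.card_pos hp.out.two_le hq.two_le hCcard hPcard hRcard h₁ h₂ h₃
  set U₁ := conjUnion D
  set U₂ := conjUnion (((P : Subgroup G) : Set G) \ {1})
  set U₃ := conjUnion (((R : Subgroup G) : Set G) \ {1})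
  have m₂ : ∀ x ∈ U₂, x ≠ 1 ∧ ∃ k, x ^ p ^ k = 1 := by
    rintro _ ⟨g, d, ⟨hd, hd1⟩, rfl⟩
    obtain ⟨k, hk⟩ := P.2.pow_eq_one hd
    exact ⟨by simpa using hd1, k, by rw [conj_pow, hk]; simp⟩
  have m₃ : ∀ x ∈ U₃, x ≠ 1 ∧ ∃ k, x ^ q ^ k = 1 := by
    rintro _ ⟨g, d, ⟨hd, hd1⟩, rfl⟩
    obtain ⟨k, hk⟩ := R.2.pow_eq_one hd
    exact ⟨by simpa using hd1, k, by rw [conj_pow, hk]; simp⟩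
  have m₁ : ∀ x ∈ U₁, (¬ ∃ k, x ^ p ^ k = 1) ∧ ¬ ∃ k, x ^ q ^ k = 1 := by
    rintro _ ⟨g, _, ⟨⟨c, w⟩, ⟨⟨hc, hc1⟩, ⟨hw, hw1⟩⟩, rfl⟩, rfl⟩
    simp only [conj_pow, mul_inv_eq_one, mul_eq_left, hf]
    refine ⟨?_, ?_⟩
    · rintro ⟨k, hk⟩
      exact hw1 (eq_one_of_commute_of_pow hp.out hq hpq (hCy c hc w hw) (hPpow c hc.1) (j := 1)
        (by rw [pow_one]; exact hypow w hw) hk)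
    · rintro ⟨k, hk⟩
      rw [(hCy c hc w hw).eq] at hk
      exact hc1 (eq_one_of_commute_of_pow hq hp.out hpq.symm (hCy c hc w hw).symm (i := 1)
        (by rw [pow_one]; exact hypow w hw) (hPpow c hc.1) hk)
  have d₁₂ : Disjoint U₁ U₂ := Set.disjoint_left.2 fun x h1 h2 ↦ (m₁ x h1).1 (m₂ x h2).2
  have d₃ : Disjoint (U₁ ∪ U₂) U₃ := Set.disjoint_left.2 fun x h1 h3 ↦ h1.elim
    (fun h1 ↦ (m₁ x h1).2 (m₃ x h3).2) fun h2 ↦ by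
      obtain ⟨hx, k, hk⟩ := m₂ x h2
      obtain ⟨-, l, hl⟩ := m₃ x h3
      exact hx (eq_one_of_coprime_prime_pow hp.out hq hpq hk hl)
  have hlt : (U₁ ∪ U₂ ∪ U₃).ncard < Nat.card G := by
    rw [← Set.ncard_univ]
    refine Set.ncard_lt_ncard (Set.ssubset_univ_iff.2 fun h ↦ ?_)
    have h1 : (1 : G) ∈ U₁ ∪ U₂ ∪ U₃ := h ▸ Set.mem_univ _
    rcases h1 with (h1 | h1) | h1
    · exact (m₁ 1 h1).1 ⟨0, by simp⟩
    · exact (m₂ 1 h1).1 rfl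
    · exact (m₃ 1 h1).1 rfl
  rw [Set.ncard_union_eq d₃, Set.ncard_union_eq d₁₂] at hlt
  omega

end Abelian

section Family

/-- A family of nontrivial abelian subgroups, each containing the centralizers of its nontrivial
elements, whose conjugates partition the nontrivial elements of `G`; the integer `q i` is the
index of `A i` in its normalizer. -/
structure IsCCFamily {G I : Type*} [Group G] (A : I → Subgroup G) (q : I → ℕ) : Prop where
  ne_bot : ∀ i, A i ≠ ⊥
  commute : ∀ i, ∀ a ∈ A i, ∀ b ∈ A i, Commute a b
  mem_of_commute : ∀ i, ∀ a ∈ A i, a ≠ 1 → ∀ g, Commute g a → g ∈ A i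
  mem_normalizer : ∀ i, ∀ a ∈ A i, a ≠ 1 → ∀ g, g * a * g⁻¹ ∈ A i →
    g ∈ normalizer (A i : Set G)
  card_normalizer : ∀ i, Nat.card (normalizer (A i : Set G)) = Nat.card (A i) * q i
  exists_conj_mem : ∀ x, x ≠ 1 → ∃ i g, g * x * g⁻¹ ∈ A i
  eq_of_conj_mem : ∀ i j x g, x ∈ A i → x ≠ 1 → g * x * g⁻¹ ∈ A j → i = j

variable {G : Type*} [Group G]

theorem exists_zpow_prime_order [Finite G] {x : G} (hx : x ≠ 1) :
    ∃ p : ℕ, p.Prime ∧ ∃ m : ℕ, orderOf (x ^ m) = p := by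
  obtain ⟨p, hp, m, hm⟩ := Nat.exists_prime_and_dvd (n := orderOf x)
    (by rwa [Ne, orderOf_eq_one_iff])
  refine ⟨p, hp, m, ?_⟩
  have h0 : 0 < orderOf x := orderOf_pos x
  have hm0 : 0 < m := Nat.pos_of_ne_zero (by rintro rfl; omega)
  rw [orderOf_pow, hm, Nat.gcd_mul_left_left, Nat.mul_div_cancel _ hm0]

theorem IsSchmidtSimple.mem_of_commute [Finite G] (hG : IsSchmidtSimple G) {p : ℕ}
    [Fact p.Prime] (P : Sylow p G) {a g : G} (ha : a ∈ P) (ha1 : a ≠ 1) (h : Commute g a) :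
    g ∈ P := by
  have hP : (P : Subgroup G) ≠ ⊥ := fun h ↦ ha1 (by
    have h1 : a ∈ (P : Subgroup G) := ha
    rwa [h, mem_bot] at h1)
  obtain ⟨q, y, hS⟩ := hG.exists_schmidtData_normalizer P hP
  have hcomm := hG.commute_of_mem P
  have hy := hS.pow_prime_eq_one hG
  obtain ⟨u, hu, k, hk⟩ := hS.exists_eq_mul g
    (hG.mem_normalizer_of_conj_mem P ha ha1 (by rwa [h.eq, mul_inv_cancel_right]))
  have h1 : Commute (y ^ k) a := by
    have h2 : y ^ k = u⁻¹ * g := by rw [hk, inv_mul_cancel_left]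
    rw [h2]
    exact ((hcomm u hu a ha).inv_left).mul_left h
  by_cases hyk : y ^ k = 1
  · rwa [hk, hyk, mul_one]
  · obtain ⟨l, hl⟩ := zpowers_eq_of_prime_pow hS.prime_right hy (pow_mem (mem_zpowers y) k) hyk
    refine absurd (hS.eq_one_of_commute hcomm ha ?_) ha1
    rw [← hl]
    exact h1.symm.zpow_right l

theorem IsSchmidtSimple.exists_isCCFamily [Finite G] (hG : IsSchmidtSimple G) :
    ∃ (A : (Nat.card G).primeFactors → Subgroup G) (q : (Nat.card G).primeFactors → ℕ)
      (y : (Nat.card G).primeFactors → G), IsCCFamily A q ∧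
      ∀ p : (Nat.card G).primeFactors, SchmidtData p (q p) (A p) (normalizer (A p : Set G)) (y p) ∧
        y p ^ q p = 1 := by
  have hfact (p : (Nat.card G).primeFactors) : Fact (p : ℕ).Prime :=
    ⟨Nat.prime_of_mem_primeFactors p.2⟩
  let P (p : (Nat.card G).primeFactors) : Sylow p G := default
  have hP (p) : (P p : Subgroup G) ≠ ⊥ :=
    (P p).ne_bot_of_dvd_card (Nat.dvd_of_mem_primeFactors p.2)
  choose q y hS using fun p ↦ hG.exists_schmidtData_normalizer (P p) (hP p)
  have hy (p) : y p ^ q p = 1 := (hS p).pow_prime_eq_one hG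
  refine ⟨fun p ↦ P p, q, y, ⟨hP, fun p ↦ hG.commute_of_mem (P p), ?_, ?_, ?_, ?_, ?_⟩,
    fun p ↦ ⟨hS p, hy p⟩⟩
  · exact fun p a ha ha1 g ↦ hG.mem_of_commute (P p) ha ha1
  · exact fun p a ha ha1 g ↦ hG.mem_normalizer_of_conj_mem (P p) ha ha1
  · exact fun p ↦ (hS p).card_eq (hy p)
  · intro x hx
    obtain ⟨p, hp, m, hm⟩ := exists_zpow_prime_order hx
    have := Fact.mk hp
    have hx' : x ^ m ≠ 1 := by
      rw [Ne, ← orderOf_eq_one_iff, hm]; exact hp.ne_one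
    have hpG : p ∈ (Nat.card G).primeFactors :=
      Nat.mem_primeFactors.2 ⟨hp, hm ▸ orderOf_dvd_natCard _, Nat.card_pos.ne'⟩
    obtain ⟨R, hR⟩ := exists_mem_sylow (a := x ^ m) (p := p) (i := 1)
      (by rw [pow_one, ← hm, pow_orderOf_eq_one])
    have hxR : x ∈ R := hG.mem_of_commute R hR hx' (Commute.self_pow x m)
    obtain ⟨g, hg⟩ := MulAction.exists_smul_eq G R (P ⟨p, hpG⟩)
    refine ⟨⟨p, hpG⟩, g, ?_⟩
    rw [← hg, Sylow.coe_subgroup_smul]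
    exact smul_mem_pointwise_smul x (MulAut.conj g) _ hxR
  · intro p r x g hx hx1 hg
    by_contra hpr
    obtain ⟨i, hi⟩ := (hS p).isPGroup.pow_eq_one hx
    obtain ⟨j, hj⟩ := (hS r).isPGroup.pow_eq_one hg
    rw [conj_pow, mul_inv_eq_one, mul_eq_left] at hj
    exact hx1 (eq_one_of_coprime_prime_pow (hfact p).out (hfact r).out
      (fun h ↦ hpr (Subtype.ext h)) hi hj)

theorem isSchmidtSimple_of_biminimalNonNilpotent [Finite G] (hsimple : IsSimpleGroup G)
    (hnonab : ¬ Abelian G) (hminimal : ∀ H : Subgroup G, H ≠ ⊤ → Group.IsSolvable H)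
    (hbi : BiminimalNonNilpotent G) : IsSchmidtSimple G where
  simple := hsimple
  commutator_eq_top := by
    refine (commutator_normal (⊤ : Subgroup G) ⊤).eq_bot_or_eq_top.resolve_left fun h ↦ hnonab ?_
    intro a b
    rw [commutator_eq_bot_iff_le_centralizer] at h
    exact (mem_centralizer_iff.1 (h (mem_top a)) b (mem_top b)).symm
  nilpotent_or H hH := (hbi.2.2 H hH).imp_right fun h ↦ h.exists_schmidtData (hminimal H hH)

namespace IsCCFamily

variable {I : Type*} {A : I → Subgroup G} {q : I → ℕ}

theorem eq_and_mem_normalizer (h : IsCCFamily A q) {i j : I} {x g k : G} (hx : x ≠ 1)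
    (hg : g * x * g⁻¹ ∈ A i) (hk : k * x * k⁻¹ ∈ A j) :
    i = j ∧ k * g⁻¹ ∈ normalizer (A i : Set G) := by
  have h1 : (k * g⁻¹) * (g * x * g⁻¹) * (k * g⁻¹)⁻¹ = k * x * k⁻¹ := by group
  have h2 : g * x * g⁻¹ ≠ 1 := by simpa using hx
  obtain rfl := h.eq_of_conj_mem i j _ _ hg h2 (h1 ▸ hk)
  exact ⟨rfl, h.mem_normalizer i _ hg h2 _ (h1 ▸ hk)⟩

theorem q_pos [Finite G] (h : IsCCFamily A q) (i : I) : 0 < q i := by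
  refine Nat.pos_of_ne_zero fun h0 ↦ ?_
  have := h.card_normalizer i
  rw [h0, mul_zero] at this
  exact Nat.card_pos.ne' this

open Classical in
/-- The sum of a class function over the nontrivial elements of `G`. -/
theorem sum_eq [Fintype G] [Fintype I] (h : IsCCFamily A q) {k : Type*} [Field k] [CharZero k]
    (F : G → k) (hF : ∀ g x, F (g * x * g⁻¹) = F x) :
    ∑ x, F x = F 1 + ∑ i, (Nat.card G : k) / (Nat.card (A i) * q i) *
      ∑ x, if x ∈ A i ∧ x ≠ 1 then F x else 0 := by
  have hcount : ∀ x : G, x ≠ 1 → ∑ i, ∑ g : G, (if g * x * g⁻¹ ∈ A i then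
      ((Nat.card (A i) * q i : ℕ) : k)⁻¹ else 0) = 1 := by
    intro x hx
    obtain ⟨i, g, hg⟩ := h.exists_conj_mem x hx
    rw [Finset.sum_eq_single i]
    · rw [← Finset.sum_filter, Finset.sum_const, nsmul_eq_mul]
      have h1 : (Finset.univ.filter fun k : G ↦ k * x * k⁻¹ ∈ A i).card =
          Nat.card (A i) * q i := by
        rw [← h.card_normalizer i, Nat.card_eq_fintype_card, Fintype.card_subtype]
        refine Finset.card_bij' (fun k _ ↦ k * g⁻¹) (fun k _ ↦ k * g) ?_ ?_ ?_ ?_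
        · intro k hk
          rw [Finset.mem_filter] at hk ⊢
          exact ⟨Finset.mem_univ _, (h.eq_and_mem_normalizer hx hg hk.2).2⟩
        · intro k hk
          rw [Finset.mem_filter] at hk ⊢
          refine ⟨Finset.mem_univ _, ?_⟩
          have := conj_mem_of_mem_normalizer hk.2 hg
          convert this using 1
          group
        · intro k _; simp
        · intro k _; simp
      rw [h1, mul_inv_cancel₀]
      rw [Nat.cast_ne_zero]
      exact Nat.mul_ne_zero Nat.card_pos.ne' (h.q_pos i).ne'
    · intro j _ hj
      refine Finset.sum_eq_zero fun k _ ↦ if_neg fun hk ↦ ?_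
      exact hj (h.eq_and_mem_normalizer hx hg hk).1.symm
    · intro hi
      exact absurd (Finset.mem_univ i) hi
  have h1 : ∀ x : G, F x = (if x = 1 then F x else 0) + ∑ i, ∑ g : G,
      (if g * x * g⁻¹ ∈ A i ∧ g * x * g⁻¹ ≠ 1 then
        ((Nat.card (A i) * q i : ℕ) : k)⁻¹ * F (g * x * g⁻¹) else 0) := by
    intro x
    by_cases hx : x = 1
    · simp [hx]
    · rw [if_neg hx, zero_add]
      conv_lhs => rw [← one_mul (F x), ← hcount x hx]
      rw [Finset.sum_mul]
      refine Finset.sum_congr rfl fun i _ ↦ ?_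
      rw [Finset.sum_mul]
      refine Finset.sum_congr rfl fun g _ ↦ ?_
      have : g * x * g⁻¹ ≠ 1 := by simpa using hx
      simp only [this, ne_eq, not_false_eq_true, and_true, hF]
      split_ifs <;> simp
  rw [Finset.sum_congr rfl fun x _ ↦ h1 x, Finset.sum_add_distrib, Finset.sum_ite_eq' ,
    if_pos (Finset.mem_univ _), Finset.sum_comm]
  congr 1
  refine Finset.sum_congr rfl fun i _ ↦ ?_
  rw [Finset.sum_comm]
  have h2 : ∀ g : G, ∑ x : G, (if g * x * g⁻¹ ∈ A i ∧ g * x * g⁻¹ ≠ 1 then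
      ((Nat.card (A i) * q i : ℕ) : k)⁻¹ * F (g * x * g⁻¹) else 0) =
      ∑ x : G, (if x ∈ A i ∧ x ≠ 1 then ((Nat.card (A i) * q i : ℕ) : k)⁻¹ * F x else 0) :=
    fun g ↦ Fintype.sum_equiv (MulAut.conj g).toEquiv _ _ fun x ↦ rfl
  rw [Finset.sum_congr rfl fun g _ ↦ h2 g, Finset.sum_const, nsmul_eq_mul, Finset.mul_sum,
    Finset.mul_sum, Finset.card_univ, ← Nat.card_eq_fintype_card (α := G)]
  refine Finset.sum_congr rfl fun x _ ↦ ?_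
  split_ifs
  · push_cast; field_simp
  · simp

end IsCCFamily

end Family

section Involutions

variable {G : Type*} [Group G]

/-- Two involutions with no common commuting involution are conjugate. -/
theorem isConj_of_sq_eq_one [Finite G] {s t : G} (hs : s ^ 2 = 1) (ht : t ^ 2 = 1)
    (h : ∀ z : G, z ^ 2 = 1 → Commute z s → Commute z t → z = 1) : ∃ g, g * s * g⁻¹ = t := by
  have hs' : s * s = 1 := by rw [← sq, hs]
  have ht' : t * t = 1 := by rw [← sq, ht]
  have hsi : s⁻¹ = s := inv_eq_of_mul_eq_one_left hs'
  have hti : t⁻¹ = t := inv_eq_of_mul_eq_one_left ht'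
  have hcs : ∀ k : ℕ, s * (s * t) ^ k * s⁻¹ = ((s * t) ^ k)⁻¹ := fun k ↦ by
    rw [← conj_pow, ← inv_pow, mul_inv_rev, hsi, hti]
    congr 1
    rw [← mul_assoc, hs', one_mul]
  have hct : ∀ k : ℕ, t * (s * t) ^ k * t⁻¹ = ((s * t) ^ k)⁻¹ := fun k ↦ by
    rw [← conj_pow, ← inv_pow, mul_inv_rev, hsi, hti]
    congr 1
    rw [mul_assoc, mul_assoc, ht', mul_one]
  rcases Nat.even_or_odd' (orderOf (s * t)) with ⟨k, hk | hk⟩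
  · have h0 : 0 < orderOf (s * t) := orderOf_pos _
    have h1 : ((s * t) ^ k) ^ 2 = 1 := by rw [← pow_mul, mul_comm, ← hk, pow_orderOf_eq_one]
    have h2 : ((s * t) ^ k)⁻¹ = (s * t) ^ k := inv_eq_of_mul_eq_one_left (by rw [← sq, h1])
    have h3 := h _ h1 (mul_inv_eq_iff_eq_mul.1 ((hcs k).trans h2)).symm
      (mul_inv_eq_iff_eq_mul.1 ((hct k).trans h2)).symm
    have := Nat.le_of_dvd (by omega) (orderOf_dvd_of_pow_eq_one h3)
    omega
  · refine ⟨(s * t) ^ k, ?_⟩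
    have h1 : (s * t) ^ k * (s * t) ^ k * (s * t) = 1 := by
      rw [← pow_add, ← pow_succ, ← two_mul, ← hk, pow_orderOf_eq_one]
    have h2 : s * ((s * t) ^ k)⁻¹ = (s * t) ^ k * s := by
      rw [← hcs k, hsi, ← mul_assoc, ← mul_assoc, hs', one_mul]
    rw [mul_assoc, h2, ← mul_assoc, eq_inv_of_mul_eq_one_left h1, mul_inv_rev, hsi, hti, mul_assoc,
      hs', mul_one]

end Involutions

section Inverting

namespace SchmidtData

variable {G : Type*} [Group G] [Finite G] {p q : ℕ} {P H : Subgroup G} {y : G}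

/-- A minimal normal subgroup argument: invariant subgroups of an abelian `P` are trivial. -/
theorem eq_of_invariant (h : SchmidtData p q P H y) (hP : ∀ a ∈ P, ∀ b ∈ P, Commute a b)
    {K : Subgroup G} (hK : K ≤ P) (hK1 : K ≠ ⊥) (hKy : ∀ u ∈ K, y * u * y⁻¹ ∈ K) : K = P := by
  by_contra hne
  refine hK1 ((eq_bot_iff_forall K).2 fun u hu ↦ ?_)
  exact h.eq_one_of_commute hP (hK hu) (h.commute_of_lt K hK hne hKy u hu)

theorem pow_eq_one_of_mem (h : SchmidtData p q P H y) (hP : ∀ a ∈ P, ∀ b ∈ P, Commute a b)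
    {x : G} (hx : x ∈ P) : x ^ p = 1 := by
  let K : Subgroup G :=
    { carrier := {u | u ∈ P ∧ u ^ p = 1}
      mul_mem' := fun {a b} ha hb ↦ ⟨mul_mem ha.1 hb.1, by
        rw [(hP a ha.1 b hb.1).mul_pow, ha.2, hb.2, one_mul]⟩
      one_mem' := ⟨one_mem P, one_pow p⟩
      inv_mem' := fun {a} ha ↦ ⟨inv_mem ha.1, by rw [inv_pow, ha.2, inv_one]⟩ }
  have := Fact.mk h.prime_left
  have hK : K = P := by
    refine h.eq_of_invariant hP (fun u hu ↦ hu.1) (fun hbot ↦ h.ne_bot ?_) fun u hu ↦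
      ⟨h.conj_mem h.mem hu.1, by rw [conj_pow, hu.2]; simp⟩
    by_contra hne
    obtain ⟨i, hi⟩ := IsPGroup.iff_card.1 h.isPGroup
    have hdvd : p ∣ Nat.card P := by
      rw [hi]
      refine dvd_pow_self p ?_
      rintro rfl
      exact hne (card_eq_one.1 (by simpa using hi))
    obtain ⟨x, hx⟩ := exists_prime_orderOf_dvd_card' p hdvd
    have hxK : (x : G) ∈ K := ⟨x.2, by
      have := pow_orderOf_eq_one x
      rw [hx] at this
      exact congrArg Subtype.val this⟩
    rw [hbot, mem_bot, OneMemClass.coe_eq_one] at hxK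
    rw [hxK, orderOf_one] at hx
    exact h.prime_left.one_lt.ne hx
  rw [← hK] at hx
  exact hx.2

theorem conj_eq_inv (h : SchmidtData p 2 P H y) (hP : ∀ a ∈ P, ∀ b ∈ P, Commute a b)
    (hy : y ^ 2 = 1) {u : G} (hu : u ∈ P) : y * u * y⁻¹ = u⁻¹ := by
  have hu' := h.conj_mem h.mem hu
  have hyi : y⁻¹ = y := inv_eq_of_mul_eq_one_left (by rw [← sq, hy])
  have h1 : y * u * y⁻¹ * u = 1 := by
    refine h.eq_one_of_commute hP (mul_mem hu' hu) ?_
    have h2 : y * (y * u * y⁻¹ * u) * y⁻¹ = y * u * y⁻¹ * u := by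
      rw [(hP _ hu' u hu).eq]
      conv_rhs => rw [← (hP _ hu' u hu).eq]
      calc _ = y * u * y⁻¹ * (y * y * u * y⁻¹ * y⁻¹) := by group
        _ = _ := by rw [hyi, ← sq, hy, mul_assoc (1 * u), ← sq, hy, one_mul, mul_one]
    exact (mul_inv_eq_iff_eq_mul.1 h2).symm
  exact eq_inv_of_mul_eq_one_left h1

theorem card_eq_prime (h : SchmidtData p 2 P H y) (hP : ∀ a ∈ P, ∀ b ∈ P, Commute a b)
    (hy : y ^ 2 = 1) : Nat.card P = p := by
  obtain ⟨x, hx, hx1⟩ := (bot_or_exists_ne_one P).resolve_left h.ne_bot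
  have := Fact.mk h.prime_left
  have hK : zpowers x = P := by
    refine h.eq_of_invariant hP (zpowers_le.2 hx) (by rwa [Ne, zpowers_eq_bot]) fun u hu ↦ ?_
    rw [h.conj_eq_inv hP hy (zpowers_le.2 hx hu)]
    exact inv_mem hu
  rw [← hK, Nat.card_zpowers, orderOf_eq_prime (h.pow_eq_one_of_mem hP hx) hx1]

end SchmidtData

end Inverting

section EvenOrder

/-- A family of representatives of the Sylow subgroups of a group all of whose local subgroups
are minimal non-nilpotent. -/
structure IsSchmidtFamily {G : Type*} [Group G] (A : (Nat.card G).primeFactors → Subgroup G)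
    (q : (Nat.card G).primeFactors → ℕ) (y : (Nat.card G).primeFactors → G) : Prop
    extends IsCCFamily A q where
  schmidtData : ∀ p : (Nat.card G).primeFactors,
    SchmidtData p (q p) (A p) (normalizer (A p : Set G)) (y p)
  pow_eq_one : ∀ p, y p ^ q p = 1
  normalizer_ne_top : ∀ p, normalizer (A p : Set G) ≠ ⊤

theorem IsSchmidtSimple.exists_isSchmidtFamily {G : Type*} [Group G] [Finite G]
    (hG : IsSchmidtSimple G) : ∃ (A : (Nat.card G).primeFactors → Subgroup G)
      (q : (Nat.card G).primeFactors → ℕ) (y : (Nat.card G).primeFactors → G),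
      IsSchmidtFamily A q y := by
  obtain ⟨A, q, y, h, hS⟩ := hG.exists_isCCFamily
  refine ⟨A, q, y, h, fun p ↦ (hS p).1, fun p ↦ (hS p).2, fun p ↦ ?_⟩
  have := Fact.mk (hS p).1.prime_left
  exact hG.normalizer_ne_top (hS p).1.isPGroup (h.ne_bot p)

namespace IsSchmidtFamily

variable {G : Type*} [Group G] {A : (Nat.card G).primeFactors → Subgroup G}
  {q : (Nat.card G).primeFactors → ℕ} {y : (Nat.card G).primeFactors → G}

theorem odd_card [Finite G] (h : IsSchmidtFamily A q y) {i : (Nat.card G).primeFactors}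
    (hi : (i : ℕ) ≠ 2) : Odd (Nat.card (A i)) := by
  have := Fact.mk (h.schmidtData i).prime_left
  obtain ⟨k, hk⟩ := IsPGroup.iff_card.1 (h.schmidtData i).isPGroup
  rw [hk]
  exact ((h.schmidtData i).prime_left.odd_of_ne_two hi).pow

theorem eq_one_of_sq [Finite G] (h : IsSchmidtFamily A q y) {i : (Nat.card G).primeFactors}
    (hi : (i : ℕ) ≠ 2) {x : G} (hx : x ∈ A i) (hx2 : x ^ 2 = 1) : x = 1 := by
  obtain ⟨k, hk⟩ := (h.schmidtData i).isPGroup.pow_eq_one hx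
  exact eq_one_of_coprime_prime_pow (h.schmidtData i).prime_left Nat.prime_two hi hk (j := 1)
    (by rwa [pow_one])

theorem sq_eq_one [Finite G] (h : IsSchmidtFamily A q y) {i : (Nat.card G).primeFactors}
    (hi : (i : ℕ) = 2) {x : G} (hx : x ∈ A i) : x ^ 2 = 1 := by
  rw [← hi]
  exact (h.schmidtData i).pow_eq_one_of_mem (h.commute i) hx

theorem exists_conj_eq [Finite G] (h : IsSchmidtFamily A q y) {i : (Nat.card G).primeFactors}
    (hi : (i : ℕ) = 2) {s t : G} (hs : s ∈ A i) (hs1 : s ≠ 1) (ht : t ∈ A i) (ht1 : t ≠ 1) :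
    ∃ g ∈ normalizer (A i : Set G), g * s * g⁻¹ = t := by
  obtain ⟨g, hg⟩ : ∃ g, g ∉ normalizer (A i : Set G) := by
    by_contra! hcon
    exact h.normalizer_ne_top i ((eq_top_iff' _).2 hcon)
  have h1 : g * s * g⁻¹ ∉ A i := fun h2 ↦ hg (h.mem_normalizer i s hs hs1 g h2)
  obtain ⟨k, hk⟩ := isConj_of_sq_eq_one (s := t) (t := g * s * g⁻¹) (h.sq_eq_one hi ht)
    (by rw [conj_pow, h.sq_eq_one hi hs]; simp) fun z _ hzt hzs ↦ by
      by_contra hz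
      exact h1 (h.mem_of_commute i z (h.mem_of_commute i t ht ht1 z hzt) hz _ hzs.symm)
  have h2 : (k⁻¹ * g) * s * (k⁻¹ * g)⁻¹ = t := by
    calc _ = k⁻¹ * (g * s * g⁻¹) * k := by group
      _ = t := by rw [← hk]; group
  exact ⟨k⁻¹ * g, h.mem_normalizer i s hs hs1 _ (h2 ▸ ht), h2⟩

open Classical in
theorem card_of_eq_two [Fintype G] (h : IsSchmidtFamily A q y) {i : (Nat.card G).primeFactors}
    (hi : (i : ℕ) = 2) : Nat.card (A i) = q i + 1 := by
  obtain ⟨s, hs, hs1⟩ := (bot_or_exists_ne_one (A i)).resolve_left (h.ne_bot i)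
  have hN := h.card_normalizer i
  have h1 : Nat.card (normalizer (A i : Set G)) =
      (Nat.card (A i) - 1) * Nat.card (A i) := by
    have hA : Nat.card (A i) = (Finset.univ.filter (· ∈ A i)).card := by
      rw [Nat.card_eq_fintype_card, Fintype.card_subtype]
    have hA' : Nat.card (A i) - 1 = ((Finset.univ.filter (· ∈ A i)).erase 1).card := by
      rw [Finset.card_erase_of_mem (by simp [one_mem]), hA]
    have hN' : Nat.card (normalizer (A i : Set G)) =
        (Finset.univ.filter (· ∈ normalizer (A i : Set G))).card := by
      rw [Nat.card_eq_fintype_card, Fintype.card_subtype]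
    rw [hN', Finset.card_eq_sum_card_fiberwise (f := fun n ↦ n * s * n⁻¹)
      (t := (Finset.univ.filter (· ∈ A i)).erase 1), Finset.sum_const_nat (m := Nat.card (A i)),
      hA']
    · intro t ht
      obtain ⟨ht1, ht⟩ := Finset.mem_erase.1 ht
      obtain ⟨g, hg, rfl⟩ := h.exists_conj_eq hi hs hs1 (Finset.mem_filter.1 ht).2 ht1
      rw [hA]
      refine Finset.card_bij' (fun n _ ↦ g⁻¹ * n) (fun a _ ↦ g * a) ?_ ?_ ?_ ?_
      · intro n hn
        obtain ⟨hn, hng⟩ := Finset.mem_filter.1 hn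
        refine Finset.mem_filter.2 ⟨Finset.mem_univ _, h.mem_of_commute i s hs hs1 _ ?_⟩
        refine mul_inv_eq_iff_eq_mul.1 ?_
        calc g⁻¹ * n * s * (g⁻¹ * n)⁻¹ = g⁻¹ * (n * s * n⁻¹) * g := by group
          _ = s := by rw [hng]; group
      · intro a ha
        have ha := (Finset.mem_filter.1 ha).2
        refine Finset.mem_filter.2 ⟨Finset.mem_filter.2 ⟨Finset.mem_univ _,
          mul_mem hg (le_normalizer ha)⟩, ?_⟩
        have := h.commute i a ha s hs
        calc g * a * s * (g * a)⁻¹ = g * (a * s * a⁻¹) * g⁻¹ := by group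
          _ = _ := by rw [this.eq, mul_inv_cancel_right]
      · intro n _; simp
      · intro n _; simp
    · intro n hn
      rw [Finset.mem_coe, Finset.mem_filter] at hn
      rw [Finset.mem_coe, Finset.mem_erase, Finset.mem_filter]
      exact ⟨by simpa using hs1, Finset.mem_univ _, conj_mem_of_mem_normalizer hn.2 hs⟩
  rw [hN, mul_comm] at h1
  have := Nat.eq_of_mul_eq_mul_right Nat.card_pos h1
  have : 0 < Nat.card (A i) := Nat.card_pos
  omega

/-- The involutions inverting a given element. -/
def _root_.invertingInvolutions [Fintype G] [DecidableEq G] (x : G) : Finset G :=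
  Finset.univ.filter fun t ↦ t ^ 2 = 1 ∧ t ≠ 1 ∧ t * x * t⁻¹ = x⁻¹

theorem _root_.mem_invertingInvolutions [Fintype G] [DecidableEq G] {x t : G} :
    t ∈ invertingInvolutions x ↔ t ^ 2 = 1 ∧ t ≠ 1 ∧ t * x * t⁻¹ = x⁻¹ := by
  simp [invertingInvolutions]

theorem _root_.card_invertingInvolutions_conj [Fintype G] [DecidableEq G] (g x : G) :
    (invertingInvolutions (g * x * g⁻¹)).card = (invertingInvolutions x).card := by
  refine (Finset.card_equiv (MulAut.conj g).toEquiv fun t ↦ ?_).symm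
  change t ∈ _ ↔ g * t * g⁻¹ ∈ _
  simp only [mem_invertingInvolutions, conj_pow]
  refine and_congr (by simp) (and_congr (by simp) ?_)
  have : g * t * g⁻¹ * (g * x * g⁻¹) * (g * t * g⁻¹)⁻¹ = g * (t * x * t⁻¹) * g⁻¹ := by group
  rw [this, conj_inv, mul_left_inj, mul_right_inj]

open Classical in
theorem _root_.sum_card_invertingInvolutions [Fintype G] :
    ∑ x : G, (invertingInvolutions x).card = (invertingInvolutions (1 : G)).card *
      ((invertingInvolutions (1 : G)).card + 1) := by
  have h1 : (Finset.univ.filter fun s : G ↦ s ^ 2 = 1) =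
      insert 1 (invertingInvolutions (1 : G)) := by
    ext s
    rw [Finset.mem_insert, mem_invertingInvolutions, Finset.mem_filter]
    constructor
    · rintro ⟨-, hs⟩
      exact or_iff_not_imp_left.2 fun h ↦ ⟨hs, h, by simp⟩
    · rintro (rfl | ⟨hs, -⟩)
      · simp
      · exact ⟨Finset.mem_univ _, hs⟩
  have h2 : (Finset.univ.filter fun s : G ↦ s ^ 2 = 1).card =
      (invertingInvolutions (1 : G)).card + 1 := by
    rw [h1, Finset.card_insert_of_notMem]
    simp [mem_invertingInvolutions]
  have h3 : ∀ x : G, (invertingInvolutions x).card = ∑ t ∈ invertingInvolutions (1 : G),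
      if t * x * t⁻¹ = x⁻¹ then 1 else 0 := by
    intro x
    rw [← Finset.card_filter]
    congr 1
    ext t
    simp [mem_invertingInvolutions, and_assoc]
  rw [Finset.sum_congr rfl fun x _ ↦ h3 x, Finset.sum_comm, Finset.sum_const_nat]
  intro t ht
  rw [← Finset.card_filter, ← h2]
  obtain ⟨ht2, -, -⟩ := mem_invertingInvolutions.1 ht
  rw [sq] at ht2
  have hti : t⁻¹ = t := inv_eq_of_mul_eq_one_left ht2
  refine Finset.card_equiv (Equiv.mulRight t) fun x ↦ ?_
  simp only [Finset.mem_filter, Finset.mem_univ, true_and, Equiv.coe_mulRight, hti]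
  rw [sq, mul_assoc x t, mul_eq_one_iff_inv_eq, ← mul_assoc, eq_comm]

theorem card_invertingInvolutions_of_eq_two [Fintype G] [DecidableEq G]
    (h : IsSchmidtFamily A q y) {i : (Nat.card G).primeFactors} (hi : (i : ℕ) = 2) {x : G}
    (hx : x ∈ A i) (hx1 : x ≠ 1) : (invertingInvolutions x).card = q i := by
  classical
  have h1 : insert 1 (invertingInvolutions x) = Finset.univ.filter (· ∈ A i) := by
    ext t
    rw [Finset.mem_insert, mem_invertingInvolutions, Finset.mem_filter]
    have hxi : x⁻¹ = x := inv_eq_of_mul_eq_one_left (by rw [← sq, h.sq_eq_one hi hx])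
    constructor
    · rintro (rfl | ⟨-, -, ht⟩)
      · exact ⟨Finset.mem_univ _, one_mem _⟩
      · rw [hxi] at ht
        exact ⟨Finset.mem_univ _, h.mem_of_commute i x hx hx1 t (mul_inv_eq_iff_eq_mul.1 ht)⟩
    · rintro ⟨-, ht⟩
      refine or_iff_not_imp_left.2 fun ht1 ↦ ⟨h.sq_eq_one hi ht, ht1, ?_⟩
      rw [hxi]
      exact mul_inv_eq_iff_eq_mul.2 (h.commute i t ht x hx)
  have h2 : (Finset.univ.filter (· ∈ A i)).card = q i + 1 := by
    rw [← h.card_of_eq_two hi, Nat.card_eq_fintype_card, Fintype.card_subtype]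
  rw [← h1, Finset.card_insert_of_notMem (by simp [mem_invertingInvolutions])] at h2
  omega

theorem card_invertingInvolutions_of_q_eq_two [Fintype G] [DecidableEq G]
    (h : IsSchmidtFamily A q y) {i : (Nat.card G).primeFactors} (hq : q i = 2) {x : G}
    (hx : x ∈ A i) (hx1 : x ≠ 1) : (invertingInvolutions x).card = i := by
  classical
  have hS := h.schmidtData i
  have hy := h.pow_eq_one i
  rw [hq] at hS hy
  have hcard := hS.card_eq_prime (h.commute i) hy
  have hi : (i : ℕ) ≠ 2 := hS.ne
  have h1 : invertingInvolutions x = Finset.univ.filter (· ∈ normalizer (A i : Set G)) \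
      Finset.univ.filter (· ∈ A i) := by
    ext t
    rw [mem_invertingInvolutions, Finset.mem_sdiff, Finset.mem_filter, Finset.mem_filter]
    constructor
    · rintro ⟨ht2, ht1, ht⟩
      exact ⟨⟨Finset.mem_univ _, h.mem_normalizer i x hx hx1 t (ht ▸ inv_mem hx)⟩,
        fun ht' ↦ ht1 (h.eq_one_of_sq hi ht'.2 ht2)⟩
    · rintro ⟨⟨-, ht⟩, htA⟩
      obtain ⟨u, hu, k, rfl⟩ := hS.exists_eq_mul t ht
      obtain ⟨k, rfl | rfl⟩ := Nat.even_or_odd' k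
      · rw [pow_mul, hy, one_pow, mul_one] at htA
        exact absurd ⟨Finset.mem_univ _, hu⟩ htA
      · have hyk : y i ^ (2 * k + 1) = y i := by rw [pow_succ, pow_mul, hy, one_pow, one_mul]
        rw [hyk] at htA ⊢
        refine ⟨?_, ?_, ?_⟩
        · have h2 := hS.conj_eq_inv (h.commute i) hy hu
          have hyi : y i ^ 2 = 1 := hy
          rw [mul_inv_eq_iff_eq_mul] at h2
          rw [sq, mul_assoc, ← mul_assoc (y i), h2, mul_assoc, ← sq, hyi, mul_one, mul_inv_cancel]
        · intro h2
          exact htA ⟨Finset.mem_univ _, h2 ▸ one_mem _⟩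
        · have h2 := hS.conj_eq_inv (h.commute i) hy hx
          calc u * y i * x * (u * y i)⁻¹ = u * (y i * x * (y i)⁻¹) * u⁻¹ := by group
            _ = _ := by rw [h2, (h.commute i u hu _ (inv_mem hx)).eq, mul_inv_cancel_right]
  rw [h1, Finset.card_sdiff_of_subset (fun t ht ↦ Finset.mem_filter.2
    ⟨Finset.mem_univ _, le_normalizer (Finset.mem_filter.1 ht).2⟩), ← Fintype.card_subtype,
    ← Fintype.card_subtype, ← Nat.card_eq_fintype_card, ← Nat.card_eq_fintype_card]
  have h2 := h.card_normalizer i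
  rw [hq, hcard] at h2
  change Nat.card (normalizer (A i : Set G)) - Nat.card (A i) = _
  omega

theorem card_invertingInvolutions_eq_zero [Fintype G] [DecidableEq G]
    (h : IsSchmidtFamily A q y) {i : (Nat.card G).primeFactors} (hi : (i : ℕ) ≠ 2)
    (hq : q i ≠ 2) {x : G} (hx : x ∈ A i) (hx1 : x ≠ 1) : (invertingInvolutions x).card = 0 := by
  rw [Finset.card_eq_zero, Finset.eq_empty_iff_forall_notMem]
  intro t ht
  obtain ⟨ht2, ht1, ht⟩ := mem_invertingInvolutions.1 ht
  have htN := h.mem_normalizer i x hx hx1 t (ht ▸ inv_mem hx)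
  have h1 : orderOf t = 2 := orderOf_eq_prime ht2 ht1
  have h2 : orderOf t ∣ Nat.card (A i) * q i := by
    rw [← h.card_normalizer i, ← Subgroup.orderOf_mk t htN]
    exact orderOf_dvd_natCard _
  rw [h1, Nat.prime_two.dvd_mul] at h2
  rcases h2 with h2 | h2
  · exact (Nat.not_even_iff_odd.2 (h.odd_card hi)) (even_iff_two_dvd.2 h2)
  · exact hq ((Nat.prime_dvd_prime_iff_eq Nat.prime_two (h.schmidtData i).prime_right).1 h2).symm

end IsSchmidtFamily

end EvenOrder

section InvolutionCount

namespace IsSchmidtFamily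

variable {G : Type*} [Group G] {A : (Nat.card G).primeFactors → Subgroup G}
  {q : (Nat.card G).primeFactors → ℕ} {y : (Nat.card G).primeFactors → G}

open Classical in
theorem _root_.sum_ite_mem_ne_one {G : Type*} [Group G] [Fintype G] (A : Subgroup G) {k : Type*}
    [Field k] (F : G → k)
    (c : k) (hF : ∀ x ∈ A, x ≠ 1 → F x = c) :
    (∑ x, if x ∈ A ∧ x ≠ 1 then F x else 0) = ((Nat.card A : k) - 1) * c := by
  have h1 : ∀ x, (if x ∈ A ∧ x ≠ 1 then F x else 0) =
      (if x ∈ A then c else 0) - if x = 1 then c else 0 := by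
    intro x
    by_cases hx1 : x = 1
    · simp [hx1, one_mem]
    · by_cases hx : x ∈ A
      · simp [hx, hx1, hF x hx hx1]
      · simp [hx, hx1]
  rw [Finset.sum_congr rfl fun x _ ↦ h1 x, Finset.sum_sub_distrib, Finset.sum_ite_eq',
    if_pos (Finset.mem_univ _), ← Finset.sum_filter, Finset.sum_const, nsmul_eq_mul, sub_mul,
    one_mul, Nat.card_eq_fintype_card, Fintype.card_subtype]

open Classical in
theorem card_eq_mul [Fintype G] (h : IsSchmidtFamily A q y) {i : (Nat.card G).primeFactors}
    (hi : (i : ℕ) = 2) :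
    Nat.card G = (invertingInvolutions (1 : G)).card * (q i + 1) := by
  have h1 := h.sum_eq (fun x ↦ if x ^ 2 = 1 ∧ x ≠ 1 then (1 : ℚ) else 0) fun g x ↦ by
    simp [conj_pow]
  rw [Finset.sum_eq_single i] at h1
  · rw [sum_ite_mem_ne_one (A i) _ 1 fun x hx hx1 ↦ if_pos ⟨h.sq_eq_one hi hx, hx1⟩,
      h.card_of_eq_two hi] at h1
    have h2 : (Finset.univ.filter fun x : G ↦ x ^ 2 = 1 ∧ x ≠ 1) =
        invertingInvolutions (1 : G) := by
      ext x; simp [mem_invertingInvolutions]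
    rw [Finset.sum_boole, h2] at h1
    have hq : (0 : ℚ) < q i := by exact_mod_cast h.q_pos i
    simp only [ne_eq, not_true_eq_false, and_false, if_false, zero_add] at h1
    have h3 : (Nat.card G : ℚ) = (invertingInvolutions (1 : G)).card * (q i + 1) := by
      rw [h1]
      push_cast
      field_simp
      ring
    exact_mod_cast h3
  · intro j _ hj
    have hj2 : (j : ℕ) ≠ 2 := fun h2 ↦ hj (Subtype.ext (h2.trans hi.symm))
    rw [sum_ite_mem_ne_one (A j) _ 0 fun x hx hx1 ↦ if_neg fun h2 ↦
      hx1 (h.eq_one_of_sq hj2 hx h2.1), mul_zero, mul_zero]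
  · intro hi'
    exact absurd (Finset.mem_univ i) hi'

theorem card_of_q_eq_two [Finite G] (h : IsSchmidtFamily A q y) {i : (Nat.card G).primeFactors}
    (hq : q i = 2) : Nat.card (A i) = i := by
  have hS := h.schmidtData i
  have hy := h.pow_eq_one i
  rw [hq] at hS hy
  exact hS.card_eq_prime (h.commute i) hy

theorem q_ne_two [Finite G] (h : IsSchmidtFamily A q y) {i : (Nat.card G).primeFactors}
    (hi : (i : ℕ) = 2) : q i ≠ 2 := fun h2 ↦ (h.schmidtData i).ne (hi.trans h2.symm)

open Classical in
/-- Counting pairs of involutions by their product. -/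
theorem card_involutions_eq [Fintype G] (h : IsSchmidtFamily A q y)
    {i : (Nat.card G).primeFactors} (hi : (i : ℕ) = 2) :
    2 * (invertingInvolutions (1 : G)).card =
      2 * q i + (q i + 1) * ∑ j with q j = 2, ((j : ℕ) - 1) := by
  set m := (invertingInvolutions (1 : G)).card with hm
  have hcard : (Nat.card G : ℚ) = m * (q i + 1) := by exact_mod_cast h.card_eq_mul hi
  have hg : (0 : ℚ) < Nat.card G := by exact_mod_cast Nat.card_pos
  have hq : (0 : ℚ) < q i := by exact_mod_cast h.q_pos i
  have hm0 : (m : ℚ) ≠ 0 := by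
    intro h0
    rw [h0, zero_mul] at hcard
    exact hg.ne' hcard
  have h1 := h.sum_eq (fun x ↦ ((invertingInvolutions x).card : ℚ)) fun g x ↦ by
    rw [card_invertingInvolutions_conj]
  rw [← Nat.cast_sum, sum_card_invertingInvolutions, ← hm] at h1
  have hi' : i ∉ Finset.univ.filter fun j ↦ q j = 2 := by simp [h.q_ne_two hi]
  rw [← Finset.sum_subset (Finset.subset_univ (insert i (Finset.univ.filter fun j ↦ q j = 2))),
    Finset.sum_insert hi', sum_ite_mem_ne_one (A i) _ (q i : ℚ) fun x hx hx1 ↦ by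
      rw [h.card_invertingInvolutions_of_eq_two hi hx hx1], h.card_of_eq_two hi] at h1
  · have h2 : ∀ j ∈ Finset.univ.filter fun j ↦ q j = 2,
        (Nat.card G : ℚ) / (Nat.card (A j) * q j) * (∑ x, if x ∈ A j ∧ x ≠ 1 then
          ((invertingInvolutions x).card : ℚ) else 0) = Nat.card G / 2 * ((j : ℕ) - 1 : ℕ) := by
      intro j hj
      have hj := (Finset.mem_filter.1 hj).2
      have hj0 : (0 : ℚ) < (j : ℕ) := by exact_mod_cast (h.schmidtData j).prime_left.pos
      rw [sum_ite_mem_ne_one (A j) _ ((j : ℕ) : ℚ) fun x hx hx1 ↦ by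
        rw [h.card_invertingInvolutions_of_q_eq_two hj hx hx1], h.card_of_q_eq_two hj, hj,
        Nat.cast_sub (h.schmidtData j).prime_left.one_le]
      field_simp
      push_cast
      ring
    rw [Finset.sum_congr rfl h2, ← Finset.mul_sum, ← Nat.cast_sum, hcard] at h1
    generalize (∑ j with q j = 2, ((j : ℕ) - 1)) = s at *
    push_cast at h1
    have h3 : (2 * m : ℚ) = 2 * q i + (q i + 1) * s := by
      field_simp at h1
      linarith
    exact_mod_cast h3
  · intro j _ hj
    rw [Finset.mem_insert, Finset.mem_filter, not_or] at hj
    have hj2 : (j : ℕ) ≠ 2 := fun h2 ↦ hj.1 (Subtype.ext (h2.trans hi.symm))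
    have hjq : q j ≠ 2 := fun h2 ↦ hj.2 ⟨Finset.mem_univ _, h2⟩
    rw [sum_ite_mem_ne_one (A j) _ 0 fun x hx hx1 ↦ by
      rw [h.card_invertingInvolutions_eq_zero hj2 hjq hx hx1, Nat.cast_zero], mul_zero, mul_zero]

theorem sum_lt_one [Fintype G] (h : IsSchmidtFamily A q y) {i : (Nat.card G).primeFactors}
    (hi : (i : ℕ) = 2) :
    1 / (q i + 1 : ℚ) + ∑ j with q j = 2, (1 - 1 / ((j : ℕ) : ℚ)) / 2 < 1 := by
  classical
  have h1 := h.sum_eq (fun _ : G ↦ (1 : ℚ)) fun g x ↦ rfl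
  have hg : (0 : ℚ) < Nat.card G := by exact_mod_cast Nat.card_pos
  have hq : (0 : ℚ) < q i := by exact_mod_cast h.q_pos i
  have hi' : i ∉ Finset.univ.filter fun j ↦ q j = 2 := by simp [h.q_ne_two hi]
  have h2 : ∀ j, (Nat.card G : ℚ) / (Nat.card (A j) * q j) *
      (∑ x, if x ∈ A j ∧ x ≠ 1 then (1 : ℚ) else 0) =
      Nat.card G * ((1 - 1 / Nat.card (A j)) / q j) := by
    intro j
    have hj0 : (0 : ℚ) < Nat.card (A j) := by exact_mod_cast Nat.card_pos
    have hj1 : (0 : ℚ) < q j := by exact_mod_cast h.q_pos j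
    rw [sum_ite_mem_ne_one (A j) _ 1 fun x hx hx1 ↦ rfl]
    field_simp
  rw [Finset.sum_congr rfl fun j _ ↦ h2 j, ← Finset.mul_sum, Finset.sum_const, Finset.card_univ,
    ← Nat.card_eq_fintype_card, nsmul_eq_mul, mul_one] at h1
  have h3 : ∑ j ∈ insert i (Finset.univ.filter fun j ↦ q j = 2),
      (1 - 1 / (Nat.card (A j) : ℚ)) / q j ≤ ∑ j, (1 - 1 / (Nat.card (A j) : ℚ)) / q j := by
    refine Finset.sum_le_sum_of_subset_of_nonneg (Finset.subset_univ _) fun j _ _ ↦ ?_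
    have hj0 : (1 : ℚ) ≤ Nat.card (A j) := by exact_mod_cast Nat.card_pos
    exact div_nonneg (sub_nonneg.2 ((div_le_one (by linarith)).2 hj0)) (Nat.cast_nonneg _)
  rw [Finset.sum_insert hi', h.card_of_eq_two hi] at h3
  have h4 : ∑ j with q j = 2, (1 - 1 / (Nat.card (A j) : ℚ)) / q j =
      ∑ j with q j = 2, (1 - 1 / ((j : ℕ) : ℚ)) / 2 := by
    refine Finset.sum_congr rfl fun j hj ↦ ?_
    have hj := (Finset.mem_filter.1 hj).2
    rw [h.card_of_q_eq_two hj, hj]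
    rfl
  have h5 : (1 - 1 / ((q i + 1 : ℕ) : ℚ)) / q i = 1 / (q i + 1) := by
    push_cast
    field_simp
    ring
  rw [h4, h5] at h3
  refine lt_of_le_of_lt h3 ?_
  by_contra! hcon
  have := mul_le_mul_of_nonneg_left hcon hg.le
  linarith

end IsSchmidtFamily

end InvolutionCount

section IsoA5

/-- A simple group of order `60` with a subgroup of index `5` is `A₅`. -/
theorem nonempty_mulEquiv_alternatingGroup {G : Type*} [Group G] [Finite G]
    (hG : IsSimpleGroup G) (hcard : Nat.card G = 60) (N : Subgroup G) (hN : N.index = 5) :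
    Nonempty (G ≃* alternatingGroup (Fin 5)) := by
  have e : G ⧸ N ≃ Fin 5 := (Finite.equivFinOfCardEq hN)
  let f : G →* Equiv.Perm (Fin 5) :=
    (e.permCongrHom : Equiv.Perm (G ⧸ N) →* Equiv.Perm (Fin 5)).comp (MulAction.toPermHom G (G ⧸ N))
  have hker : f.ker = ⊥ := by
    refine (MonoidHom.normal_ker f).eq_bot_or_eq_top.resolve_right fun h ↦ ?_
    have h1 : (MulAction.toPermHom G (G ⧸ N)).ker = ⊤ := by
      rw [eq_top_iff'] at h ⊢
      intro g
      exact e.permCongrHom.injective (by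
        rw [map_one]
        exact h g)
    rw [← normalCore_eq_ker] at h1
    have h2 : N = ⊤ := top_le_iff.1 (h1 ▸ normalCore_le N)
    rw [h2, index_top] at hN
    omega
  have hf : Function.Injective f := (MonoidHom.ker_eq_bot_iff f).1 hker
  have e' := MonoidHom.ofInjective hf
  have hr : f.range.index = 2 := by
    have h1 := f.range.card_mul_index
    rw [← Nat.card_congr e'.toEquiv, hcard, Nat.card_eq_fintype_card, Fintype.card_perm,
      Fintype.card_fin] at h1
    have : Nat.factorial 5 = 120 := rfl
    omega
  rw [Equiv.Perm.eq_alternatingGroup_of_index_eq_two hr] at e'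
  exact ⟨e'⟩

theorem eq_of_mersenne_prime {Q r₁ r₂ m d : ℕ} (hQ : Q.Prime) (hQd : Q + 1 = 2 ^ d)
    (h₁ : r₁.Prime) (h₂ : r₂.Prime) (h₁2 : r₁ ≠ 2) (h₂2 : r₂ ≠ 2) (hlt : r₁ < r₂) (hle : r₁ ≤ Q)
    (hr₁ : r₁ ∣ m) (hr₂ : r₂ ∣ m) (hQm : Q ∣ m) (hQ2 : Q ≠ 2)
    (hm : 2 * m = 2 * Q + (Q + 1) * ((r₁ - 1) + (r₂ - 1))) : m = 15 ∧ Q = 3 := by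
  have hQ3 : 3 ≤ Q := by have := hQ.two_le; omega
  have hr3 : 3 ≤ r₁ := by have := h₁.two_le; omega
  obtain ⟨s, hs⟩ : ∃ s, r₁ + r₂ = 2 + 2 * s := by
    obtain ⟨a, ha⟩ := h₁.odd_of_ne_two h₁2
    obtain ⟨b, hb⟩ := h₂.odd_of_ne_two h₂2
    exact ⟨a + b, by omega⟩
  have hs' : r₁ - 1 + (r₂ - 1) = 2 * s := by omega
  have hm1 : m = Q + (Q + 1) * s := by
    rw [hs'] at hm
    nlinarith
  have hQs : Q ∣ s := by
    have h : Q ∣ (Q + 1) * s := (Nat.dvd_add_right (dvd_refl Q)).1 (hm1 ▸ hQm)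
    exact (Nat.Coprime.dvd_mul_left (by simp)).1 h
  obtain ⟨l, rfl⟩ := hQs
  have hl : 1 ≤ l := by
    rcases Nat.eq_zero_or_pos l with rfl | h
    · omega
    · exact h
  have hm2 : m = Q * (1 + (Q + 1) * l) := by rw [hm1]; ring
  have hdvd : ∀ r : ℕ, r.Prime → r ∣ m → r ≠ Q → r ∣ 1 + (Q + 1) * l := by
    intro r hr hrm hrQ
    rw [hm2, hr.dvd_mul] at hrm
    exact hrm.resolve_left fun h ↦ hrQ ((Nat.prime_dvd_prime_iff_eq hr hQ).1 h)
  have hr2Q : r₂ ≠ Q := by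
    rintro rfl
    nlinarith
  have hd2 := Nat.le_of_dvd (by positivity) (hdvd r₂ h₂ hr₂ hr2Q)
  have hr1Q : r₁ = Q := by
    by_contra hne
    have h12 : r₁ * r₂ ∣ 1 + (Q + 1) * l := Nat.Coprime.mul_dvd_of_dvd_of_dvd
      ((Nat.coprime_primes h₁ h₂).2 hlt.ne) (hdvd r₁ h₁ hr₁ hne) (hdvd r₂ h₂ hr₂ hr2Q)
    have h3 := Nat.le_of_dvd (by positivity) h12
    have h4 : r₂ + Q ≥ 2 + 2 * (Q * l) := by omega
    have h5 : 3 * r₂ ≤ r₁ * r₂ := Nat.mul_le_mul_right _ hr3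
    nlinarith
  subst hr1Q
  have hl1 : l = 1 := by
    by_contra hne
    have h2l : 2 ≤ l := by omega
    obtain ⟨k, rfl⟩ := Nat.exists_eq_add_of_le h2l
    nlinarith
  subst hl1
  have hr2 : r₂ = r₁ + 2 := by omega
  have h3 : r₁ % 3 = 0 ∨ r₂ % 3 = 0 := by
    have : 2 ^ d % 3 = 1 ∨ 2 ^ d % 3 = 2 := by
      clear * -
      induction d with
      | zero => simp
      | succ n ih => rw [pow_succ]; omega
    omega
  have : r₁ = 3 := by
    rcases h3 with h3 | h3
    · exact ((Nat.prime_dvd_prime_iff_eq Nat.prime_three h₁).1 (Nat.dvd_of_mod_eq_zero h3)).symm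
    · have := (Nat.prime_dvd_prime_iff_eq Nat.prime_three h₂).1 (Nat.dvd_of_mod_eq_zero h3)
      omega
  subst this
  exact ⟨by rw [hm2], rfl⟩

theorem not_prime_dvd_of_mersenne {Q r m : ℕ} (hQ : Q.Prime) (hQ2 : Q ≠ 2) (hr : r.Prime)
    (hrm : r ∣ m) (hQm : Q ∣ m) (hm : 2 * m = 2 * Q + (Q + 1) * (r - 1)) : False := by
  have hQ3 : 3 ≤ Q := by have := hQ.two_le; omega
  obtain ⟨s, rfl⟩ : ∃ s, r = s + 1 := ⟨r - 1, by have := hr.pos; omega⟩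
  have hs : 0 < s := by have := hr.two_le; omega
  obtain ⟨t, rfl⟩ : ∃ t, Q = t + 1 := ⟨Q - 1, by omega⟩
  rw [Nat.add_sub_cancel] at hm
  have h1 : s + 1 ∣ t := by
    have h2 : 2 * m = (t + 1 + 1) * (s + 1) + t := by rw [hm]; ring
    exact (Nat.dvd_add_right (Dvd.intro_left _ rfl)).1 (h2 ▸ Dvd.dvd.mul_left hrm 2)
  have h2 : t + 1 ∣ s := by
    have h2 : 2 * m = (t + 1) * (s + 2) + s := by rw [hm]; ring
    exact (Nat.dvd_add_right (Dvd.intro _ rfl)).1 (h2 ▸ Dvd.dvd.mul_left hQm 2)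
  have := Nat.le_of_dvd (by omega) h1
  have := Nat.le_of_dvd hs h2
  omega

namespace IsSchmidtFamily

variable {G : Type*} [Group G] {A : (Nat.card G).primeFactors → Subgroup G}
  {q : (Nat.card G).primeFactors → ℕ} {y : (Nat.card G).primeFactors → G}

theorem card_q_eq_two_le [Fintype G] (h : IsSchmidtFamily A q y) {i : (Nat.card G).primeFactors}
    (hi : (i : ℕ) = 2) : (Finset.univ.filter fun j ↦ q j = 2).card ≤ 2 := by
  by_contra! hcon
  have h1 := h.sum_lt_one hi
  have hq : (0 : ℚ) < 1 / (q i + 1) := by positivity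
  have h2 : (Finset.univ.filter fun j ↦ q j = 2).card • (1 / 3 : ℚ) ≤
      ∑ j with q j = 2, (1 - 1 / ((j : ℕ) : ℚ)) / 2 := by
    refine Finset.card_nsmul_le_sum _ _ _ fun j hj ↦ ?_
    have hj := (Finset.mem_filter.1 hj).2
    have h3 : 3 ≤ (j : ℕ) := by
      have := (h.schmidtData j).prime_left.two_le
      have := (h.schmidtData j).ne
      omega
    have h3' : (3 : ℚ) ≤ (j : ℕ) := by exact_mod_cast h3
    have h4 : 1 / ((j : ℕ) : ℚ) ≤ 1 / 3 := one_div_le_one_div_of_le (by norm_num) h3'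
    linarith
  have h3 : (3 : ℚ) ≤ (Finset.univ.filter fun j ↦ q j = 2).card := by exact_mod_cast hcon
  rw [nsmul_eq_mul] at h2
  linarith

theorem nonempty_mulEquiv_alternatingGroup [Finite G] (hG : IsSimpleGroup G)
    (h : IsSchmidtFamily A q y) {i : (Nat.card G).primeFactors} (hi : (i : ℕ) = 2) :
    Nonempty (G ≃* alternatingGroup (Fin 5)) := by
  classical
  have := Fintype.ofFinite G
  have hcard := h.card_eq_mul hi
  have hm := h.card_involutions_eq hi
  have hlt := h.sum_lt_one hi
  have hle := h.card_q_eq_two_le hi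
  have hN := h.card_normalizer i
  rw [h.card_of_eq_two hi] at hN
  have hQ := (h.schmidtData i).prime_right
  have hQ2 := h.q_ne_two hi
  have hNG := (normalizer (A i : Set G)).card_mul_index
  rw [hN] at hNG
  obtain ⟨d, hd⟩ : ∃ d, q i + 1 = 2 ^ d := by
    have := Fact.mk (h.schmidtData i).prime_left
    obtain ⟨d, hd⟩ := IsPGroup.iff_card.1 (h.schmidtData i).isPGroup
    exact ⟨d, by rw [← h.card_of_eq_two hi, hd, hi]⟩
  have hdvd : ∀ r : ℕ, r.Prime → r ≠ 2 → r ∣ Nat.card G →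
      r ∣ (invertingInvolutions (1 : G)).card := by
    intro r hr hr2 hrG
    rw [hcard, hr.dvd_mul] at hrG
    refine hrG.resolve_right fun h2 ↦ hr2 ?_
    rw [hd] at h2
    exact (Nat.prime_dvd_prime_iff_eq hr Nat.prime_two).1 (hr.dvd_of_dvd_pow h2)
  have hQm := hdvd _ hQ hQ2 (hNG ▸ Dvd.dvd.mul_right (Dvd.intro_left _ rfl) _)
  have hr : ∀ j : (Nat.card G).primeFactors, q j = 2 → (j : ℕ).Prime ∧ (j : ℕ) ≠ 2 ∧
      (j : ℕ) ∣ (invertingInvolutions (1 : G)).card := fun j hj ↦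
    have h1 : (j : ℕ) ≠ 2 := fun h2 ↦ h.q_ne_two h2 hj
    ⟨(h.schmidtData j).prime_left, h1,
      hdvd _ (h.schmidtData j).prime_left h1 (Nat.dvd_of_mem_primeFactors j.2)⟩
  obtain h0 | h1 | h2 : (Finset.univ.filter fun j ↦ q j = 2).card = 0 ∨
      (Finset.univ.filter fun j ↦ q j = 2).card = 1 ∨
      (Finset.univ.filter fun j ↦ q j = 2).card = 2 := by omega
  · rw [Finset.card_eq_zero.1 h0, Finset.sum_empty] at hm
    refine absurd (card_eq_iff_eq_top _ |>.1 ?_) (h.normalizer_ne_top i)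
    rw [hN, hcard, mul_comm]
    congr 1
    omega
  · obtain ⟨j, hj⟩ := Finset.card_eq_one.1 h1
    have hjq : q j = 2 :=
      (Finset.mem_filter.1 (show j ∈ Finset.univ.filter fun j ↦ q j = 2 by rw [hj]; simp)).2
    rw [hj, Finset.sum_singleton] at hm
    exact (not_prime_dvd_of_mersenne hQ hQ2 (hr j hjq).1 (hr j hjq).2.2 hQm hm).elim
  · obtain ⟨j, k, hjk, hT⟩ := Finset.card_eq_two.1 h2
    have hjq : q j = 2 :=
      (Finset.mem_filter.1 (show j ∈ Finset.univ.filter fun j ↦ q j = 2 by rw [hT]; simp)).2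
    have hkq : q k = 2 :=
      (Finset.mem_filter.1 (show k ∈ Finset.univ.filter fun j ↦ q j = 2 by rw [hT]; simp)).2
    rw [hT, Finset.sum_pair hjk] at hm hlt
    have hjk' : (j : ℕ) ≠ k := fun h ↦ hjk (Subtype.ext h)
    obtain ⟨hj1, hj2, hj3⟩ := hr j hjq
    obtain ⟨hk1, hk2, hk3⟩ := hr k hkq
    have hmin : ∀ a b : ℕ, 0 < a → a < b → 1 / (q i + 1 : ℚ) +
        ((1 - 1 / (a : ℚ)) / 2 + (1 - 1 / (b : ℚ)) / 2) < 1 → a ≤ q i := by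
      intro a b ha hab hlt
      by_contra! hcon
      have ha' : (0 : ℚ) < a := by exact_mod_cast ha
      have h1 : 1 / (b : ℚ) ≤ 1 / a := one_div_le_one_div_of_le ha' (by exact_mod_cast hab.le)
      have h2 : 1 / (a : ℚ) ≤ 1 / (q i + 1) :=
        one_div_le_one_div_of_le (by positivity) (by exact_mod_cast hcon)
      linarith
    obtain ⟨hm15, hq3⟩ : (invertingInvolutions (1 : G)).card = 15 ∧ q i = 3 := by
      rcases lt_or_gt_of_ne hjk' with hlt' | hlt'
      · exact eq_of_mersenne_prime hQ hd hj1 hk1 hj2 hk2 hlt' (hmin _ _ hj1.pos hlt' hlt) hj3 hk3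
          hQm hQ2 hm
      · rw [add_comm ((j : ℕ) - 1)] at hm
        rw [add_comm ((1 - 1 / ((j : ℕ) : ℚ)) / 2)] at hlt
        exact eq_of_mersenne_prime hQ hd hk1 hj1 hk2 hj2 hlt' (hmin _ _ hk1.pos hlt' hlt) hk3 hj3
          hQm hQ2 hm
    rw [hm15, hq3] at hcard
    rw [hcard, hq3] at hNG
    exact _root_.nonempty_mulEquiv_alternatingGroup hG hcard (normalizer (A i : Set G)) (by omega)

end IsSchmidtFamily

end IsoA5

section CharacterTable

/-- The trace of left multiplication by `X` and right multiplication by `Y` on a product of matrix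
algebras. -/
theorem trace_mulLeft_mulRight_pi_matrix {k ι : Type*} [Field k] [Fintype ι] {d : ι → ℕ}
    (X Y : Π i, Matrix (Fin (d i)) (Fin (d i)) k) :
    LinearMap.trace k _ (LinearMap.mulLeft k X ∘ₗ LinearMap.mulRight k Y) =
      ∑ i, (X i).trace * (Y i).trace := by
  classical
  let b := Pi.basis fun i ↦ Matrix.stdBasis k (Fin (d i)) (Fin (d i))
  rw [LinearMap.trace_eq_matrix_trace k b, Matrix.trace, Fintype.sum_sigma]
  refine Finset.sum_congr rfl fun i _ ↦ ?_
  rw [Fintype.sum_prod_type, Matrix.trace, Matrix.trace, Finset.sum_mul_sum]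
  refine Finset.sum_congr rfl fun r _ ↦ Finset.sum_congr rfl fun s _ ↦ ?_
  rw [Matrix.diag_apply, LinearMap.toMatrix_apply, Pi.basis_repr, Pi.basis_apply]
  rw [LinearMap.comp_apply, LinearMap.mulRight_apply, LinearMap.mulLeft_apply, Pi.mul_apply,
    Pi.mul_apply, Pi.single_eq_same, Matrix.stdBasis_eq_single]
  have h (M : Matrix (Fin (d i)) (Fin (d i)) k) :
    (Matrix.stdBasis k (Fin (d i)) (Fin (d i))).repr M (r, s) = M r s := rfl
  rw [h]
  simp [Matrix.mul_apply, Matrix.single_apply, ite_and]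

theorem trace_mulLeft_mulRight_single {k G : Type*} [Field k] [Group G] [Fintype G] (x y : G) :
    LinearMap.trace k _ (LinearMap.mulLeft k (MonoidAlgebra.single x (1 : k)) ∘ₗ
      LinearMap.mulRight k (MonoidAlgebra.single y⁻¹ (1 : k))) =
      (Nat.card {h : G // h * x * h⁻¹ = y} : k) := by
  classical
  let b : Module.Basis G k (MonoidAlgebra k G) := MonoidAlgebra.basis G k
  rw [LinearMap.trace_eq_matrix_trace k b, Matrix.trace]
  have h (g : G) : Matrix.diag (LinearMap.toMatrix b b
      (LinearMap.mulLeft k (MonoidAlgebra.single x (1 : k)) ∘ₗ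
        LinearMap.mulRight k (MonoidAlgebra.single y⁻¹ (1 : k)))) g =
      if g⁻¹ * x * g⁻¹⁻¹ = y then 1 else 0 := by
    have h1 : b g = MonoidAlgebra.single g 1 := by simp [b]
    have h2 (z : MonoidAlgebra k G) : b.repr z g = z.coeff g := rfl
    rw [Matrix.diag_apply, LinearMap.toMatrix_apply, h1, h2]
    have h3 : x * (g * y⁻¹) = g ↔ g⁻¹ * x * g⁻¹⁻¹ = y := by
      rw [inv_inv, ← mul_assoc, mul_inv_eq_iff_eq_mul, mul_assoc, inv_mul_eq_iff_eq_mul]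
    simp [MonoidAlgebra.single_mul_single, Finsupp.single_apply, h3]
  rw [Finset.sum_congr rfl fun g _ ↦ h g, ← Equiv.sum_comp (Equiv.inv G)]
  simp [Nat.card_eq_fintype_card, Fintype.card_subtype]

theorem exists_trace_eq_natCast_of_isIdempotentElem {n : Type*} [Fintype n] [DecidableEq n]
    {k : Type*} [Field k] {E : Matrix n n k} (hE : IsIdempotentElem E) :
    ∃ m : ℕ, E.trace = m := by
  have h : IsIdempotentElem (Matrix.toLin' E) := by
    rw [IsIdempotentElem, Module.End.mul_eq_comp, ← Matrix.toLin'_mul, hE.eq]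
  exact ⟨_, (Matrix.trace_toLin'_eq E).symm.trans
    ((LinearMap.isProj_range_iff_isIdempotentElem _).2 h).trace⟩

/-- A complete set of irreducible complex characters of a finite group. -/
structure IsCharacterTable {G X : Type*} [Group G] [Fintype G] [Fintype X] (χ : X → G → ℂ) :
    Prop where
  conj : ∀ i g h, χ i (g * h * g⁻¹) = χ i h
  sum_mul_inv : ∀ x y, ∑ i, χ i x * χ i y⁻¹ = Nat.card {h : G // h * x * h⁻¹ = y}
  linearIndependent : ∀ c : X → ℂ, (∀ g, ∑ i, c i * χ i g = 0) → c = 0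
  exists_multiplicity : ∀ i (A : Subgroup G) [Fintype A] (l : A →* ℂˣ),
    ∃ n : ℕ, ∑ a : A, ((l a)⁻¹ : ℂˣ) * χ i a = Nat.card A * n
  exists_degree : ∀ i, ∃ d : ℕ, 1 ≤ d ∧ χ i 1 = d ∧ (d = 1 → ∀ g h, χ i (g * h) = χ i g * χ i h)

theorem exists_isCharacterTable (G : Type*) [Group G] [Fintype G] :
    ∃ (n : ℕ) (χ : Fin n → G → ℂ), IsCharacterTable χ := by
  classical
  have : NeZero (Nat.card G : ℂ) := ⟨by simp⟩
  obtain ⟨n, d, hd, ⟨φ⟩⟩ :=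
    IsSemisimpleRing.exists_algEquiv_pi_matrix_of_isAlgClosed ℂ (MonoidAlgebra ℂ G)
  let ρ (i : Fin n) : G →* Matrix (Fin (d i)) (Fin (d i)) ℂ :=
    ((Pi.evalMonoidHom (fun i ↦ Matrix (Fin (d i)) (Fin (d i)) ℂ) i).comp
      (φ : MonoidAlgebra ℂ G →* Π i, Matrix (Fin (d i)) (Fin (d i)) ℂ)).comp (MonoidAlgebra.of ℂ G)
  refine ⟨n, fun i g ↦ (ρ i g).trace, ?_, ?_, ?_, ?_, ?_⟩
  · intro i g h
    rw [map_mul, Matrix.trace_mul_comm, ← map_mul, inv_mul_cancel_left]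
  · intro x y
    rw [← trace_mulLeft_mulRight_single x y]
    have h := trace_mulLeft_mulRight_pi_matrix (φ (MonoidAlgebra.single x 1))
      (φ (MonoidAlgebra.single y⁻¹ 1))
    refine h.symm.trans ?_
    rw [← LinearMap.trace_conj' _ φ.toLinearEquiv]
    congr 1
    refine LinearMap.ext fun z ↦ ?_
    simp [LinearEquiv.conj_apply]
  · intro c hc
    have h (z : MonoidAlgebra ℂ G) : ∑ i, c i * (φ z i).trace = 0 := by
      let f : MonoidAlgebra ℂ G →ₗ[ℂ] ℂ := ∑ i, c i • (Matrix.traceLinearMap (Fin (d i)) ℂ ℂ ∘ₗ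
        LinearMap.proj (R := ℂ) (φ := fun i ↦ Matrix (Fin (d i)) (Fin (d i)) ℂ) i ∘ₗ φ.toLinearMap)
      have hf (z) : f z = ∑ i, c i * (φ z i).trace := by simp [f]
      have h0 : f = 0 := (MonoidAlgebra.basis G ℂ).ext fun g ↦ by
        rw [hf, MonoidAlgebra.basis_apply]
        exact hc g
      rw [← hf, h0, LinearMap.zero_apply]
    ext j
    have h1 := h (φ.symm (Pi.single j (Matrix.single 0 0 1)))
    rw [AlgEquiv.apply_symm_apply, Finset.sum_eq_single j] at h1
    · simpa using h1
    · intro i _ hij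
      simp [Pi.single_eq_of_ne hij]
    · simp
  · intro i A _ l
    have hA : (Nat.card A : ℂ) ≠ 0 := by simp
    let E := (Nat.card A : ℂ)⁻¹ • ∑ a : A, (((l a)⁻¹ : ℂˣ) : ℂ) • ρ i a
    have hE : IsIdempotentElem E := by
      have h (a b : A) : ((((l a)⁻¹ : ℂˣ) : ℂ) • ρ i a) * ((((l b)⁻¹ : ℂˣ) : ℂ) • ρ i b) =
          (((l (a * b))⁻¹ : ℂˣ) : ℂ) • ρ i (a * b : A) := by
        rw [smul_mul_smul_comm, map_mul l, mul_inv, Units.val_mul, A.coe_mul, map_mul]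
      rw [IsIdempotentElem, smul_mul_smul_comm, Finset.sum_mul_sum, mul_smul]
      congr 1
      rw [inv_smul_eq_iff₀ hA]
      have h2 (a : A) : ∑ b : A, (((l (a * b))⁻¹ : ℂˣ) : ℂ) • ρ i (a * b : A) =
          ∑ b : A, (((l b)⁻¹ : ℂˣ) : ℂ) • ρ i b :=
        Equiv.sum_comp (Equiv.mulLeft a) fun b : A ↦ (((l b)⁻¹ : ℂˣ) : ℂ) • ρ i b
      simp_rw [h, h2, Finset.sum_const, Finset.card_univ, ← Nat.card_eq_fintype_card,
        Nat.cast_smul_eq_nsmul]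
    obtain ⟨m, hm⟩ := exists_trace_eq_natCast_of_isIdempotentElem hE
    refine ⟨m, ?_⟩
    rw [← hm, Matrix.trace_smul, Matrix.trace_sum, smul_eq_mul, mul_inv_cancel_left₀ hA]
    exact Finset.sum_congr rfl fun a _ ↦ ((Matrix.trace_smul _ _).trans (smul_eq_mul ..)).symm
  · refine fun i ↦ ⟨d i, NeZero.one_le, by simp, fun hdi g h ↦ ?_⟩
    have : Unique (Fin (d i)) := by rw [hdi]; infer_instance
    simp [Matrix.trace, Matrix.mul_apply]

end CharacterTable

section Multiplicity

theorem sum_monoidHom_apply {B : Type*} [Group B] [Fintype B] (hB : ∀ a b : B, Commute a b)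
    [Fintype (B →* ℂˣ)] [DecidableEq B] (b : B) :
    ∑ l : B →* ℂˣ, (l b : ℂ) = if b = 1 then (Nat.card B : ℂ) else 0 := by
  let _ : CommGroup B := { mul_comm := fun a b ↦ hB a b }
  split_ifs with hb
  · subst hb
    simp only [map_one, Units.val_one, Finset.sum_const, Finset.card_univ, nsmul_eq_mul, mul_one]
    rw [← Nat.card_eq_fintype_card]
    exact congrArg Nat.cast (CommGroup.card_monoidHom_of_hasEnoughRootsOfUnity B ℂ)
  · obtain ⟨m, hm⟩ := CommGroup.exists_apply_ne_one_of_hasEnoughRootsOfUnity B ℂ hb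
    have h := Equiv.sum_comp (Equiv.mulLeft m) fun l : B →* ℂˣ ↦ (l b : ℂ)
    simp only [Equiv.coe_mulLeft, MonoidHom.mul_apply, Units.val_mul] at h
    rw [← Finset.mul_sum] at h
    exact (mul_left_eq_self₀.1 h).resolve_left fun h ↦ hm (Units.ext h)

theorem sum_inv_mul_monoidHom {B : Type*} [Group B] [Fintype B] [DecidableEq (B →* ℂˣ)]
    (l m : B →* ℂˣ) :
    ∑ b, (((l b)⁻¹ : ℂˣ) : ℂ) * m b = if l = m then (Nat.card B : ℂ) else 0 := by
  split_ifs with h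
  · subst h
    simp
  · obtain ⟨c, hc⟩ : ∃ c, l c ≠ m c := by
      contrapose! h
      exact MonoidHom.ext h
    have h := Equiv.sum_comp (Equiv.mulLeft c) fun b ↦ (((l b)⁻¹ : ℂˣ) : ℂ) * m b
    have h1 (b : B) : (((l (c * b))⁻¹ : ℂˣ) : ℂ) * m (c * b) =
        ((((l c)⁻¹ : ℂˣ) : ℂ) * m c) * ((((l b)⁻¹ : ℂˣ) : ℂ) * m b) := by
      rw [map_mul, map_mul, mul_inv, Units.val_mul, Units.val_mul]
      ring
    simp only [Equiv.coe_mulLeft, h1] at h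
    rw [← Finset.mul_sum] at h
    refine (mul_left_eq_self₀.1 h).resolve_left fun h ↦ hc ?_
    rw [← Units.val_mul, Units.val_eq_one, inv_mul_eq_one] at h
    exact h

namespace IsCharacterTable

variable {G X : Type*} [Group G] [Fintype G] [Fintype X] {χ : X → G → ℂ}

/-- The multiplicity of a linear character of a subgroup in an irreducible character. -/
noncomputable def multiplicity (h : IsCharacterTable χ) (A : Subgroup G) [Fintype A]
    (l : A →* ℂˣ) (i : X) : ℕ :=
  (h.exists_multiplicity i A l).choose

theorem sum_eq_multiplicity (h : IsCharacterTable χ) (A : Subgroup G) [Fintype A]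
    (l : A →* ℂˣ) (i : X) :
    ∑ a : A, (((l a)⁻¹ : ℂˣ) : ℂ) * χ i a = Nat.card A * h.multiplicity A l i :=
  (h.exists_multiplicity i A l).choose_spec

theorem sum_inv_eq_multiplicity (h : IsCharacterTable χ) (A : Subgroup G) [Fintype A]
    (l : A →* ℂˣ) (i : X) :
    ∑ a : A, (l a : ℂ) * χ i a⁻¹ = Nat.card A * h.multiplicity A l i := by
  rw [← h.sum_eq_multiplicity, ← Equiv.sum_comp (Equiv.inv A)]
  simp

theorem apply_eq_sum_multiplicity (h : IsCharacterTable χ) {A : Subgroup G} [Fintype A]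
    [Fintype (A →* ℂˣ)] (hA : ∀ a b : A, Commute a b) (i : X) (a : A) :
    χ i a = ∑ l : A →* ℂˣ, (h.multiplicity A l i : ℂ) * l a := by
  classical
  have hA0 : (Nat.card A : ℂ) ≠ 0 := by simp
  apply mul_left_cancel₀ hA0
  rw [Finset.mul_sum]
  simp_rw [← mul_assoc, ← h.sum_eq_multiplicity, Finset.sum_mul]
  have h1 (b : A) (l : A →* ℂˣ) : (((l b)⁻¹ : ℂˣ) : ℂ) * χ i b * l a = χ i b * l (b⁻¹ * a) := by
    rw [map_mul, map_inv, Units.val_mul]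
    ring
  simp_rw [h1]
  rw [Finset.sum_comm]
  simp_rw [← Finset.mul_sum, sum_monoidHom_apply hA, inv_mul_eq_one]
  simp [mul_comm]

theorem sum_apply_mul_inv (h : IsCharacterTable χ) {A : Subgroup G} [Fintype A]
    [Fintype (A →* ℂˣ)] (hA : ∀ a b : A, Commute a b) (i : X) :
    ∑ a : A, χ i a * χ i a⁻¹ = Nat.card A * ∑ l : A →* ℂˣ, (h.multiplicity A l i : ℂ) ^ 2 := by
  simp_rw [h.apply_eq_sum_multiplicity hA i, Finset.sum_mul]
  rw [Finset.sum_comm, Finset.mul_sum]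
  refine Finset.sum_congr rfl fun l _ ↦ ?_
  simp_rw [mul_assoc, ← Finset.mul_sum]
  rw [h.sum_inv_eq_multiplicity]
  ring

open Classical in
theorem sum_multiplicity_mul (h : IsCharacterTable χ) (A B : Subgroup G) [Fintype A] [Fintype B]
    (l : A →* ℂˣ) (m : B →* ℂˣ) :
    (Nat.card A : ℂ) * Nat.card B * ∑ i, (h.multiplicity A l i : ℂ) * h.multiplicity B m i =
      ∑ g : G, ∑ a : A, ∑ b : B, if g * a * g⁻¹ = b then (((l a)⁻¹ : ℂˣ) : ℂ) * m b else 0 := by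
  have h1 (i : X) : (Nat.card A : ℂ) * Nat.card B *
      ((h.multiplicity A l i : ℂ) * h.multiplicity B m i) =
      ∑ a : A, ∑ b : B, (((l a)⁻¹ : ℂˣ) : ℂ) * m b * (χ i a * χ i b⁻¹) := by
    rw [mul_mul_mul_comm, ← h.sum_eq_multiplicity, ← h.sum_inv_eq_multiplicity, Finset.sum_mul_sum]
    exact Finset.sum_congr rfl fun a _ ↦ Finset.sum_congr rfl fun b _ ↦ by ring
  rw [Finset.mul_sum]
  simp_rw [h1]
  rw [Finset.sum_comm, Finset.sum_comm (s := (Finset.univ : Finset G))]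
  refine Finset.sum_congr rfl fun a _ ↦ ?_
  rw [Finset.sum_comm, Finset.sum_comm (s := (Finset.univ : Finset G))]
  refine Finset.sum_congr rfl fun b _ ↦ ?_
  rw [← Finset.mul_sum, h.sum_mul_inv, Nat.card_eq_fintype_card, Fintype.card_subtype,
    ← Finset.sum_filter, Finset.sum_const, nsmul_eq_mul, mul_comm]

end IsCharacterTable

end Multiplicity

section Orthogonality

open Classical in
theorem sum_ite_conj_eq_one {G : Type*} [Group G] {A B : Subgroup G} [Fintype A] [Fintype B]
    (l : A →* ℂˣ)
    (m : B →* ℂˣ) {g : G} (hg : ∀ a ∈ A, a ≠ 1 → g * a * g⁻¹ ∉ B) :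
    (∑ a : A, ∑ b : B, if g * a * g⁻¹ = b then (((l a)⁻¹ : ℂˣ) : ℂ) * m b else 0) = 1 := by
  rw [Finset.sum_eq_single 1, Finset.sum_eq_single 1]
  · simp
  · intro b _ hb
    rw [if_neg]
    simpa [eq_comm] using hb
  · simp
  · intro a _ ha
    refine Finset.sum_eq_zero fun b _ ↦ if_neg fun hab ↦ ?_
    exact hg a a.2 (by simpa using ha) (hab ▸ b.2)
  · simp

namespace IsCharacterTable

variable {G X : Type*} [Group G] [Fintype G] [Fintype X] {χ : X → G → ℂ}

theorem sum_inv_mul [DecidableEq X] (h : IsCharacterTable χ) (i j : X) :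
    ∑ y, χ i y⁻¹ * χ j y = if i = j then (Nat.card G : ℂ) else 0 := by
  classical
  have h1 := h.linearIndependent
    (fun i ↦ ∑ y, χ i y⁻¹ * χ j y - if i = j then (Nat.card G : ℂ) else 0) fun x ↦ by
    simp_rw [sub_mul, Finset.sum_mul, Finset.sum_sub_distrib]
    rw [Finset.sum_comm]
    have h2 (y : G) : ∑ i, χ i y⁻¹ * χ j y * χ i x =
        ∑ g : G, if g * x * g⁻¹ = y then χ j y else 0 := by
      rw [← Finset.sum_filter, Finset.sum_const, ← Fintype.card_subtype,
        ← Nat.card_eq_fintype_card, nsmul_eq_mul, ← h.sum_mul_inv, Finset.sum_mul]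
      exact Finset.sum_congr rfl fun i _ ↦ by ring
    simp_rw [h2]
    rw [Finset.sum_comm]
    simp [h.conj]
  exact sub_eq_zero.1 (congrFun h1 i)

/-- The degree of an irreducible character. -/
noncomputable def degree (h : IsCharacterTable χ) (i : X) : ℕ := (h.exists_degree i).choose

theorem one_le_degree (h : IsCharacterTable χ) (i : X) : 1 ≤ h.degree i :=
  (h.exists_degree i).choose_spec.1

theorem apply_one (h : IsCharacterTable χ) (i : X) : χ i 1 = h.degree i :=
  (h.exists_degree i).choose_spec.2.1

theorem map_mul_of_degree_eq_one (h : IsCharacterTable χ) {i : X} (hi : h.degree i = 1) (x y : G) :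
    χ i (x * y) = χ i x * χ i y :=
  (h.exists_degree i).choose_spec.2.2 hi x y

theorem apply_eq_one_of_degree_eq_one (h : IsCharacterTable χ) (hG : commutator G = ⊤) {i : X}
    (hi : h.degree i = 1) (x : G) : χ i x = 1 := by
  let f : G →* ℂ := ⟨⟨χ i, by rw [h.apply_one, hi, Nat.cast_one]⟩, h.map_mul_of_degree_eq_one hi⟩
  have h1 : x ∈ f.toHomUnits.ker :=
    Abelianization.commutator_subset_ker _ (hG ▸ mem_top x)
  exact congrArg Units.val (MonoidHom.mem_ker.1 h1)

theorem eq_of_degree_eq_one (h : IsCharacterTable χ) (hG : commutator G = ⊤) {i j : X}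
    (hi : h.degree i = 1) (hj : h.degree j = 1) : i = j := by
  classical
  by_contra hij
  have h1 := h.linearIndependent (Pi.single i 1 - Pi.single j 1) fun g ↦ by
    simp [sub_mul, Finset.sum_sub_distrib, Pi.single_apply,
      h.apply_eq_one_of_degree_eq_one hG hi, h.apply_eq_one_of_degree_eq_one hG hj]
  simpa [Pi.single_eq_of_ne hij] using congrFun h1 i

theorem sum_multiplicity_mul_of_disjoint (h : IsCharacterTable χ) {A B : Subgroup G} [Fintype A]
    [Fintype B] (hAB : ∀ a ∈ A, a ≠ 1 → ∀ g, g * a * g⁻¹ ∉ B) (l : A →* ℂˣ) (m : B →* ℂˣ) :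
    (Nat.card A : ℂ) * Nat.card B * ∑ i, (h.multiplicity A l i : ℂ) * h.multiplicity B m i =
      Nat.card G := by
  rw [h.sum_multiplicity_mul]
  simp_rw [fun g ↦ sum_ite_conj_eq_one l m fun a ha ha1 ↦ hAB a ha ha1 g]
  simp

theorem multiplicity_bot (h : IsCharacterTable χ) (m : (⊥ : Subgroup G) →* ℂˣ) (i : X) :
    h.multiplicity ⊥ m i = h.degree i := by
  have h1 := h.sum_eq_multiplicity ⊥ m i
  have h2 : m default = 1 := map_one m
  rw [Fintype.sum_unique, h2] at h1
  have h3 : ((default : (⊥ : Subgroup G)) : G) = 1 := rfl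
  rw [h3, h.apply_one] at h1
  simp only [inv_one, Units.val_one, one_mul, card_bot, Nat.cast_one] at h1
  exact_mod_cast h1.symm

theorem sum_multiplicity_mul_degree (h : IsCharacterTable χ) (A : Subgroup G) [Fintype A]
    (l : A →* ℂˣ) :
    (Nat.card A : ℂ) * ∑ i, (h.multiplicity A l i : ℂ) * h.degree i = Nat.card G := by
  have h1 := h.sum_multiplicity_mul_of_disjoint (A := A) (B := ⊥)
    (fun a _ ha g hg ↦ ha (by simpa using hg)) l 1
  simpa [h.multiplicity_bot] using h1

theorem exists_degree_eq_one (h : IsCharacterTable χ) : ∃ i, h.degree i = 1 := by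
  have : Fintype (⊤ : Subgroup G) := Fintype.ofFinite _
  have h1 := h.sum_multiplicity_mul_degree ⊤ 1
  have hG : (Nat.card G : ℂ) ≠ 0 := by simp
  rw [card_top, mul_eq_left₀ hG] at h1
  have h2 : ∑ i, h.multiplicity ⊤ 1 i * h.degree i = 1 := by exact_mod_cast h1
  obtain ⟨i, -, hi⟩ := Finset.exists_ne_zero_of_sum_ne_zero (h2 ▸ one_ne_zero)
  have h3 : h.multiplicity ⊤ 1 i * h.degree i ≤ 1 :=
    h2 ▸ Finset.single_le_sum (f := fun i ↦ h.multiplicity ⊤ 1 i * h.degree i)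
      (fun _ _ ↦ Nat.zero_le _) (Finset.mem_univ i)
  exact ⟨i, (mul_eq_one.1 (le_antisymm h3 (Nat.one_le_iff_ne_zero.2 hi))).2⟩

theorem multiplicity_of_apply_eq_one (h : IsCharacterTable χ) {i : X} (hi : ∀ g, χ i g = 1)
    (A : Subgroup G) [Fintype A] [DecidableEq (A →* ℂˣ)] (l : A →* ℂˣ) :
    h.multiplicity A l i = if l = 1 then 1 else 0 := by
  have h1 := h.sum_eq_multiplicity A l i
  have h2 := sum_inv_mul_monoidHom l 1
  simp only [MonoidHom.one_apply, Units.val_one] at h2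
  simp only [hi] at h1
  rw [h2] at h1
  have hA : (Nat.card A : ℂ) ≠ 0 := by simp
  split_ifs at h1 ⊢
  · exact_mod_cast (mul_eq_left₀ hA).1 h1.symm
  · exact_mod_cast (mul_eq_zero.1 h1.symm).resolve_left hA

theorem sum_multiplicity_eq_degree (h : IsCharacterTable χ) {A : Subgroup G} [Fintype A]
    [Fintype (A →* ℂˣ)] (hA : ∀ a b : A, Commute a b) (i : X) :
    ∑ l : A →* ℂˣ, h.multiplicity A l i = h.degree i := by
  have h1 := h.apply_eq_sum_multiplicity hA i 1
  simp only [OneMemClass.coe_one, h.apply_one, map_one, Units.val_one, mul_one] at h1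
  exact_mod_cast h1.symm

end IsCharacterTable

end Orthogonality

section CCFamilyCharacters

/-- The number of elements of the normalizer of `A` that carry `m` to `l`. -/
noncomputable def Subgroup.transporterCard {G : Type*} [Group G] (A : Subgroup G)
    (l m : A →* ℂˣ) : ℕ :=
  Nat.card {g : normalizer (A : Set G) // m.comp (A.normalizerMonoidHom g).toMonoidHom = l}

theorem Subgroup.sum_transporterCard {G : Type*} [Group G] [Finite G] (A : Subgroup G)
    [Fintype (A →* ℂˣ)] (l : A →* ℂˣ) :
    ∑ m, A.transporterCard l m = Nat.card (normalizer (A : Set G)) := by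
  classical
  have := Fintype.ofFinite (normalizer (A : Set G))
  have h (m : A →* ℂˣ) : A.transporterCard l m = ∑ g : normalizer (A : Set G),
      if m = l.comp (A.normalizerMonoidHom g).symm.toMonoidHom then 1 else 0 := by
    rw [transporterCard, Nat.card_eq_fintype_card, Fintype.card_subtype, Finset.card_filter]
    refine Finset.sum_congr rfl fun g _ ↦ ?_
    congr 1
    rw [eq_iff_iff]
    constructor <;> rintro rfl <;> ext a <;> simp
  simp_rw [h]
  rw [Finset.sum_comm, Finset.sum_congr rfl fun g _ ↦ Finset.sum_ite_eq' Finset.univ _ _]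
  simp [Nat.card_eq_fintype_card]

theorem Subgroup.transporterCard_one_one {G : Type*} [Group G] (A : Subgroup G) :
    A.transporterCard 1 1 = Nat.card (normalizer (A : Set G)) := by
  simp [transporterCard]

theorem Subgroup.transporterCard_one_right {G : Type*} [Group G] (A : Subgroup G) {l : A →* ℂˣ}
    (hl : l ≠ 1) : A.transporterCard l 1 = 0 := by
  simp [transporterCard, hl.symm]

theorem IsCharacterTable.multiplicity_eq_of_transporterCard_ne_zero {G X : Type*} [Group G]
    [Fintype G] [Fintype X] {χ : X → G → ℂ} (h : IsCharacterTable χ) {A : Subgroup G} [Fintype A]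
    {l m : A →* ℂˣ} (hlm : A.transporterCard l m ≠ 0) (i : X) :
    h.multiplicity A l i = h.multiplicity A m i := by
  obtain ⟨⟨g, rfl⟩⟩ := (Nat.card_ne_zero.1 hlm).1
  have hA : (Nat.card A : ℂ) ≠ 0 := by simp
  have h1 : (Nat.card A : ℂ) * h.multiplicity A (m.comp (A.normalizerMonoidHom g).toMonoidHom) i =
      Nat.card A * h.multiplicity A m i := by
    rw [← h.sum_eq_multiplicity, ← h.sum_eq_multiplicity,
      ← Equiv.sum_comp (A.normalizerMonoidHom g).toEquiv
        fun a : A ↦ (((m a)⁻¹ : ℂˣ) : ℂ) * χ i a]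
    refine Finset.sum_congr rfl fun a _ ↦ ?_
    have h2 : (((A.normalizerMonoidHom g) a : A) : G) = g * a * (g : G)⁻¹ := by simp
    simp [h2, h.conj]
  exact_mod_cast mul_left_cancel₀ hA h1

namespace IsCCFamily

variable {G I : Type*} [Group G] [Fintype G] {A : I → Subgroup G} {q : I → ℕ}

theorem transporterCard_self (hF : IsCCFamily A q) (i : I) {l : A i →* ℂˣ} (hl : l ≠ 1) :
    (A i).transporterCard l l = Nat.card (A i) := by
  have h1 (g : normalizer (A i : Set G)) :
      l.comp ((A i).normalizerMonoidHom g).toMonoidHom = l ↔ (g : G) ∈ A i := by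
    refine ⟨fun hg ↦ ?_, fun hg ↦ ?_⟩
    · by_contra hgA
      refine hl ?_
      let f : A i → A i := fun a ↦ (A i).normalizerMonoidHom g a * a⁻¹
      have hf : Function.Injective f := by
        intro a b hab
        by_contra hne
        refine hgA (hF.mem_of_commute i (a * b⁻¹ : A i) (a * b⁻¹).2 ?_ g ?_)
        · rwa [Ne, OneMemClass.coe_eq_one, mul_inv_eq_one]
        · have hc (x y : A i) : x * y = y * x := Subtype.ext (hF.commute i x x.2 y y.2)
          have h2 : (A i).normalizerMonoidHom g (a * b⁻¹) = a * b⁻¹ := by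
            rw [map_mul, map_inv, mul_inv_eq_iff_eq_mul, mul_inv_eq_iff_eq_mul.1 hab, hc _ a]
            exact (congrArg (a * ·) (hc _ _)).trans (mul_assoc ..).symm
          have h3 := congrArg Subtype.val h2
          rw [Subgroup.normalizerMonoidHom_apply_apply_coe] at h3
          exact mul_inv_eq_iff_eq_mul.1 h3
      ext a
      obtain ⟨b, rfl⟩ := Finite.surjective_of_injective hf a
      have h4 := DFunLike.congr_fun hg b
      have h5 : l ((A i).normalizerMonoidHom g b) = l b := h4
      rw [map_mul, h5, map_inv, mul_inv_cancel, MonoidHom.one_apply]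
    · ext a
      have h2 : (A i).normalizerMonoidHom g a = a := by
        ext
        have := hF.commute i g hg a a.2
        simp [this.eq]
      simp [h2]
  rw [transporterCard, Nat.card_congr (Equiv.subtypeEquivRight h1)]
  exact Nat.card_congr (subgroupOfEquivOfLe le_normalizer).toEquiv

variable {X : Type*} [Fintype X] {χ : X → G → ℂ} [∀ i, Fintype (A i)]

theorem sum_multiplicity_mul_of_ne (hF : IsCCFamily A q) (h : IsCharacterTable χ) {i j : I}
    (hij : i ≠ j) (l : A i →* ℂˣ) (m : A j →* ℂˣ) :
    (Nat.card (A i) : ℂ) * Nat.card (A j) *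
      ∑ x, (h.multiplicity (A i) l x : ℂ) * h.multiplicity (A j) m x = Nat.card G :=
  h.sum_multiplicity_mul_of_disjoint
    (fun a ha ha1 g hg ↦ hij (hF.eq_of_conj_mem i j a g ha ha1 hg)) l m

theorem sum_multiplicity_mul (hF : IsCCFamily A q) (h : IsCharacterTable χ) (i : I)
    (l m : A i →* ℂˣ) :
    (Nat.card (A i) : ℂ) * Nat.card (A i) *
      ∑ x, (h.multiplicity (A i) l x : ℂ) * h.multiplicity (A i) m x =
      Nat.card (A i) * (A i).transporterCard l m + (Nat.card G - Nat.card (A i) * q i) := by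
  classical
  have := Fintype.ofFinite (normalizer (A i : Set G))
  rw [h.sum_multiplicity_mul]
  let T (g : G) : ℂ := ∑ a : A i, ∑ b : A i,
    if g * a * g⁻¹ = b then (((l a)⁻¹ : ℂˣ) : ℂ) * m b else 0
  have hT (g : G) (hg : g ∉ normalizer (A i : Set G)) : T g - 1 = 0 :=
    sub_eq_zero.2 (sum_ite_conj_eq_one l m fun a ha ha1 hgA ↦
      hg (hF.mem_normalizer i a ha ha1 g hgA))
  have hT2 (g : normalizer (A i : Set G)) : T g =
      if m.comp ((A i).normalizerMonoidHom g).toMonoidHom = l then (Nat.card (A i) : ℂ) else 0 := by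
    have h1 := sum_inv_mul_monoidHom l (m.comp ((A i).normalizerMonoidHom g).toMonoidHom)
    simp_rw [eq_comm (a := l)] at h1
    rw [← h1]
    refine Finset.sum_congr rfl fun a _ ↦ ?_
    have h2 (b : A i) : (g : G) * a * (g : G)⁻¹ = b ↔ (A i).normalizerMonoidHom g a = b := by
      rw [← Subtype.coe_inj, normalizerMonoidHom_apply_apply_coe]
    simp_rw [h2]
    rw [Finset.sum_ite_eq]
    simp
  have h1 : ∑ g, (T g - 1) = ∑ g : normalizer (A i : Set G), (T g - 1) := by
    rw [← Finset.sum_subtype (Finset.univ.filter (· ∈ normalizer (A i : Set G)))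
      (by simp) fun g ↦ T g - 1, Finset.sum_filter_of_ne]
    intro g _ hg
    by_contra hg'
    exact hg (hT g hg')
  simp_rw [hT2, Finset.sum_sub_distrib, ← Finset.sum_filter, Finset.sum_const, Finset.card_univ,
    ← Fintype.card_subtype, ← Nat.card_eq_fintype_card, hF.card_normalizer, nsmul_eq_mul, mul_one]
    at h1
  rw [Nat.cast_mul, sub_eq_iff_eq_add] at h1
  rw [show (∑ g : G, ∑ a : A i, ∑ b : A i,
      if g * a * g⁻¹ = b then (((l a)⁻¹ : ℂˣ) : ℂ) * m b else 0) =
    ∑ g, T g from rfl, h1, transporterCard]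
  ring

/-- Nontrivial linear characters of `A i` are conjugate under the normalizer if they have the same
multiplicities in all irreducible characters. -/
theorem transporterCard_eq_ite (hF : IsCCFamily A q) (h : IsCharacterTable χ) (i : I)
    {l m : A i →* ℂˣ} (hl : l ≠ 1) [Decidable (h.multiplicity (A i) m = h.multiplicity (A i) l)] :
    (A i).transporterCard l m =
      if h.multiplicity (A i) m = h.multiplicity (A i) l then Nat.card (A i) else 0 := by
  split_ifs with heq
  · have hA : (Nat.card (A i) : ℂ) ≠ 0 := by simp
    have h1 := hF.sum_multiplicity_mul h i l m
    rw [heq, hF.sum_multiplicity_mul h i l l, hF.transporterCard_self i hl] at h1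
    exact_mod_cast (mul_left_cancel₀ hA (add_right_cancel h1)).symm
  · by_contra hne
    exact heq (funext fun x ↦ (h.multiplicity_eq_of_transporterCard_ne_zero hne x).symm)

theorem card_filter_multiplicity_eq [DecidableEq (X → ℕ)] (hF : IsCCFamily A q)
    (h : IsCharacterTable χ) (i : I) [Fintype (A i →* ℂˣ)] {l : A i →* ℂˣ} (hl : l ≠ 1) :
    (Finset.univ.filter fun m ↦ h.multiplicity (A i) m = h.multiplicity (A i) l).card = q i := by
  have h1 := (A i).sum_transporterCard l
  simp_rw [hF.transporterCard_eq_ite h i hl] at h1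
  rw [← Finset.sum_filter, Finset.sum_const, hF.card_normalizer, smul_eq_mul, mul_comm] at h1
  exact Nat.eq_of_mul_eq_mul_left Nat.card_pos h1

end IsCCFamily

end CCFamilyCharacters

section CoherentTable

/-- The arithmetic of the multiplicities of the linear characters of the members of a family of
subgroups in the irreducible characters of a group. Here `v i none` gives the multiplicities of
the trivial character, and `v i (some ω)` those of the nontrivial ones in the orbit `ω`. -/
structure IsCoherentTable {I X : Type*} [Fintype I] [Fintype X] {Ω : I → Type*}
    [∀ i, Fintype (Ω i)] (v : ∀ i, Option (Ω i) → X → ℤ) (d : X → ℤ) (a q : I → ℕ) (g : ℕ)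
    (o : X) (C : I → ℤ) (D : I → I → ℤ) (K : I → ℤ) : Prop where
  card_eq : ∀ i, a i = 1 + q i * Fintype.card (Ω i)
  odd_card : ∀ i, Odd (a i)
  odd_index : ∀ i, Odd (q i)
  one_lt_card : ∀ i, 1 < a i
  card_pos : 0 < g
  sum_mul_none : ∀ i, ∑ x, v i none x * v i none x = C i + q i
  sum_mul_some_none : ∀ i s, ∑ x, v i (some s) x * v i none x = C i
  sum_mul_self : ∀ i s, ∑ x, v i (some s) x * v i (some s) x = C i + 1
  sum_mul_of_ne : ∀ i s t, s ≠ t → ∑ x, v i (some s) x * v i (some t) x = C i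
  sum_mul_cross : ∀ i j, i ≠ j → ∀ s t, ∑ x, v i s x * v j t x = D i j
  sum_mul_degree : ∀ i s, ∑ x, v i s x * d x = K i
  apply_none : ∀ i, v i none o = 1
  apply_some : ∀ i s, v i (some s) o = 0
  degree_eq : ∀ i x, d x = v i none x + q i * ∑ s, v i (some s) x
  sum_row : ∀ x, ∑ i, ((a i : ℚ) * ((v i none x : ℚ) ^ 2 + q i * ∑ s, (v i (some s) x : ℚ) ^ 2) -
    (d x : ℚ) ^ 2) / (a i * q i) = 1 - (d x : ℚ) ^ 2 / g
  sum_mass : ∑ i, (Fintype.card (Ω i) : ℚ) / a i = 1 - 1 / g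
  card_eq_sum : Fintype.card X = 1 + ∑ i, Fintype.card (Ω i)
  degree_one : d o = 1
  two_le_degree : ∀ x, x ≠ o → 2 ≤ d x

/-- The multiplicity functions of the nontrivial linear characters of a subgroup. -/
def IsCharacterTable.exceptional {G X : Type*} [Group G] [Fintype G] [Fintype X] {χ : X → G → ℂ}
    (h : IsCharacterTable χ) (A : Subgroup G) [Fintype A] : Set (X → ℕ) :=
  Set.range fun l : {l : A →* ℂˣ // l ≠ 1} ↦ h.multiplicity A l

theorem IsCharacterTable.sum_mul_apply_inv {G X : Type*} [Group G] [Fintype G] [Fintype X]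
    {χ : X → G → ℂ} (h : IsCharacterTable χ) (x : X) : ∑ y, χ x y * χ x y⁻¹ = Nat.card G := by
  classical
  have h1 := h.sum_inv_mul x x
  rw [if_pos rfl] at h1
  rw [← h1]
  exact Finset.sum_congr rfl fun y _ ↦ mul_comm _ _

namespace IsCCFamily

variable {G I : Type*} [Group G] [Fintype G] {A : I → Subgroup G} {q : I → ℕ}
  {X : Type*} [Fintype X] {χ : X → G → ℂ} [∀ i, Fintype (A i)]

theorem sum_multiplicity_comp (hF : IsCCFamily A q) (h : IsCharacterTable χ) (i : I) {o : X}
    (ho : ∀ g, χ o g = 1) [Fintype (A i →* ℂˣ)] [Fintype (h.exceptional (A i))]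
    {M : Type*} [CommRing M] (f : (X → ℕ) → M) :
    ∑ l : A i →* ℂˣ, f (h.multiplicity (A i) l) =
      f (h.multiplicity (A i) 1) + q i * ∑ s : h.exceptional (A i), f s := by
  classical
  have h1 (l : A i →* ℂˣ) : f (h.multiplicity (A i) l) =
      (if l = 1 then f (h.multiplicity (A i) 1) else 0) +
        ∑ s : h.exceptional (A i), if h.multiplicity (A i) l = s then f s else 0 := by
    split_ifs with hl
    · subst hl
      rw [Finset.sum_eq_zero, add_zero]
      rintro ⟨_, ⟨l, hl⟩, rfl⟩ -
      refine if_neg fun heq ↦ ?_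
      have h2 := congrFun heq o
      simp [h.multiplicity_of_apply_eq_one ho, hl] at h2
    · rw [zero_add, Finset.sum_eq_single ⟨_, ⟨l, hl⟩, rfl⟩]
      · simp
      · exact fun s _ hs ↦ if_neg fun heq ↦ hs (Subtype.ext heq.symm)
      · simp
  rw [Finset.sum_congr rfl fun l _ ↦ h1 l, Finset.sum_add_distrib, Finset.sum_comm,
    Finset.sum_ite_eq' Finset.univ, if_pos (Finset.mem_univ _), Finset.mul_sum]
  congr 1
  refine Finset.sum_congr rfl ?_
  rintro ⟨_, ⟨l, hl⟩, rfl⟩ -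
  rw [← Finset.sum_filter, Finset.sum_const, hF.card_filter_multiplicity_eq h i hl, nsmul_eq_mul]

theorem card_eq_one_add (hF : IsCCFamily A q) (h : IsCharacterTable χ) (i : I) {o : X}
    (ho : ∀ g, χ o g = 1) [Fintype (h.exceptional (A i))] :
    Nat.card (A i) = 1 + q i * Fintype.card (h.exceptional (A i)) := by
  have := Fintype.ofFinite (A i →* ℂˣ)
  let _ : CommGroup (A i) :=
    { mul_comm := fun a b ↦ Subtype.ext (hF.commute i a a.2 b b.2) }
  have h1 := hF.sum_multiplicity_comp h i ho (fun _ ↦ (1 : ℤ))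
  have h2 := CommGroup.card_monoidHom_of_hasEnoughRootsOfUnity (A i) ℂ
  rw [Nat.card_eq_fintype_card] at h2
  simp only [Finset.sum_const, Finset.card_univ, nsmul_eq_mul, mul_one] at h1
  rw [← h2]
  exact_mod_cast h1

theorem sum_ite_mem_ne_one_mul (hF : IsCCFamily A q) (h : IsCharacterTable χ) (i : I) {o : X}
    (ho : ∀ g, χ o g = 1) [Fintype (h.exceptional (A i))] [DecidablePred fun x ↦ x ∈ A i ∧ x ≠ 1]
    (x : X) : (∑ y, if y ∈ A i ∧ y ≠ 1 then χ x y * χ x y⁻¹ else 0) =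
      (Nat.card (A i) : ℂ) * ((h.multiplicity (A i) 1 x : ℂ) ^ 2 +
        q i * ∑ s : h.exceptional (A i), ((s : X → ℕ) x : ℂ) ^ 2) - (h.degree x : ℂ) ^ 2 := by
  classical
  have := Fintype.ofFinite (A i →* ℂˣ)
  have hA (a b : A i) : Commute a b := Subtype.ext (hF.commute i a a.2 b b.2)
  rw [← hF.sum_multiplicity_comp h i ho fun s ↦ (s x : ℂ) ^ 2, ← h.sum_apply_mul_inv hA,
    eq_sub_iff_add_eq, ← Finset.sum_subtype (Finset.univ.filter (· ∈ A i))
      (by simp) fun y ↦ χ x y * χ x y⁻¹, Finset.sum_filter]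
  have h1 (y : G) : (if y ∈ A i then χ x y * χ x y⁻¹ else 0) =
      (if y ∈ A i ∧ y ≠ 1 then χ x y * χ x y⁻¹ else 0) +
        if y = 1 then (h.degree x : ℂ) ^ 2 else 0 := by
    by_cases hy : y = 1
    · simp [hy, one_mem, h.apply_one, sq]
    · simp [hy]
  simp_rw [h1, Finset.sum_add_distrib]
  simp

open Classical in
theorem sum_row (hF : IsCCFamily A q) (h : IsCharacterTable χ) [Fintype I] {o : X}
    (ho : ∀ g, χ o g = 1) [∀ i, Fintype (h.exceptional (A i))] (x : X) :
    ∑ i, ((Nat.card (A i) : ℚ) * ((h.multiplicity (A i) 1 x : ℚ) ^ 2 +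
      q i * ∑ s : h.exceptional (A i), ((s : X → ℕ) x : ℚ) ^ 2) - (h.degree x : ℚ) ^ 2) /
        (Nat.card (A i) * q i) = 1 - (h.degree x : ℚ) ^ 2 / Nat.card G := by
  have h1 := h.sum_mul_apply_inv x
  have hG : (Nat.card G : ℂ) ≠ 0 := by simp
  rw [hF.sum_eq (fun y ↦ χ x y * χ x y⁻¹)] at h1
  · simp_rw [hF.sum_ite_mem_ne_one_mul h _ ho] at h1
    simp_rw [div_mul_eq_mul_div, mul_div_assoc] at h1
    rw [← Finset.mul_sum, inv_one, h.apply_one, ← eq_sub_iff_add_eq'] at h1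
    have h2 := (eq_div_iff hG).2 ((mul_comm _ _).trans h1)
    rw [sub_div, div_self hG, ← sq] at h2
    apply Rat.cast_injective (α := ℂ)
    push_cast
    exact h2
  · intro g y
    rw [h.conj, ← h.conj x g y⁻¹]
    simp [mul_assoc]

theorem sum_mass (hF : IsCCFamily A q) [Fintype I] (w : I → ℕ)
    (hw : ∀ i, Nat.card (A i) = 1 + q i * w i) :
    ∑ i, (w i : ℚ) / Nat.card (A i) = 1 - 1 / Nat.card G := by
  classical
  have hG : (Nat.card G : ℚ) ≠ 0 := by simp
  have h1 := hF.sum_eq (fun _ ↦ (1 : ℚ)) (by simp)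
  have h2 (i : I) : (Nat.card G : ℚ) / (Nat.card (A i) * q i) *
      (∑ x, if x ∈ A i ∧ x ≠ 1 then 1 else 0) = Nat.card G * (w i / Nat.card (A i)) := by
    have hA : (Nat.card (A i) : ℚ) ≠ 0 := by simp
    have hq : (q i : ℚ) ≠ 0 := by exact_mod_cast (hF.q_pos i).ne'
    rw [sum_ite_mem_ne_one (A i) _ 1 (by simp)]
    nth_rw 2 [hw i]
    push_cast
    field_simp
    ring
  simp_rw [h2] at h1
  rw [← Finset.mul_sum, Finset.sum_const, Finset.card_univ, ← Nat.card_eq_fintype_card] at h1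
  simp only [nsmul_eq_mul, mul_one] at h1
  field_simp
  linarith

theorem card_irreducible (hF : IsCCFamily A q) (h : IsCharacterTable χ) [Fintype I] (w : I → ℕ)
    (hw : ∀ i, Nat.card (A i) = 1 + q i * w i) : Fintype.card X = 1 + ∑ i, w i := by
  classical
  have hG : (Nat.card G : ℂ) ≠ 0 := by simp
  have h1 : ∑ y, ∑ x, χ x y * χ x y⁻¹ = Fintype.card X * Nat.card G := by
    rw [Finset.sum_comm]
    simp_rw [h.sum_mul_apply_inv]
    simp
  rw [hF.sum_eq (fun y ↦ ∑ x, χ x y * χ x y⁻¹)] at h1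
  · have h2 (i : I) (y : G) (hy : y ∈ A i) (hy1 : y ≠ 1) :
        ∑ x, χ x y * χ x y⁻¹ = Nat.card (A i) := by
      rw [h.sum_mul_inv]
      congr 1
      refine Nat.card_congr (Equiv.subtypeEquivRight fun g ↦ ?_)
      rw [mul_inv_eq_iff_eq_mul]
      exact ⟨fun hg ↦ hF.mem_of_commute i y hy hy1 g hg, fun hg ↦ hF.commute i g hg y hy⟩
    have h3 (i : I) : (Nat.card G : ℂ) / (Nat.card (A i) * q i) *
        (∑ y, if y ∈ A i ∧ y ≠ 1 then ∑ x, χ x y * χ x y⁻¹ else 0) = Nat.card G * w i := by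
      have hA : (Nat.card (A i) : ℂ) ≠ 0 := by simp
      have hq : (q i : ℂ) ≠ 0 := by exact_mod_cast (hF.q_pos i).ne'
      rw [sum_ite_mem_ne_one (A i) _ _ (h2 i)]
      nth_rw 2 [hw i]
      push_cast
      field_simp
      ring
    simp_rw [h3] at h1
    rw [h.sum_mul_inv, ← Finset.mul_sum] at h1
    simp only [mul_one, mul_inv_cancel, Nat.card_eq_fintype_card, Fintype.card_subtype_true] at h1
    rw [Nat.card_eq_fintype_card] at hG
    have h4 : (Fintype.card G : ℂ) * (1 + ∑ i, (w i : ℂ)) = Fintype.card G * Fintype.card X := by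
      linear_combination h1
    exact_mod_cast (mul_left_cancel₀ hG h4).symm
  · intro g y
    refine Finset.sum_congr rfl fun x _ ↦ ?_
    rw [h.conj, ← h.conj x g y⁻¹]
    simp [mul_assoc]

end IsCCFamily

end CoherentTable

section ExceptionalTable

/-- The multiplicities of the linear characters of a subgroup in the irreducible characters, where
the nontrivial linear characters are represented by their multiplicity functions. -/
noncomputable def IsCharacterTable.exceptionalTable {G X : Type*} [Group G] [Fintype G] [Fintype X]
    {χ : X → G → ℂ} (h : IsCharacterTable χ) (A : Subgroup G) [Fintype A]
    (s : Option (h.exceptional A)) (x : X) : ℤ :=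
  (s.elim (h.multiplicity A 1) (↑) x : ℕ)

variable {G I : Type*} [Group G] [Fintype G] {A : I → Subgroup G} {q : I → ℕ}
  {X : Type*} [Fintype X] {χ : X → G → ℂ} [∀ i, Fintype (A i)]

theorem IsCharacterTable.exists_exceptionalTable_eq {G X : Type*} [Group G] [Fintype G] [Fintype X]
    {χ : X → G → ℂ} (h : IsCharacterTable χ) (A : Subgroup G) [Fintype A]
    (s : Option (h.exceptional A)) :
    ∃ l : A →* ℂˣ, ∀ x, h.exceptionalTable A s x = h.multiplicity A l x := by
  rcases s with _ | ⟨_, ⟨l, hl⟩, rfl⟩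
  · exact ⟨1, fun _ ↦ rfl⟩
  · exact ⟨l, fun _ ↦ rfl⟩

theorem IsCCFamily.isCoherentTable (hF : IsCCFamily A q) (h : IsCharacterTable χ)
    (hG : commutator G = ⊤) [Fintype I] [∀ i, Fintype (h.exceptional (A i))]
    (hodd : Odd (Nat.card G)) {o : X} (ho : h.degree o = 1) :
    ∃ (C : I → ℤ) (D : I → I → ℤ) (K : I → ℤ),
      IsCoherentTable (fun i ↦ h.exceptionalTable (A i)) (fun x ↦ h.degree x)
        (fun i ↦ Nat.card (A i)) q (Nat.card G) o C D K := by
  classical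
  have ho1 := h.apply_eq_one_of_degree_eq_one hG ho
  have hA (i : I) : (Nat.card (A i) : ℂ) ≠ 0 := by simp
  have hcard (i : I) := hF.card_eq_one_add h i ho1
  have hnone (i : I) : (Nat.card (A i) : ℂ) * Nat.card (A i) *
      ∑ x, (h.multiplicity (A i) 1 x : ℂ) * h.multiplicity (A i) 1 x =
      Nat.card (A i) * (Nat.card (A i) * q i) + (Nat.card G - Nat.card (A i) * q i) := by
    rw [hF.sum_multiplicity_mul h, transporterCard_one_one, hF.card_normalizer, Nat.cast_mul]
  refine ⟨fun i ↦ ∑ x, h.exceptionalTable (A i) none x * h.exceptionalTable (A i) none x - q i,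
    fun i j ↦ ∑ x, h.exceptionalTable (A i) none x * h.exceptionalTable (A j) none x,
    fun i ↦ ∑ x, h.exceptionalTable (A i) none x * h.degree x, ?_⟩
  refine
    { card_eq := hcard
      odd_card := fun i ↦ hodd.of_dvd_nat (card_subgroup_dvd_card _)
      odd_index := fun i ↦ hodd.of_dvd_nat ((Dvd.intro_left _ rfl).trans
        (hF.card_normalizer i ▸ card_subgroup_dvd_card _))
      one_lt_card := fun i ↦ (one_lt_card_iff_ne_bot _).2 (hF.ne_bot i)
      card_pos := Nat.card_pos
      sum_mul_none := fun i ↦ by simp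
      sum_mul_some_none := ?_
      sum_mul_self := ?_
      sum_mul_of_ne := ?_
      sum_mul_cross := ?_
      sum_mul_degree := ?_
      apply_none := fun i ↦ by
        simp [IsCharacterTable.exceptionalTable, h.multiplicity_of_apply_eq_one ho1]
      apply_some := ?_
      degree_eq := ?_
      sum_row := fun x ↦ by
        simpa [IsCharacterTable.exceptionalTable] using hF.sum_row h ho1 x
      sum_mass := hF.sum_mass _ hcard
      card_eq_sum := hF.card_irreducible h _ hcard
      degree_one := by simp [ho]
      two_le_degree := fun x hx ↦ ?_ }
  · rintro i ⟨_, ⟨l, hl⟩, rfl⟩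
    have h1 := hF.sum_multiplicity_mul h i l 1
    rw [transporterCard_one_right _ hl] at h1
    apply Int.cast_injective (α := ℂ)
    apply mul_left_cancel₀ (mul_ne_zero (hA i) (hA i))
    simp only [IsCharacterTable.exceptionalTable, Option.elim]
    push_cast
    linear_combination h1 - hnone i
  · rintro i ⟨_, ⟨l, hl⟩, rfl⟩
    have h1 := hF.sum_multiplicity_mul h i l l
    rw [hF.transporterCard_self i hl] at h1
    apply Int.cast_injective (α := ℂ)
    apply mul_left_cancel₀ (mul_ne_zero (hA i) (hA i))
    simp only [IsCharacterTable.exceptionalTable, Option.elim]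
    push_cast
    linear_combination h1 - hnone i
  · rintro i ⟨_, ⟨l, hl⟩, rfl⟩ ⟨_, ⟨m, hm⟩, rfl⟩ hlm
    have h1 := hF.sum_multiplicity_mul h i l m
    rw [hF.transporterCard_eq_ite h i hl, if_neg fun heq ↦ hlm (Subtype.ext heq.symm)] at h1
    apply Int.cast_injective (α := ℂ)
    apply mul_left_cancel₀ (mul_ne_zero (hA i) (hA i))
    simp only [IsCharacterTable.exceptionalTable, Option.elim]
    push_cast
    push_cast at h1
    linear_combination h1 - hnone i
  · intro i j hij s t
    obtain ⟨l, hl⟩ := h.exists_exceptionalTable_eq (A i) s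
    obtain ⟨m, hm⟩ := h.exists_exceptionalTable_eq (A j) t
    apply Int.cast_injective (α := ℂ)
    apply mul_left_cancel₀ (mul_ne_zero (hA i) (hA j))
    simp only [hl, hm]
    simp only [IsCharacterTable.exceptionalTable, Option.elim]
    push_cast
    rw [hF.sum_multiplicity_mul_of_ne h hij, hF.sum_multiplicity_mul_of_ne h hij]
  · intro i s
    obtain ⟨l, hl⟩ := h.exists_exceptionalTable_eq (A i) s
    apply Int.cast_injective (α := ℂ)
    apply mul_left_cancel₀ (hA i)
    simp only [hl]
    simp only [IsCharacterTable.exceptionalTable, Option.elim]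
    push_cast
    rw [h.sum_multiplicity_mul_degree, h.sum_multiplicity_mul_degree]
  · rintro i ⟨_, ⟨l, hl⟩, rfl⟩
    simp [IsCharacterTable.exceptionalTable, h.multiplicity_of_apply_eq_one ho1, hl]
  · intro i x
    have := Fintype.ofFinite (A i →* ℂˣ)
    have hA (a b : A i) : Commute a b := Subtype.ext (hF.commute i a a.2 b b.2)
    rw [← h.sum_multiplicity_eq_degree hA]
    have h1 := hF.sum_multiplicity_comp h i ho1 fun s ↦ (s x : ℤ)
    push_cast
    exact h1
  · have h1 := h.one_le_degree x
    have h2 : h.degree x ≠ 1 := fun h2 ↦ hx (h.eq_of_degree_eq_one hG h2 ho)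
    have h3 : 2 ≤ h.degree x := by omega
    exact_mod_cast h3

end ExceptionalTable

section DeltaFunctions

theorem exists_eq_sub_of_sum_sq_eq_two {X : Type*} [Fintype X] [DecidableEq X] {f d : X → ℤ}
    (hd : ∀ x, 0 < d x) (hf : ∑ x, f x ^ 2 = 2) (hfd : ∑ x, f x * d x = 0) :
    ∃ x y, x ≠ y ∧ ∀ z, f z = (if z = x then 1 else 0) - if z = y then 1 else 0 := by
  have hne : ∃ z, f z ≠ 0 := by
    by_contra! h
    simp [h] at hf
  obtain ⟨z, hz⟩ := hne
  obtain ⟨x, hx⟩ : ∃ x, 0 < f x := by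
    by_contra! h
    have h1 := (Finset.sum_eq_zero_iff_of_nonpos
      fun x _ ↦ mul_nonpos_of_nonpos_of_nonneg (h x) (hd x).le).1 hfd z (Finset.mem_univ z)
    exact hz ((mul_eq_zero.1 h1).resolve_right (hd z).ne')
  obtain ⟨y, hy⟩ : ∃ y, f y < 0 := by
    by_contra! h
    have h1 := (Finset.sum_eq_zero_iff_of_nonneg
      fun x _ ↦ mul_nonneg (h x) (hd x).le).1 hfd z (Finset.mem_univ z)
    exact hz ((mul_eq_zero.1 h1).resolve_right (hd z).ne')
  have hxy : x ≠ y := fun h ↦ by subst h; omega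
  have h2 : f x ^ 2 + f y ^ 2 ≤ 2 := by
    rw [← hf, ← Finset.sum_pair (f := fun x ↦ f x ^ 2) hxy]
    exact Finset.sum_le_univ_sum_of_nonneg fun x ↦ sq_nonneg (f x)
  have hx1 : f x = 1 := by nlinarith
  have hy1 : f y = -1 := by nlinarith
  refine ⟨x, y, hxy, fun t ↦ ?_⟩
  by_cases htx : t = x
  · simp [htx, hx1, hxy]
  by_cases hty : t = y
  · simp [hty, hy1, hxy.symm]
  have h3 : f t ^ 2 + (f x ^ 2 + f y ^ 2) ≤ 2 := by
    rw [← hf, ← Finset.sum_pair (f := fun x ↦ f x ^ 2) hxy,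
      ← Finset.sum_insert (f := fun x ↦ f x ^ 2) (by simp [htx, hty])]
    exact Finset.sum_le_univ_sum_of_nonneg fun x ↦ sq_nonneg (f x)
  simp only [htx, hty, if_false, sub_zero]
  rw [hx1, hy1] at h3
  exact pow_eq_zero_iff two_ne_zero |>.1 (le_antisymm (by linarith) (sq_nonneg _))

theorem exists_eq_add_ite_of_sum_sq_sub_eq_two {X Ω : Type*} [Fintype X] [DecidableEq X]
    [DecidableEq Ω] [Nontrivial Ω] {v : Ω → X → ℤ} {d : X → ℤ} (hd : ∀ x, 0 < d x)
    (hv : ∀ s t, s ≠ t → ∑ x, (v s x - v t x) ^ 2 = 2)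
    (hvd : ∀ s t, ∑ x, (v s x - v t x) * d x = 0) :
    ∃ (ε : ℤ) (p : Ω → X) (m : X → ℤ), (ε = 1 ∨ ε = -1) ∧ Function.Injective p ∧
      ∀ s x, v s x = m x + if x = p s then ε else 0 := by
  obtain ⟨s₀, t₀, hst₀⟩ := exists_pair_ne Ω
  have h1 (s t : Ω) (hst : s ≠ t) := exists_eq_sub_of_sum_sq_eq_two hd (hv s t hst) (hvd s t)
  suffices h2 : ∃ (ε : ℤ) (z : X) (p : Ω → X), (ε = 1 ∨ ε = -1) ∧ ∀ s, s ≠ s₀ → p s ≠ z ∧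
      ∀ x, v s x - v s₀ x = ε * ((if x = p s then 1 else 0) - if x = z then 1 else 0) by
    obtain ⟨ε, z, p, hε, hp⟩ := h2
    refine ⟨ε, Function.update p s₀ z, fun x ↦ v s₀ x - if x = z then ε else 0, hε, ?_, ?_⟩
    · intro s t hst
      by_contra hne
      have h3 := hv s t hne
      by_cases hs : s = s₀
      · subst hs
        rw [Function.update_self, Function.update_of_ne (Ne.symm hne)] at hst
        exact (hp t (Ne.symm hne)).1 hst.symm
      by_cases ht : t = s₀
      · subst ht
        rw [Function.update_self, Function.update_of_ne hne] at hst
        exact (hp s hne).1 hst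
      rw [Function.update_of_ne hs, Function.update_of_ne ht] at hst
      rw [Finset.sum_eq_zero] at h3
      · omega
      · intro x _
        have h4 := (hp s hs).2 x
        have h5 := (hp t ht).2 x
        rw [hst] at h4
        rw [show v s x - v t x = 0 by linarith]
        simp
    · intro s x
      by_cases hs : s = s₀
      · subst hs
        simp
      · have h4 := (hp s hs).2 x
        rw [Function.update_of_ne hs]
        dsimp only
        split_ifs at h4 ⊢ <;> linarith
  have hex (s : Ω) : ∃ x y, s ≠ s₀ →
      x ≠ y ∧ ∀ z, v s z - v s₀ z = (if z = x then 1 else 0) - if z = y then 1 else 0 := by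
    by_cases hs : s = s₀
    · obtain ⟨x, -⟩ := h1 s₀ t₀ hst₀
      exact ⟨x, x, fun h ↦ absurd hs h⟩
    · obtain ⟨x, y, h⟩ := h1 s s₀ hs
      exact ⟨x, y, fun _ ↦ h⟩
  choose x y hxy using hex
  have hor (s t : Ω) (hs : s ≠ s₀) (ht : t ≠ s₀) (hst : s ≠ t) : x s = x t ∨ y s = y t := by
    by_contra! hne
    obtain ⟨a, b, hab, h2⟩ := h1 s t hst
    have h3 := h2 (x s)
    have h4 := h2 (y t)
    have h5 := (hxy s hs).2 (x s)
    have h6 := (hxy s hs).2 (y t)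
    have h7 := (hxy t ht).2 (x s)
    have h8 := (hxy t ht).2 (y t)
    have h9 := (hxy s hs).1
    have h10 := (hxy t ht).1
    simp only [if_true, if_neg hne.1, if_neg h9, if_neg hne.2.symm, if_neg h10.symm] at h5 h6 h7 h8
    grind
  have hand (s t : Ω) (hs : s ≠ s₀) (ht : t ≠ s₀) (hx : x s = x t) (hy : y s = y t) : s = t := by
    by_contra hne
    have h3 := hv s t hne
    rw [Finset.sum_eq_zero] at h3
    · omega
    · intro z _
      have h4 := (hxy s hs).2 z
      have h5 := (hxy t ht).2 z
      rw [hx, hy] at h4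
      rw [show v s z - v t z = 0 by linarith]
      simp
  by_cases hX : ∃ s t, s ≠ s₀ ∧ t ≠ s₀ ∧ s ≠ t ∧ x s = x t
  · obtain ⟨s, t, hs, ht, hst, hx⟩ := hX
    have hx' (u : Ω) (hu : u ≠ s₀) : x u = x s := by
      by_cases hus : u = s
      · rw [hus]
      by_cases hut : u = t
      · rw [hut, hx]
      rcases hor u s hu hs hus with h2 | h2
      · exact h2
      rcases hor u t hu ht hut with h3 | h3
      · rw [h3, hx]
      · exact absurd (hand s t hs ht hx (h2.symm.trans h3)) hst
    refine ⟨-1, x s, y, Or.inr rfl, fun u hu ↦ ⟨?_, fun z ↦ ?_⟩⟩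
    · rw [← hx' u hu]
      exact (hxy u hu).1.symm
    · rw [(hxy u hu).2 z, hx' u hu]
      ring
  · push Not at hX
    refine ⟨1, y t₀, x, Or.inl rfl, fun u hu ↦ ?_⟩
    have h2 : y u = y t₀ := by
      by_cases hut : u = t₀
      · rw [hut]
      exact (hor u t₀ hu hst₀.symm hut).resolve_left (hX u t₀ hu hst₀.symm hut)
    refine ⟨?_, fun z ↦ ?_⟩
    · rw [← h2]
      exact (hxy u hu).1
    · rw [(hxy u hu).2 z, h2, one_mul]

end DeltaFunctions

namespace IsCoherentTable

variable {I X : Type*} [Fintype I] [Fintype X] {Ω : I → Type*} [∀ i, Fintype (Ω i)]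
  {v : ∀ i, Option (Ω i) → X → ℤ} {d : X → ℤ} {a q : I → ℕ} {g : ℕ} {o : X} {C : I → ℤ}
  {D : I → I → ℤ} {K : I → ℤ}

theorem even_card (h : IsCoherentTable v d a q g o C D K) (i : I) : Even (Fintype.card (Ω i)) := by
  have h1 := h.odd_card i
  rw [h.card_eq, add_comm, Nat.odd_add_one, Nat.not_odd_iff_even, Nat.even_mul] at h1
  exact h1.resolve_left (Nat.not_even_iff_odd.2 (h.odd_index i))

theorem two_le_card (h : IsCoherentTable v d a q g o C D K) (i : I) : 2 ≤ Fintype.card (Ω i) := by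
  obtain ⟨r, hr⟩ := h.even_card i
  have h1 := h.one_lt_card i
  rw [h.card_eq] at h1
  have h2 : Fintype.card (Ω i) ≠ 0 := fun h0 ↦ by simp [h0] at h1
  omega

theorem nontrivial (h : IsCoherentTable v d a q g o C D K) (i : I) : Nontrivial (Ω i) :=
  Fintype.one_lt_card_iff_nontrivial.1 (h.two_le_card i)

theorem degree_pos (h : IsCoherentTable v d a q g o C D K) (x : X) : 0 < d x := by
  by_cases hx : x = o
  · rw [hx, h.degree_one]
    exact one_pos
  · have := h.two_le_degree x hx
    omega

open Classical in
theorem exists_eq_add_ite (h : IsCoherentTable v d a q g o C D K) (i : I) :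
    ∃ (ε : ℤ) (p : Ω i → X) (m : X → ℤ), (ε = 1 ∨ ε = -1) ∧ Function.Injective p ∧
      ∀ s x, v i (some s) x = m x + if x = p s then ε else 0 := by
  have := h.nontrivial i
  refine exists_eq_add_ite_of_sum_sq_sub_eq_two h.degree_pos (fun s t hst ↦ ?_) fun s t ↦ ?_
  · have h1 (x : X) : (v i (some s) x - v i (some t) x) ^ 2 = v i (some s) x * v i (some s) x +
        v i (some t) x * v i (some t) x - 2 * (v i (some s) x * v i (some t) x) := by ring
    simp_rw [h1, Finset.sum_sub_distrib, Finset.sum_add_distrib, ← Finset.mul_sum, h.sum_mul_self,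
      h.sum_mul_of_ne i s t hst]
    ring
  · simp_rw [sub_mul, Finset.sum_sub_distrib, h.sum_mul_degree, sub_self]

open Classical in
/-- In a coherent table the elements other than `o` are labelled by the disjoint union of the sets
`Ω i`, and the table is constant on the blocks of this labelling up to signs on the diagonal. -/
theorem exists_labelling (h : IsCoherentTable v d a q g o C D K) :
    ∃ (ε : I → ℤ) (p : (Σ i, Ω i) → X) (b n : I → I → ℤ), (∀ i, ε i = 1 ∨ ε i = -1) ∧
      (∀ σ, p σ ≠ o) ∧ (∀ f : X → ℤ, ∑ x, f x = f o + ∑ σ, f (p σ)) ∧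
      (∀ σ k, v k none (p σ) = b σ.1 k) ∧
      ∀ σ k t, v k (some t) (p σ) = n σ.1 k + if σ = ⟨k, t⟩ then ε k else 0 := by
  choose ε p m hε hp hv using h.exists_eq_add_ite
  have hne (i : I) (s : Ω i) : ∃ t, t ≠ s := by
    have := h.nontrivial i
    exact exists_ne s
  have hε0 (i : I) : ε i ≠ 0 := by rcases hε i with h | h <;> omega
  have hsub (i : I) (s t : Ω i) (f : X → ℤ) :
      ∑ x, v i (some s) x * f x - ∑ x, v i (some t) x * f x = ε i * (f (p i s) - f (p i t)) := by
    rw [← Finset.sum_sub_distrib]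
    simp_rw [hv, add_mul, add_sub_add_left_eq_sub, ite_mul, zero_mul]
    rw [Finset.sum_sub_distrib, Finset.sum_ite_eq', Finset.sum_ite_eq']
    simp
    ring
  have hcross (i j : I) (hij : i ≠ j) (t : Option (Ω j)) (s s' : Ω i) :
      v j t (p i s) = v j t (p i s') := by
    have h1 := hsub i s s' (v j t)
    rw [h.sum_mul_cross i j hij, h.sum_mul_cross i j hij, sub_self] at h1
    exact sub_eq_zero.1 ((mul_eq_zero.1 h1.symm).resolve_left (hε0 i))
  have hdisj (i j : I) (hij : i ≠ j) (s : Ω i) (t : Ω j) : p i s ≠ p j t := by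
    intro heq
    obtain ⟨s', hs'⟩ := hne i s
    obtain ⟨t', ht'⟩ := hne j t
    have h1 := hcross i j hij (some t) s s'
    have h2 := hcross i j hij (some t') s s'
    have h3 : p i s' ≠ p j t := fun h4 ↦ hs' (hp i (h4.trans heq.symm))
    have h4 : p j t ≠ p j t' := fun h4 ↦ ht' (hp j h4).symm
    rw [hv, hv, heq, if_pos rfl, if_neg h3] at h1
    rw [hv, hv, heq, if_neg h4] at h2
    have := hε j
    split_ifs at h2 <;> omega
  have ho (i : I) (s : Ω i) : p i s ≠ o := by
    intro heq
    obtain ⟨s', hs'⟩ := hne i s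
    have h1 := h.apply_some i s
    have h2 := h.apply_some i s'
    rw [hv, if_pos heq.symm] at h1
    rw [hv, if_neg fun h3 ↦ hs' (hp i (heq.trans h3)).symm] at h2
    have := hε0 i
    omega
  let P (σ : Σ i, Ω i) : X := p σ.1 σ.2
  have hP : Function.Injective P := by
    rintro ⟨i, s⟩ ⟨j, t⟩ hst
    by_cases hij : i = j
    · subst hij
      exact congrArg (Sigma.mk i) (hp i hst)
    · exact absurd hst (hdisj i j hij s t)
  let R : Option (Σ i, Ω i) → X := fun σ ↦ σ.elim o P
  have hR : Function.Bijective R := by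
    rw [Fintype.bijective_iff_injective_and_card]
    refine ⟨?_, ?_⟩
    · rintro (_ | σ) (_ | τ) hst
      · rfl
      · exact absurd hst.symm (ho _ _)
      · exact absurd hst (ho _ _)
      · exact congrArg some (hP hst)
    · rw [h.card_eq_sum, Fintype.card_option, Fintype.card_sigma, add_comm]
  have hdiag (i : I) (s s' : Ω i) : v i none (p i s) = v i none (p i s') := by
    have h1 := hsub i s s' (v i none)
    rw [h.sum_mul_some_none, h.sum_mul_some_none, sub_self] at h1
    exact sub_eq_zero.1 ((mul_eq_zero.1 h1.symm).resolve_left (hε0 i))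
  have hm (i j : I) (s s' : Ω i) : m j (p i s) = m j (p i s') := by
    by_cases hij : i = j
    · subst hij
      by_cases hs : s = s'
      · rw [hs]
      have h1 := hsub i s s' (v i (some s))
      rw [h.sum_mul_self, h.sum_mul_of_ne i s' s (Ne.symm hs), hv, hv, if_pos rfl,
        if_neg fun h2 ↦ hs (hp i h2).symm] at h1
      rcases hε i with h2 | h2 <;> rw [h2] at h1 <;> omega
    · obtain ⟨t⟩ := (h.nontrivial j).to_nonempty
      have h1 := hcross i j hij (some t) s s'
      rwa [hv, hv, if_neg (hdisj i j hij s t), if_neg (hdisj i j hij s' t), add_zero,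
        add_zero] at h1
  have hb (i j : I) (s s' : Ω i) : v j none (p i s) = v j none (p i s') := by
    by_cases hij : i = j
    · subst hij
      exact hdiag i s s'
    · exact hcross i j hij none s s'
  let s₀ (i : I) : Ω i := (h.nontrivial i).to_nonempty.some
  refine ⟨ε, P, fun i j ↦ v j none (p i (s₀ i)), fun i j ↦ m j (p i (s₀ i)), hε,
    fun σ ↦ ho _ _, fun f ↦ ?_, fun σ k ↦ hb _ _ _ _, fun σ k t ↦ ?_⟩
  · rw [← hR.sum_comp, Fintype.sum_option]
    rfl
  · change v k (some t) (p σ.1 σ.2) = _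
    rw [hv, hm σ.1 k σ.2 (s₀ σ.1)]
    congr 1
    exact if_congr ⟨fun h1 ↦ hP h1, fun h1 ↦ congrArg P h1⟩ rfl rfl

end IsCoherentTable

theorem mul_sq_sub_two_mul_nonneg {w : ℕ} (hw : 2 ≤ w) {ε : ℤ} (hε : ε = 1 ∨ ε = -1) (c : ℤ) :
    0 ≤ w * c ^ 2 - 2 * ε * c := by
  have hw' : (2 : ℤ) ≤ w := by exact_mod_cast hw
  have h1 : 0 ≤ c * (c - ε) := by
    rcases hε with rfl | rfl
    · rcases le_or_gt c 0 with h | h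
      · exact mul_nonneg_of_nonpos_of_nonpos h (by omega)
      · exact mul_nonneg h.le (by omega)
    · rcases lt_or_ge c 0 with h | h
      · exact mul_nonneg_of_nonpos_of_nonpos h.le (by omega)
      · exact mul_nonneg h (by omega)
  nlinarith [sq_nonneg c]

namespace IsCoherentTable

variable {I X : Type*} [Fintype I] [Fintype X] {Ω : I → Type*} [∀ i, Fintype (Ω i)]
  {v : ∀ i, Option (Ω i) → X → ℤ} {d : X → ℤ} {a q : I → ℕ} {g : ℕ} {o : X} {C : I → ℤ}
  {D : I → I → ℤ} {K : I → ℤ}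

open Classical in
/-- The integers `c i k` are the values on the `i`-th block of the difference of the row of
the trivial character and the generic part of the other rows of the `k`-th member. -/
theorem exists_matrix (h : IsCoherentTable v d a q g o C D K) :
    ∃ c : I → I → ℤ, (∀ i k, i ≠ k → c i k ≠ 0 ∨ c k i ≠ 0) ∧
      (∀ k, ∑ l ∈ Finset.univ.erase k, Fintype.card (Ω l) * c l k ^ 2 ≤ (q k - 1 : ℤ)) ∧
      ∀ k, ∃ e : ℤ, 2 ≤ e ∧ ∑ i ∈ Finset.univ.erase k,
        (Fintype.card (Ω i) : ℚ) / a i * c k i ^ 2 ≤ q k / a k - e ^ 2 / g := by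
  obtain ⟨ε, p, b, n, hε, hp, hsum, hb, hn⟩ := h.exists_labelling
  have hε2 (i : I) : ε i * ε i = 1 := by rcases hε i with h | h <;> simp [h]
  have hc (k : I) (t : Ω k) (σ : Σ i, Ω i) : v k none (p σ) - v k (some t) (p σ) =
      (b σ.1 k - n σ.1 k) - if σ = ⟨k, t⟩ then ε k else 0 := by
    rw [hb, hn]
    ring
  have hinner (i k : I) (s : Ω i) (t : Ω k) :
      ∑ x, (v i none x - v i (some s) x) * (v k none x - v k (some t) x) =
        1 + ∑ l, Fintype.card (Ω l) * ((b l i - n l i) * (b l k - n l k)) -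
          ε i * (b i k - n i k) - ε k * (b k i - n k i) +
          if (⟨i, s⟩ : Σ i, Ω i) = ⟨k, t⟩ then ε i * ε k else 0 := by
    have h1 (σ : Σ i, Ω i) : (v i none (p σ) - v i (some s) (p σ)) *
        (v k none (p σ) - v k (some t) (p σ)) = (b σ.1 i - n σ.1 i) * (b σ.1 k - n σ.1 k) -
          (if σ = ⟨i, s⟩ then ε i * (b σ.1 k - n σ.1 k) else 0) -
          (if σ = ⟨k, t⟩ then ε k * (b σ.1 i - n σ.1 i) else 0) +
          if σ = ⟨i, s⟩ then if σ = ⟨k, t⟩ then ε i * ε k else 0 else 0 := by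
      rw [hc, hc]
      split_ifs <;> ring
    rw [hsum, Finset.sum_congr rfl fun σ _ ↦ h1 σ, h.apply_none, h.apply_none, h.apply_some,
      h.apply_some, Finset.sum_add_distrib, Finset.sum_sub_distrib, Finset.sum_sub_distrib,
      Finset.sum_ite_eq', Finset.sum_ite_eq', Finset.sum_ite_eq', Fintype.sum_sigma]
    simp only [Finset.mem_univ, if_true, Finset.sum_const, Finset.card_univ, nsmul_eq_mul]
    ring
  refine ⟨fun i k ↦ b i k - n i k, fun i k hik ↦ ?_, fun k ↦ ?_, fun k ↦ ?_⟩
  · by_contra! h0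
    obtain ⟨s⟩ := (h.nontrivial i).to_nonempty
    obtain ⟨t⟩ := (h.nontrivial k).to_nonempty
    have h1 := hinner i k s t
    rw [if_neg fun h2 : (⟨i, s⟩ : Σ i, Ω i) = ⟨k, t⟩ ↦ hik (congrArg Sigma.fst h2),
      h0.1, h0.2] at h1
    have h3 : ∑ x, (v i none x - v i (some s) x) * (v k none x - v k (some t) x) = 0 := by
      simp_rw [sub_mul, mul_sub, Finset.sum_sub_distrib, h.sum_mul_cross i k hik]
      ring
    have h2 : (2 : ℤ) ∣ ∑ l, (Fintype.card (Ω l) : ℤ) * ((b l i - n l i) * (b l k - n l k)) :=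
      Finset.dvd_sum fun l _ ↦ Dvd.dvd.mul_right
        (by exact_mod_cast (h.even_card l).two_dvd) _
    rw [h3] at h1
    omega
  · obtain ⟨t⟩ := (h.nontrivial k).to_nonempty
    have h1 := hinner k k t t
    rw [if_pos rfl, hε2] at h1
    have h2 : ∑ x, (v k none x - v k (some t) x) * (v k none x - v k (some t) x) = q k + 1 := by
      have h3 (x : X) : (v k none x - v k (some t) x) * (v k none x - v k (some t) x) =
          v k none x * v k none x + v k (some t) x * v k (some t) x -
            2 * (v k (some t) x * v k none x) := by ring
      simp_rw [h3, Finset.sum_sub_distrib, Finset.sum_add_distrib, ← Finset.mul_sum]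
      rw [h.sum_mul_none, h.sum_mul_self, h.sum_mul_some_none]
      ring
    rw [h2, ← Finset.add_sum_erase _ _ (Finset.mem_univ k)] at h1
    have h3 := mul_sq_sub_two_mul_nonneg (h.two_le_card k) (hε k) (b k k - n k k)
    simp_rw [← sq] at h1
    linarith
  · obtain ⟨t⟩ := (h.nontrivial k).to_nonempty
    have h1 := h.sum_row (p ⟨k, t⟩)
    refine ⟨d (p ⟨k, t⟩), h.two_le_degree _ (hp _), ?_⟩
    rw [← Finset.add_sum_erase _ _ (Finset.mem_univ k)] at h1
    have hq (i : I) : (q i : ℚ) ≠ 0 := by exact_mod_cast (h.odd_index i).pos.ne'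
    have ha (i : I) : (a i : ℚ) ≠ 0 := by exact_mod_cast (h.odd_card i).pos.ne'
    have haq (i : I) : (a i : ℚ) = 1 + q i * Fintype.card (Ω i) := by exact_mod_cast h.card_eq i
    have hoff (i : I) (hi : i ∈ Finset.univ.erase k) :
        (a i * ((v i none (p ⟨k, t⟩) : ℚ) ^ 2 + q i * ∑ s, (v i (some s) (p ⟨k, t⟩) : ℚ) ^ 2) -
          (d (p ⟨k, t⟩) : ℚ) ^ 2) / (a i * q i) =
        (Fintype.card (Ω i) : ℚ) / a i * ((b k i - n k i : ℤ) : ℚ) ^ 2 := by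
      have hik (s : Ω i) : (⟨k, t⟩ : Σ i, Ω i) ≠ ⟨i, s⟩ :=
        fun h2 ↦ Finset.ne_of_mem_erase hi (congrArg Sigma.fst h2).symm
      rw [h.degree_eq i, div_eq_iff (mul_ne_zero (ha i) (hq i))]
      simp_rw [hn, if_neg (hik _), hb, add_zero, Finset.sum_const, Finset.card_univ, nsmul_eq_mul]
      push_cast
      have h3 := haq i
      have h4 := ha i
      field_simp
      rw [h3]
      ring
    rw [Finset.sum_congr rfl hoff] at h1
    have hdiag : 1 - (q k : ℚ) / a k ≤
        (a k * ((v k none (p ⟨k, t⟩) : ℚ) ^ 2 + q k * ∑ s, (v k (some s) (p ⟨k, t⟩) : ℚ) ^ 2) -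
          (d (p ⟨k, t⟩) : ℚ) ^ 2) / (a k * q k) := by
      have hite : ∑ s, (if (⟨k, t⟩ : Σ i, Ω i) = ⟨k, s⟩ then ε k else 0) = ε k := by
        simp
      have hlin : ∑ s, v k (some s) (p ⟨k, t⟩) = Fintype.card (Ω k) * n k k + ε k := by
        simp_rw [hn, Finset.sum_add_distrib, hite]
        simp
      have hsq : ∑ s, v k (some s) (p ⟨k, t⟩) ^ 2 =
          Fintype.card (Ω k) * n k k ^ 2 + 2 * n k k * ε k + 1 := by
        have h2 (s : Ω k) : v k (some s) (p ⟨k, t⟩) ^ 2 = n k k ^ 2 +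
            (2 * n k k + ε k) * if (⟨k, t⟩ : Σ i, Ω i) = ⟨k, s⟩ then ε k else 0 := by
          rw [hn]
          split_ifs <;> ring
        simp_rw [h2, Finset.sum_add_distrib, ← Finset.mul_sum, hite, add_mul, hε2]
        simp
        ring
      have hsq' : ∑ s, (v k (some s) (p ⟨k, t⟩) : ℚ) ^ 2 =
          Fintype.card (Ω k) * n k k ^ 2 + 2 * n k k * ε k + 1 := by
        exact_mod_cast hsq
      have hquad : (0 : ℚ) ≤ Fintype.card (Ω k) * (b k k - n k k) ^ 2 -
          2 * ε k * (b k k - n k k) := by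
        exact_mod_cast mul_sq_sub_two_mul_nonneg (h.two_le_card k) (hε k) (b k k - n k k)
      have hε2' : (ε k : ℚ) * ε k = 1 := by exact_mod_cast hε2 k
      have hq0 : (0 : ℚ) < q k := by exact_mod_cast (h.odd_index k).pos
      have ha0 : (0 : ℚ) < a k := by exact_mod_cast (h.odd_card k).pos
      have h2 : (1 - (q k : ℚ) / a k) * (a k * q k) = q k * (a k - q k) := by
        field_simp
      rw [le_div_iff₀ (mul_pos ha0 hq0), h2, hsq', h.degree_eq k, hlin, hb]
      push_cast
      have h3 := haq k
      have h4 := mul_nonneg hq0.le hquad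
      rw [h3]
      linear_combination h4 + (q k : ℚ) ^ 2 * hε2'
    linarith

theorem elim (h : IsCoherentTable v d a q g o C D K) [Nonempty I] : False := by
  classical
  obtain ⟨c, hc, hcol, hrow⟩ := h.exists_matrix
  obtain ⟨k, hk⟩ := Finite.exists_min q
  obtain ⟨e, he, hrow⟩ := hrow k
  have hg : (0 : ℚ) < g := by exact_mod_cast h.card_pos
  have hq : (1 : ℚ) ≤ q k := by exact_mod_cast (h.odd_index k).pos
  have ha (i : I) : (0 : ℚ) < a i := by exact_mod_cast (h.odd_card i).pos
  have hw (i : I) : (2 : ℚ) ≤ Fintype.card (Ω i) := by exact_mod_cast h.two_le_card i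
  have haq (i : I) : (a i : ℚ) = 1 + q i * Fintype.card (Ω i) := by exact_mod_cast h.card_eq i
  have hle (i : I) : 2 * (q k : ℚ) + 1 ≤ a i := by
    have h1 : (q k : ℚ) ≤ q i := by exact_mod_cast hk i
    rw [haq]
    nlinarith [hw i]
  have h2q : (0 : ℚ) < 2 * q k + 1 := by linarith
  have hone (z : ℤ) (hz : z ≠ 0) : (1 : ℚ) ≤ z ^ 2 := by
    have : 1 ≤ z ^ 2 := sq_pos_of_ne_zero hz
    exact_mod_cast this
  have hterm (i : I) (hi : i ∈ Finset.univ.erase k) : (Fintype.card (Ω i) : ℚ) / a i ≤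
      (Fintype.card (Ω i) : ℚ) / a i * c k i ^ 2 +
        (Fintype.card (Ω i) * c i k ^ 2 : ℤ) / (2 * q k + 1) := by
    have hpos : (0 : ℚ) ≤ Fintype.card (Ω i) / a i := by positivity
    rcases hc k i (Finset.ne_of_mem_erase hi).symm with h1 | h1
    · refine le_add_of_le_of_nonneg (le_mul_of_one_le_right hpos (hone _ h1)) ?_
      push_cast
      positivity
    · refine le_add_of_nonneg_of_le (by positivity) ?_
      push_cast
      have h2 := hone _ h1
      refine div_le_div₀ (by positivity) ?_ h2q (hle i)
      exact le_mul_of_one_le_right (by positivity) h2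
  have hsum := Finset.sum_le_sum hterm
  rw [Finset.sum_add_distrib, ← Finset.sum_div] at hsum
  have hmass := h.sum_mass
  rw [← Finset.add_sum_erase _ _ (Finset.mem_univ k)] at hmass
  have hcol' : (∑ i ∈ Finset.univ.erase k, ((Fintype.card (Ω i) * c i k ^ 2 : ℤ) : ℚ)) /
      (2 * q k + 1) ≤ (q k - 1) / (2 * q k + 1) := by
    refine div_le_div_of_nonneg_right ?_ h2q.le
    exact_mod_cast hcol k
  have hmain : (Fintype.card (Ω k) : ℚ) / a k + q k / a k ≤ (2 + q k) / (2 * q k + 1) := by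
    rw [← add_div, div_le_div_iff₀ (ha k) h2q, haq]
    nlinarith [mul_nonneg (sub_nonneg.2 (hw k)) (sub_nonneg.2 hq),
      mul_nonneg (mul_nonneg (sub_nonneg.2 (hw k)) (sub_nonneg.2 hq)) (sub_nonneg.2 hq)]
  have hadd : (2 + (q k : ℚ)) / (2 * q k + 1) + (q k - 1) / (2 * q k + 1) = 1 := by
    field_simp
    ring
  have he2 : (e : ℚ) ^ 2 / g ≤ 1 / g := by linarith
  rw [div_le_div_iff_of_pos_right hg] at he2
  have he' : (2 : ℚ) ≤ e := by exact_mod_cast he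
  nlinarith

end IsCoherentTable

theorem IsCCFamily.even_card {G I : Type*} [Group G] [Finite G] [Finite I] [Nonempty I]
    {A : I → Subgroup G} {q : I → ℕ} (hF : IsCCFamily A q) (hG : commutator G = ⊤) :
    Even (Nat.card G) := by
  have := Fintype.ofFinite G
  have := Fintype.ofFinite I
  have (i : I) := Fintype.ofFinite (A i)
  by_contra hodd
  obtain ⟨n, χ, h⟩ := exists_isCharacterTable G
  obtain ⟨o, ho⟩ := h.exists_degree_eq_one
  have (i : I) : Fintype (h.exceptional (A i)) := (Set.finite_range _).fintype
  obtain ⟨C, D, K, hT⟩ := hF.isCoherentTable h hG (Nat.not_even_iff_odd.1 hodd) ho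
  exact hT.elim

/-- A finite minimal simple group which is biminimal non-nilpotent is isomorphic to $A_5$. -/
theorem stmt_2 {G : Type*} [Group G] [Finite G]
    (hsimple : IsSimpleGroup G) (hnonab : ¬ Abelian G)
    (hminimal : ∀ H : Subgroup G, H ≠ ⊤ → IsSolvable H)
    (hbi : BiminimalNonNilpotent G) :
    Nonempty (G ≃* ↥(alternatingGroup (Fin 5))) := by
  have hS := isSchmidtSimple_of_biminimalNonNilpotent hsimple hnonab hminimal hbi
  obtain ⟨A, q, y, hF⟩ := hS.exists_isSchmidtFamily
  have hne : Nonempty (Nat.card G).primeFactors := by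
    have := hsimple.toNontrivial
    exact (Nat.nonempty_primeFactors.2 Finite.one_lt_card).to_subtype
  have heven := hF.toIsCCFamily.even_card hS.commutator_eq_top
  exact hF.nonempty_mulEquiv_alternatingGroup hsimple
    (i := ⟨2, Nat.mem_primeFactors.2 ⟨Nat.prime_two, heven.two_dvd, Nat.card_pos.ne'⟩⟩) rfl
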